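/- Let C ⊆ ℝ³ be a regular strictly convex bounded domain, let Γ ⊆ ∂C be a smooth Jordan curve, and let ε > 0. Then there exists a complete conformal minimal immersion ψ : 𝔻 → C of the open unit disk 𝔻 into C that is proper in C and whose limit set ψ(∂𝔻) = closure(ψ(𝔻)) \ ψ(𝔻) is a nonempty compact set satisfying δ^H(ψ(∂𝔻), Γ) < ε. -/

import Mathlib

open Set Metric Function

noncomputable section

/-- ℝ³, identified with `EuclideanSpace ℝ (Fin 3)`. -/
abbrev R3 := EuclideanSpace ℝ (Fin 3)

/-- A real function on `ℂ ≃ ℝ²` is harmonic on a set if its Laplacian vanishes there. -/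
def HarmOn (f : ℂ → ℝ) (Ω : Set ℂ) : Prop :=
  ∀ z ∈ Ω,
    fderiv ℝ (fun w => fderiv ℝ f w 1) z 1 +
      fderiv ℝ (fun w => fderiv ℝ f w Complex.I) z Complex.I = 0

/-- A conformal minimal immersion on an open set `Ω ⊆ ℂ`: a smooth map whose coordinate
functions are harmonic and whose real derivative at each point of `Ω` is a positive scalar
multiple of a linear isometry (hence injective and conformal). -/
def ConfMinImmOn (X : ℂ → R3) (Ω : Set ℂ) : Prop :=
  ContDiffOn ℝ (⊤ : ℕ∞) X Ω ∧
  (∀ i : Fin 3, HarmOn (fun z => X z i) Ω) ∧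
  ∀ z ∈ Ω, ∃ c : ℝ, 0 < c ∧ ∀ v : ℂ, ‖fderiv ℝ X z v‖ = c * ‖v‖

/-- A path `γ : [0,1) → Ω` that eventually leaves every compact subset of `Ω`. -/
def DivergentPath (Ω : Set ℂ) (γ : ℝ → ℂ) : Prop :=
  ContinuousOn γ (Ico 0 1) ∧ MapsTo γ (Ico 0 1) Ω ∧
  ∀ K : Set ℂ, IsCompact K → K ⊆ Ω →
    ∃ t₀ ∈ Ico (0:ℝ) 1, ∀ t ∈ Ico t₀ 1, γ t ∉ K

/-- Completeness of an immersion `X` on `Ω`: every divergent path has image of infinite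
total variation (length). -/
def CompleteOn (X : ℂ → R3) (Ω : Set ℂ) : Prop :=
  ∀ γ : ℝ → ℂ, DivergentPath Ω γ → eVariationOn (X ∘ γ) (Ico 0 1) = ⊤

/-- Properness of `ψ : Ω → D`: preimages of compact subsets of `D` are compact. -/
def ProperIn (ψ : ℂ → R3) (Ω : Set ℂ) (D : Set R3) : Prop :=
  ∀ K : Set R3, IsCompact K → K ⊆ D → IsCompact (Ω ∩ ψ ⁻¹' K)

/-- The limit set of a map on the open unit disk. -/
def limitSet (ψ : ℂ → R3) : Set R3 :=
  closure (ψ '' ball (0:ℂ) 1) \ ψ '' ball (0:ℂ) 1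

/-- A regular strictly convex bounded domain: a nonempty bounded convex open set satisfying
uniform interior and exterior sphere conditions. -/
def RegStrictConvexDomain (C : Set R3) : Prop :=
  C.Nonempty ∧ IsOpen C ∧ Convex ℝ C ∧ Bornology.IsBounded C ∧
  ∃ r R : ℝ, 0 < r ∧ r ≤ R ∧
    ∀ p ∈ frontier C,
      (∃ x, p ∈ sphere x r ∧ closedBall x r ⊆ closure C) ∧
      (∃ y, p ∈ sphere y R ∧ closure C ⊆ closedBall y R)

/-- `R` is a uniform exterior sphere radius for `E`. -/
def ExtSphereRadius (E : Set R3) (R : ℝ) : Prop :=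
  0 < R ∧ ∀ p ∈ frontier E, ∃ y, p ∈ sphere y R ∧ closure E ⊆ closedBall y R

/-- `γ : ℝ → ℝ³`, `1`-periodic, parametrizes a smooth Jordan curve: it is `C^∞`, injective on
a period, and has nowhere-vanishing derivative. -/
def SmoothJordan (γ : ℝ → R3) : Prop :=
  ContDiff ℝ (⊤ : ℕ∞) γ ∧ Periodic γ 1 ∧
  (∀ s ∈ Ico (0:ℝ) 1, ∀ t ∈ Ico (0:ℝ) 1, γ s = γ t → s = t) ∧
  ∀ t, deriv γ t ≠ 0

/-- `p : ℝ → ℂ`, `1`-periodic, parametrizes a polygon: an injective piecewise-linear loop. -/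
def PolygonParam (p : ℝ → ℂ) : Prop :=
  Continuous p ∧ Periodic p 1 ∧
  (∀ s ∈ Ico (0:ℝ) 1, ∀ t ∈ Ico (0:ℝ) 1, p s = p t → s = t) ∧
  ∃ n : ℕ, 0 < n ∧ ∀ k : ℕ, k < n → ∀ s ∈ Icc ((k:ℝ)/n) ((k+1)/n),
    p s = p (k/n) + (((s - k/n) * n) : ℝ) • (p ((k+1)/n) - p (k/n))

/-- The interior region of a polygon `P ⊆ ℂ`: the union of the bounded connected components
of the complement of `P`. -/
def polyInt (P : Set ℂ) : Set ℂ :=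
  {z | z ∉ P ∧ Bornology.IsBounded (connectedComponentIn Pᶜ z)}

/-- The intrinsic distance, induced by `X`, within `W` from a point `z` to a set `S`:
the infimum of the lengths (total variations) of `X ∘ α` over continuous paths `α` in `W`
joining `z` to `S`. -/
def intrinsicDist (X : ℂ → R3) (W : Set ℂ) (z : ℂ) (S : Set ℂ) : ENNReal :=
  ⨅ (α : ℝ → ℂ) (_ : ContinuousOn α (Icc 0 1)) (_ : MapsTo α (Icc 0 1) W)
    (_ : α 0 = z) (_ : α 1 ∈ S), eVariationOn (X ∘ α) (Icc 0 1)

/-- Two `1`-periodic loops in `ℝ³` are freely homotopic within a set `T`. -/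
def HomotopicLoopsIn (T : Set R3) (f g : ℝ → R3) : Prop :=
  ∃ H : ℝ × ℝ → R3, Continuous H ∧
    (∀ t, H (t, 0) = f t) ∧ (∀ t, H (t, 1) = g t) ∧
    (∀ t s, H (t + 1, s) = H (t, s)) ∧
    ∀ t s, s ∈ Icc (0:ℝ) 1 → H (t, s) ∈ T

/-- The inner parallel body `E₋ₜ` of a convex open set. -/
def innerParallel (E : Set R3) (t : ℝ) : Set R3 :=
  {x ∈ E | t < infDist x Eᶜ}

namespace NullDisc

open Filter Topology MeasureTheory

/-- The squared Hermitian norm of a spinor. -/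
def spinSq (s : ℂ × ℂ) : ℝ := ‖s.1‖ ^ 2 + ‖s.2‖ ^ 2

/-- The null vector of `ℂ³` attached to a spinor. -/
def nullVec (s : ℂ × ℂ) : Fin 3 → ℂ :=
  ![s.1 ^ 2 - s.2 ^ 2, Complex.I * (s.1 ^ 2 + s.2 ^ 2), 2 * s.1 * s.2]

/-- The real linear map `v ↦ Re (v • c)`. -/
def reMap (c : Fin 3 → ℂ) : ℂ →L[ℝ] R3 :=
  ((EuclideanSpace.equiv (Fin 3) ℝ).symm : (Fin 3 → ℝ) →L[ℝ] R3).comp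
    (ContinuousLinearMap.pi fun i =>
      Complex.reCLM.comp ((c i • (1 : ℂ →L[ℂ] ℂ)).restrictScalars ℝ))

@[simp] lemma reMap_apply (c : Fin 3 → ℂ) (v : ℂ) (i : Fin 3) : reMap c v i = (c i * v).re := by
  simp [reMap]

lemma reMap_sub (c d : Fin 3 → ℂ) : reMap (c - d) = reMap c - reMap d := by
  ext v i
  simp
  ring

lemma reMap_add (c d : Fin 3 → ℂ) : reMap (c + d) = reMap c + reMap d := by
  ext v i
  simp
  ring

lemma reMap_smul_apply (w : ℂ) (c : Fin 3 → ℂ) (v : ℂ) :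
    reMap (w • c) v = reMap c (w * v) := by
  ext i
  simp [mul_assoc, mul_left_comm]

lemma norm_reMap_apply_le (c : Fin 3 → ℂ) (v : ℂ) : ‖reMap c v‖ ≤ 2 * ‖c‖ * ‖v‖ := by
  refine le_of_sq_le_sq ?_ (by positivity)
  have h : ∀ i, (reMap c v i) ^ 2 ≤ (‖c‖ * ‖v‖) ^ 2 := fun i => by
    rw [reMap_apply, ← sq_abs]
    gcongr
    calc |(c i * v).re| ≤ ‖c i * v‖ := Complex.abs_re_le_norm _
      _ = ‖c i‖ * ‖v‖ := norm_mul _ _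
      _ ≤ _ := by gcongr; exact norm_le_pi_norm c i
  rw [EuclideanSpace.norm_sq_eq, Fin.sum_univ_three]
  simp only [Real.norm_eq_abs, sq_abs]
  nlinarith [h 0, h 1, h 2, sq_nonneg (‖c‖ * ‖v‖)]

lemma norm_reMap_le (c : Fin 3 → ℂ) : ‖reMap c‖ ≤ 2 * ‖c‖ :=
  ContinuousLinearMap.opNorm_le_bound _ (by positivity) (norm_reMap_apply_le c)

lemma continuous_reMap : Continuous reMap := by
  refine (LipschitzWith.of_dist_le_mul (K := 2) fun c d => ?_).continuous
  rw [dist_eq_norm, dist_eq_norm, ← reMap_sub]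
  exact norm_reMap_le _

lemma norm_reMap_nullVec (s : ℂ × ℂ) (v : ℂ) : ‖reMap (nullVec s) v‖ = spinSq s * ‖v‖ := by
  have h0 : 0 ≤ spinSq s * ‖v‖ := by unfold spinSq; positivity
  rw [← sq_eq_sq₀ (norm_nonneg _) h0, EuclideanSpace.norm_sq_eq, Fin.sum_univ_three]
  simp only [Real.norm_eq_abs, sq_abs, mul_pow, spinSq, Complex.sq_norm, Complex.normSq_apply,
    reMap_apply]
  obtain ⟨⟨a1, a2⟩, ⟨b1, b2⟩⟩ := s
  obtain ⟨v1, v2⟩ := v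
  simp [nullVec, pow_two]
  ring

lemma inner_reMap (c : Fin 3 → ℂ) (v : ℂ) (n : R3) :
    inner ℝ (reMap c v) n = ((∑ i, c i * (n i : ℂ)) * v).re := by
  simp [PiLp.inner_apply, Fin.sum_univ_three]
  ring

lemma spinSq_nonneg (s : ℂ × ℂ) : 0 ≤ spinSq s := by unfold spinSq; positivity

lemma spinSq_pos {s : ℂ × ℂ} (h : s ≠ 0) : 0 < spinSq s := by
  have : s.1 ≠ 0 ∨ s.2 ≠ 0 := by
    by_contra! h'
    exact h (Prod.ext h'.1 h'.2)
  unfold spinSq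
  rcases this with h | h
  · have := norm_pos_iff.2 h; positivity
  · have := norm_pos_iff.2 h; positivity

lemma continuous_spinSq : Continuous spinSq := by unfold spinSq; fun_prop

lemma continuous_nullVec : Continuous nullVec := by
  unfold nullVec
  refine continuous_pi fun i => ?_
  fin_cases i <;> simp <;> fun_prop

/-- The polarization of `nullVec`, up to a factor two. -/
def nullPolar (s t : ℂ × ℂ) : Fin 3 → ℂ :=
  ![s.1 * t.1 - s.2 * t.2, Complex.I * (s.1 * t.1 + s.2 * t.2), s.1 * t.2 + s.2 * t.1]

lemma nullVec_add_smul (s t : ℂ × ℂ) (c : ℂ) :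
    nullVec (s + c • t) = nullVec s + (2 * c) • nullPolar s t + c ^ 2 • nullVec t := by
  ext i
  fin_cases i <;> simp [nullVec, nullPolar] <;> ring

lemma nullVec_smul (c : ℂ) (s : ℂ × ℂ) : nullVec (c • s) = c ^ 2 • nullVec s := by
  ext i
  fin_cases i <;> simp [nullVec] <;> ring

lemma norm_nullPolar_le (s t : ℂ × ℂ) : ‖nullPolar s t‖ ≤ 2 * ‖s‖ * ‖t‖ := by
  have h1 : ∀ a b c d : ℂ, ‖a‖ ≤ ‖s‖ → ‖c‖ ≤ ‖s‖ → ‖b‖ ≤ ‖t‖ → ‖d‖ ≤ ‖t‖ →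
      ‖a * b‖ + ‖c * d‖ ≤ 2 * ‖s‖ * ‖t‖ := fun a b c d ha hc hb hd => by
    rw [norm_mul, norm_mul]
    have := mul_le_mul ha hb (norm_nonneg _) (norm_nonneg _)
    have := mul_le_mul hc hd (norm_nonneg _) (norm_nonneg _)
    linarith
  refine (pi_norm_le_iff_of_nonneg (by positivity)).2 fun i => ?_
  fin_cases i
  · exact (norm_sub_le _ _).trans
      (h1 _ _ _ _ (norm_fst_le _) (norm_snd_le _) (norm_fst_le _) (norm_snd_le _))
  · simp only [nullPolar]
    simpa using (norm_add_le _ _).trans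
      (h1 _ _ _ _ (norm_fst_le s) (norm_snd_le s) (norm_fst_le t) (norm_snd_le t))
  · exact (norm_add_le _ _).trans
      (h1 _ _ _ _ (norm_fst_le _) (norm_snd_le _) (norm_snd_le _) (norm_fst_le _))

lemma spinSq_add_smul_ge (s t : ℂ × ℂ) (c : ℂ) :
    spinSq s + ‖c‖ ^ 2 * spinSq t - 4 * ‖c‖ * ‖s‖ * ‖t‖ ≤ spinSq (s + c • t) := by
  have h : ∀ a b : ℂ, ‖a‖ ≤ ‖s‖ → ‖b‖ ≤ ‖t‖ →
      ‖a‖ ^ 2 + ‖c‖ ^ 2 * ‖b‖ ^ 2 - 2 * ‖c‖ * ‖s‖ * ‖t‖ ≤ ‖a + c * b‖ ^ 2 := fun a b ha hb => by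
    have h1 : |‖a‖ - ‖c * b‖| ≤ ‖a + c * b‖ := by
      simpa using abs_norm_sub_norm_le a (-(c * b))
    have h2 := pow_le_pow_left₀ (abs_nonneg _) h1 2
    rw [sq_abs, norm_mul] at h2
    have h3 := mul_le_mul ha hb (norm_nonneg _) (norm_nonneg _)
    nlinarith [mul_le_mul_of_nonneg_left h3 (norm_nonneg c)]
  have h1 := h s.1 t.1 (norm_fst_le _) (norm_fst_le _)
  have h2 := h s.2 t.2 (norm_snd_le _) (norm_snd_le _)
  simp only [spinSq, Prod.fst_add, Prod.snd_add, Prod.smul_fst, Prod.smul_snd, smul_eq_mul]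
  nlinarith

/-- `X` is, on the disc of radius `R`, the real part of a null curve with spinor `s`. -/
def Spin (R : ℝ) (s : ℂ → ℂ × ℂ) (X : ℂ → R3) : Prop :=
  DifferentiableOn ℂ s (ball 0 R) ∧
    ∀ z ∈ ball (0 : ℂ) R, HasFDerivAt X (reMap (nullVec (s z))) z

lemma differentiable_nullVec : Differentiable ℂ nullVec := by
  refine differentiable_pi.2 fun i => ?_
  fin_cases i <;> simp [nullVec] <;> fun_prop

lemma hasFDerivAt_reMap_one {G : ℂ → Fin 3 → ℂ} {G' : Fin 3 → ℂ} {z : ℂ}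
    (h : HasDerivAt G G' z) : HasFDerivAt (fun z => reMap (G z) 1) (reMap G') z := by
  rw [← hasFDerivWithinAt_univ, hasFDerivWithinAt_euclidean]
  intro i
  rw [hasFDerivWithinAt_univ]
  have h1 := Complex.reCLM.hasFDerivAt.comp z
    (((hasDerivAt_pi.1 h) i).hasFDerivAt.restrictScalars ℝ)
  have hL : (PiLp.proj 2 (fun _ : Fin 3 => ℝ) i).comp (reMap G') =
      Complex.reCLM.comp (((ContinuousLinearMap.toSpanSingleton ℂ (G' i))).restrictScalars ℝ) := by
    ext v
    simp [mul_comm]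
  have hf : (fun z => reMap (G z) 1 i) = Complex.reCLM ∘ fun z => G z i := by
    ext z
    simp
  erw [hL, hf]
  exact h1

lemma exists_spin {R : ℝ} {s : ℂ → ℂ × ℂ} (hs : DifferentiableOn ℂ s (ball 0 R)) (x₀ : R3) :
    ∃ X, Spin R s X ∧ X 0 = x₀ := by
  have h : ∀ i, ∃ F : ℂ → ℂ, ∀ z ∈ ball (0 : ℂ) R, HasDerivAt F (nullVec (s z) i) z := fun i => by
    have : DifferentiableOn ℂ (fun z => nullVec (s z) i) (ball 0 R) := fun z hz =>
      (differentiable_pi.1 differentiable_nullVec i _).comp_differentiableWithinAt z (hs z hz)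
    obtain ⟨F, hF⟩ := this.isExactOn_ball
    exact ⟨F, hF⟩
  choose F hF using h
  refine ⟨fun z => reMap (fun i => F i z) 1 + (x₀ - reMap (fun i => F i 0) 1),
    ⟨hs, fun z hz => ?_⟩, by simp⟩
  exact (hasFDerivAt_reMap_one (hasDerivAt_pi.2 fun i => hF i z hz)).add_const _

lemma nullVec_sub_nullVec (s t : ℂ × ℂ) : nullVec s - nullVec t = nullPolar (s - t) (s + t) := by
  ext i
  fin_cases i <;> simp [nullVec, nullPolar] <;> ring

lemma norm_nullVec_sub_le (s t : ℂ × ℂ) :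
    ‖nullVec s - nullVec t‖ ≤ 2 * ‖s - t‖ * (‖s‖ + ‖t‖) := by
  rw [nullVec_sub_nullVec]
  exact (norm_nullPolar_le _ _).trans (by gcongr; exact norm_add_le _ _)

lemma abs_spinSq_sub_le (s t : ℂ × ℂ) :
    |spinSq s - spinSq t| ≤ 2 * ‖s - t‖ * (‖s‖ + ‖t‖) := by
  have h : ∀ a b : ℂ, ‖a‖ ≤ ‖s‖ → ‖b‖ ≤ ‖t‖ → ‖a - b‖ ≤ ‖s - t‖ →
      |‖a‖ ^ 2 - ‖b‖ ^ 2| ≤ ‖s - t‖ * (‖s‖ + ‖t‖) := fun a b ha hb hab => by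
    rw [sq_sub_sq, abs_mul, mul_comm, abs_of_nonneg (by positivity : (0 : ℝ) ≤ ‖a‖ + ‖b‖)]
    gcongr
    exact (abs_norm_sub_norm_le _ _).trans hab
  have h1 := h s.1 t.1 (norm_fst_le _) (norm_fst_le _) (norm_fst_le (s - t))
  have h2 := h s.2 t.2 (norm_snd_le _) (norm_snd_le _) (norm_snd_le (s - t))
  have h3 := abs_add_le (‖s.1‖ ^ 2 - ‖t.1‖ ^ 2) (‖s.2‖ ^ 2 - ‖t.2‖ ^ 2)
  unfold spinSq
  rw [show ‖s.1‖ ^ 2 + ‖s.2‖ ^ 2 - (‖t.1‖ ^ 2 + ‖t.2‖ ^ 2) =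
    (‖s.1‖ ^ 2 - ‖t.1‖ ^ 2) + (‖s.2‖ ^ 2 - ‖t.2‖ ^ 2) by ring]
  linarith

lemma norm_le_of_reMap_deriv {R : ℝ} (hR : 1 < R) {D : ℂ → R3} {c : ℂ → Fin 3 → ℂ} {A B : ℝ}
    {n m : ℕ} (hD : ∀ z ∈ ball (0 : ℂ) R, HasFDerivAt D (reMap (c z)) z) (h0 : D 0 = 0)
    (hc : ∀ z, ‖z‖ ≤ 1 → ‖c z‖ ≤ A * ‖z‖ ^ n + B * ‖z‖ ^ m) {z : ℂ} (hz : ‖z‖ ≤ 1)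
    (hA : 0 ≤ A) (hB : 0 ≤ B) : ‖D z‖ ≤ 2 * (A / (n + 1) + B / (m + 1)) := by
  have hmem : ∀ t ∈ Icc (0 : ℝ) 1, ‖(t : ℂ) * z‖ ≤ t := fun t ht => by
    rw [norm_mul, Complex.norm_real, Real.norm_eq_abs, abs_of_nonneg ht.1]
    exact mul_le_of_le_one_right ht.1 hz
  have hd : ∀ t ∈ Icc (0 : ℝ) 1,
      HasDerivAt (fun t : ℝ => D (t * z)) (reMap (c (t * z)) z) t := fun t ht => by
    have h1 := hD (t * z) (by
      rw [mem_ball_zero_iff]; exact ((hmem t ht).trans ht.2).trans_lt hR)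
    have h2 : HasDerivAt (fun t : ℝ => (t : ℂ) * z) z t := by
      simpa using (Complex.ofRealCLM.hasDerivAt (x := t)).mul_const z
    exact h1.comp_hasDerivAt t h2
  have key := image_norm_le_of_norm_deriv_right_le_deriv_boundary
    (f := fun t : ℝ => D (t * z)) (a := 0) (b := 1)
    (f' := fun t : ℝ => reMap (c (t * z)) z)
    (B := fun t => 2 * (A * t ^ (n + 1) / (n + 1) + B * t ^ (m + 1) / (m + 1)))
    (B' := fun t => 2 * (A * t ^ n + B * t ^ m))
    (fun t ht => (hd t ht).continuousAt.continuousWithinAt)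
    (fun t ht => (hd t (Ico_subset_Icc_self ht)).hasDerivWithinAt) (by simp [h0])
    (fun t => by
      have h1 := ((hasDerivAt_pow (n + 1) t).const_mul A).div_const ((n : ℝ) + 1)
      have h2 := ((hasDerivAt_pow (m + 1) t).const_mul B).div_const ((m : ℝ) + 1)
      refine ((h1.add h2).const_mul 2).congr_deriv ?_
      push_cast
      have : (n : ℝ) + 1 ≠ 0 := by positivity
      have : (m : ℝ) + 1 ≠ 0 := by positivity
      field_simp)
    (fun t ht => by
      have ht' := Ico_subset_Icc_self ht
      have h1 := norm_reMap_apply_le (c (t * z)) z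
      have h2 := hc (t * z) ((hmem t ht').trans ht'.2)
      have h3 : ‖c (t * z)‖ ≤ A * t ^ n + B * t ^ m := h2.trans (by
        gcongr <;> exact hmem t ht')
      calc _ ≤ 2 * ‖c (t * z)‖ * ‖z‖ := h1
        _ ≤ 2 * ‖c (t * z)‖ * 1 := by gcongr
        _ ≤ _ := by linarith)
  simpa using key (right_mem_Icc.2 zero_le_one)

/-- A quantitative lower bound for the intrinsic radius of the disc with spinor `s`. -/
def Grow (s : ℂ → ℂ × ℂ) (l : ℝ) : Prop :=
  ∃ h : ℝ → ℝ, Continuous h ∧ (∀ z, ‖z‖ ≤ 1 → h ‖z‖ ≤ spinSq (s z)) ∧ l ≤ ∫ t in (0 : ℝ)..1, h t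

lemma Spin.exists_bound {R : ℝ} (hR : 1 < R) {s : ℂ → ℂ × ℂ} {X : ℂ → R3} (h : Spin R s X) :
    ∃ M, 0 < M ∧ ∀ z, ‖z‖ ≤ 1 → ‖s z‖ ≤ M := by
  have hc : ContinuousOn s (closedBall 0 1) :=
    h.1.continuousOn.mono (closedBall_subset_ball hR)
  obtain ⟨M, hM⟩ := (isCompact_closedBall (0 : ℂ) 1).exists_bound_of_continuousOn hc
  exact ⟨max M 1, by positivity, fun z hz => (hM z (by simpa using hz)).trans (le_max_left _ _)⟩

lemma Spin.continuousOn {R : ℝ} {s : ℂ → ℂ × ℂ} {X : ℂ → R3} (h : Spin R s X) :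
    ContinuousOn X (ball 0 R) :=
  fun z hz => (h.2 z hz).continuousAt.continuousWithinAt

lemma exists_nonvanishing {R : ℝ} (hR : 1 < R) {s : ℂ → ℂ × ℂ} {X : ℂ → R3} (h : Spin R s X)
    {η : ℝ} (hη : 0 < η) : ∃ s' X', Spin R s' X' ∧
      (∀ z, ‖z‖ ≤ 1 → ‖s' z - s z‖ ≤ η ∧ ‖nullVec (s' z) - nullVec (s z)‖ ≤ η ∧
        ‖X' z - X z‖ ≤ η ∧ s' z ≠ 0) ∧
      ∀ l, Grow s l → Grow s' (l - η) := by
  obtain ⟨M, hM0, hM⟩ := h.exists_bound hR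
  have hd : Dense ((fun z => - s z) '' ball (0 : ℂ) R)ᶜ := by
    refine ContDiffOn.dense_compl_image_of_dimH_lt_finrank (t := ball 0 R) (E := ℂ)
      ?_ (convex_ball 0 R) subset_rfl ?_
    · exact (((h.1.contDiffOn isOpen_ball).neg (n := 1)).restrict_scalars ℝ)
    · refine (dimH_mono (subset_univ _)).trans_lt ?_
      rw [Real.dimH_univ_eq_finrank, Module.finrank_prod, Complex.finrank_real_complex]
      norm_num
  set ε := min 1 (η / (2 * (2 * (2 * M + 1)) + 1)) with hε
  have hε0 : 0 < ε := by positivity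
  have hε1 : ε ≤ 1 := min_le_left _ _
  have hεη : ε * (2 * (2 * (2 * M + 1)) + 1) ≤ η := by
    rw [← le_div_iff₀ (by positivity)]; exact min_le_right _ _
  obtain ⟨c, hc, hcε⟩ := Metric.dense_iff.1 hd 0 ε hε0
  rw [mem_ball_zero_iff] at hc
  have hsd : DifferentiableOn ℂ (fun z => s z + c) (ball 0 R) := h.1.add_const c
  obtain ⟨X', hX', hX0⟩ := exists_spin hsd (X 0)
  have hn : ∀ z, ‖z‖ ≤ 1 → 2 * ‖(s z + c) - s z‖ * (‖s z + c‖ + ‖s z‖) ≤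
      2 * ε * (2 * M + 1) := fun z hz => by
    have h1 := hM z hz
    have h2 := norm_add_le (s z) c
    have h3 : ‖s z + c - s z‖ = ‖c‖ := by simp
    rw [h3]
    have h4 : ‖s z + c‖ + ‖s z‖ ≤ 2 * M + 1 := by linarith
    exact mul_le_mul (by linarith) h4 (by positivity) (by positivity)
  have hη1 : 2 * ε * (2 * M + 1) ≤ η := by nlinarith
  refine ⟨_, X', hX', fun z hz => ⟨?_, (norm_nullVec_sub_le _ _).trans ((hn z hz).trans hη1),
    ?_, ?_⟩, ?_⟩
  · simp only [add_sub_cancel_left]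
    nlinarith
  · have := norm_le_of_reMap_deriv hR (D := fun z => X' z - X z) (n := 0) (m := 0)
      (c := fun z => nullVec (s z + c) - nullVec (s z)) (A := 2 * ε * (2 * M + 1)) (B := 0)
      (fun z hz => by
        rw [reMap_sub]
        exact (hX'.2 z hz).sub (h.2 z hz)) (by simp [hX0])
      (fun z hz => by
        simpa using (norm_nullVec_sub_le _ _).trans (hn z hz)) hz (by positivity) le_rfl
    refine this.trans ?_
    simp
    nlinarith
  · intro h0
    refine hcε ⟨z, by simpa using hz.trans_lt hR, ?_⟩
    rw [eq_comm, ← sub_eq_zero]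
    simpa [add_comm] using h0
  · rintro l ⟨k, hk, hk1, hk2⟩
    refine ⟨fun t => k t - η, by fun_prop, fun z hz => ?_, ?_⟩
    · have := (abs_le.1 (abs_spinSq_sub_le (s z + c) (s z))).1
      have := hn z hz
      have := hk1 z hz
      dsimp only
      linarith
    · rw [intervalIntegral.integral_sub (hk.intervalIntegrable _ _) (by simp)]
      simp
      linarith

lemma exists_bound_entire {E : Type*} [NormedAddCommGroup E] [NormedSpace ℂ E] [CompleteSpace E]
    {f : ℂ → E} (hf : Differentiable ℂ f) : ∃ M : ℝ, 0 < M ∧ (∀ z, ‖z‖ ≤ 1 → ‖f z‖ ≤ M) ∧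
      (∀ z, ‖z‖ ≤ 1 → ‖deriv f z‖ ≤ M) ∧
      ∀ z w, ‖z‖ ≤ 1 → ‖w‖ ≤ 1 → ‖f z - f w‖ ≤ M * ‖z - w‖ := by
  obtain ⟨A, hA⟩ := (isCompact_closedBall (0 : ℂ) 1).exists_bound_of_continuousOn
    hf.continuous.continuousOn
  have hd : Continuous (deriv f) := (hf.contDiff (n := 1)).continuous_deriv le_rfl
  obtain ⟨B, hB⟩ := (isCompact_closedBall (0 : ℂ) 1).exists_bound_of_continuousOn hd.continuousOn
  refine ⟨max 1 (max A B), by positivity, fun z hz => ?_, fun z hz => ?_, fun z w hz hw => ?_⟩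
  · exact (hA z (by simpa using hz)).trans ((le_max_left _ _).trans (le_max_right _ _))
  · exact (hB z (by simpa using hz)).trans ((le_max_right _ _).trans (le_max_right _ _))
  · refine (convex_closedBall (0 : ℂ) 1).norm_image_sub_le_of_norm_deriv_le
      (fun x _ => hf x) (fun x hx => ?_) (by simpa using hw) (by simpa using hz)
    exact (hB x hx).trans ((le_max_right _ _).trans (le_max_right _ _))

lemma pow_mul_one_sub_le {t : ℝ} (h0 : 0 ≤ t) (h1 : t ≤ 1) (m : ℕ) :
    t ^ m * (1 - t) ≤ 1 / (m + 1) := by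
  have h2 : ((m : ℝ) + 1) * t ^ m ≤ ∑ i ∈ Finset.range (m + 1), t ^ i := by
    have := Finset.card_nsmul_le_sum (Finset.range (m + 1)) (fun i => t ^ i) (t ^ m)
      (fun i hi => pow_le_pow_of_le_one h0 h1 (by simp at hi; omega))
    simpa using this
  have h3 := mul_neg_geom_sum t (m + 1)
  have h4 : 0 ≤ t ^ (m + 1) := by positivity
  rw [le_div_iff₀ (by positivity)]
  nlinarith [mul_le_mul_of_nonneg_left h2 (sub_nonneg.2 h1)]

lemma exists_large_exponent {ρ : ℝ} (h0 : 0 ≤ ρ) (h1 : ρ < 1) {δ : ℝ} (hδ : 0 < δ) :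
    ∃ n : ℕ, ∃ q : ℝ, 1 ≤ q ∧ q ^ 2 = 2 * n + 1 ∧ q * ρ ^ n ≤ δ ∧ q / (n + 1) ≤ δ ∧
      1 / (2 * (n : ℝ) + 2) ≤ δ := by
  have e1 : Tendsto (fun n : ℕ => 2 * ((n : ℝ) * ρ ^ n) + ρ ^ n) atTop (𝓝 (2 * 0 + 0)) :=
    ((tendsto_self_mul_const_pow_of_lt_one h0 h1).const_mul 2).add
      (tendsto_pow_atTop_nhds_zero_of_lt_one h0 h1)
  have e2 : Tendsto (fun n : ℕ => 2 / √(2 * (n : ℝ) + 1)) atTop (𝓝 0) := by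
    refine tendsto_const_nhds.div_atTop (Real.tendsto_sqrt_atTop.comp ?_)
    exact tendsto_atTop_add_const_right _ _
      (tendsto_natCast_atTop_atTop.const_mul_atTop (by norm_num))
  obtain ⟨n, hn1, hn2⟩ := ((e1.eventually_le_const (by simpa using hδ)).and
    (e2.eventually_le_const hδ)).exists
  have hn0 : (0 : ℝ) ≤ n := n.cast_nonneg
  have hq2 : √(2 * (n : ℝ) + 1) ^ 2 = 2 * n + 1 := Real.sq_sqrt (by positivity)
  have hq1 : 1 ≤ √(2 * (n : ℝ) + 1) := Real.one_le_sqrt.2 (by linarith)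
  have h4 : √(2 * (n : ℝ) + 1) / (n + 1) ≤ 2 / √(2 * (n : ℝ) + 1) := by
    rw [div_le_div_iff₀ (by positivity) (by positivity)]
    nlinarith
  refine ⟨n, √(2 * n + 1), hq1, hq2, ?_, h4.trans hn2, ?_⟩
  · have h5 : √(2 * (n : ℝ) + 1) ≤ 2 * n + 1 := by nlinarith
    have h6 : 0 ≤ ρ ^ n := by positivity
    nlinarith
  · refine le_trans ?_ (h4.trans hn2)
    rw [div_le_div_iff₀ (by positivity) (by positivity)]
    nlinarith

lemma exists_unit_smul (z : ℂ) : ∃ ζ : ℂ, ‖ζ‖ = 1 ∧ z = (‖z‖ : ℂ) * ζ := by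
  by_cases h : z = 0
  · exact ⟨1, by simp, by simp [h]⟩
  · have : (‖z‖ : ℂ) ≠ 0 := by simpa using h
    refine ⟨z / ‖z‖, ?_, by field_simp⟩
    rw [norm_div]
    simp [h]

lemma norm_ofReal_mul_unit {ζ : ℂ} (hζ : ‖ζ‖ = 1) {t : ℝ} (ht : 0 ≤ t) : ‖(t : ℂ) * ζ‖ = t := by
  rw [norm_mul, hζ, mul_one, Complex.norm_real, Real.norm_eq_abs, abs_of_nonneg ht]

lemma norm_sub_unit {ζ : ℂ} (hζ : ‖ζ‖ = 1) {t : ℝ} (ht : t ≤ 1) : ‖(t : ℂ) * ζ - ζ‖ = 1 - t := by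
  rw [show (t : ℂ) * ζ - ζ = ((t - 1 : ℝ) : ℂ) * ζ by push_cast; ring, norm_mul, hζ, mul_one,
    Complex.norm_real, Real.norm_eq_abs, abs_sub_comm, abs_of_nonneg (by linarith)]

lemma reMap_zero : reMap 0 = 0 := by
  ext v i
  simp

lemma Grow.add_smul_pow {s τ : ℂ → ℂ × ℂ} {M q : ℝ} {n : ℕ} (hq0 : 0 ≤ q)
    (hq2 : q ^ 2 = 2 * n + 1)
    (hbs : ∀ z, ‖z‖ ≤ 1 → ‖s z‖ ≤ M) (hbt : ∀ z, ‖z‖ ≤ 1 → ‖τ z‖ ≤ M)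
    (hL : ∀ z w, ‖z‖ ≤ 1 → ‖w‖ ≤ 1 → ‖τ z - τ w‖ ≤ M * ‖z - w‖) {a l : ℝ}
    (ha : ∀ ζ, ‖ζ‖ = 1 → a ≤ spinSq (τ ζ)) (hl : Grow s l) :
    Grow (fun z => s z + ((q : ℂ) * z ^ n) • τ z)
      (l + a - 4 * M ^ 2 * (1 / (2 * n + 2)) - 4 * M ^ 2 * (q / (n + 1))) := by
  have hM : 0 ≤ M := (norm_nonneg _).trans (hbs 0 (by simp))
  have hqz : ∀ z : ℂ, ‖(q : ℂ) * z ^ n‖ = q * ‖z‖ ^ n := fun z => by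
    rw [norm_mul, norm_pow, Complex.norm_real, Real.norm_eq_abs, abs_of_nonneg hq0]
  obtain ⟨k, hk, hk1, hk2⟩ := hl
  refine ⟨fun t => k t + (((2 * n + 1) * t ^ (2 * n)) * (a - 4 * M ^ 2) +
    4 * M ^ 2 * ((2 * n + 1) * t ^ (2 * n + 1)) - 4 * q * M ^ 2 * t ^ n),
    by fun_prop, fun z hz => ?_, ?_⟩
  · obtain ⟨ζ, hζ, hzζ⟩ := exists_unit_smul z
    have h1 := spinSq_add_smul_ge (s z) (τ z) ((q : ℂ) * z ^ n)
    rw [hqz] at h1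
    have h2 : ‖s z‖ * ‖τ z‖ ≤ M * M :=
      mul_le_mul (hbs z hz) (hbt z hz) (norm_nonneg _) hM
    have h3 : a - 4 * M ^ 2 * (1 - ‖z‖) ≤ spinSq (τ z) := by
      have e1 := (abs_le.1 (abs_spinSq_sub_le (τ z) (τ ζ))).1
      have e2 := hL z ζ hz hζ.le
      have e3 : ‖z - ζ‖ = 1 - ‖z‖ := by
        conv_lhs => rw [hzζ]
        exact norm_sub_unit hζ hz
      rw [e3] at e2
      have e4 : 2 * ‖τ z - τ ζ‖ * (‖τ z‖ + ‖τ ζ‖) ≤ 2 * (M * (1 - ‖z‖)) * (M + M) := by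
        have : 0 ≤ 1 - ‖z‖ := by linarith
        exact mul_le_mul (by linarith) (add_le_add (hbt z hz) (hbt ζ hζ.le)) (by positivity)
          (by positivity)
      linarith [ha ζ hζ]
    have h4 : (q * ‖z‖ ^ n) ^ 2 = (2 * n + 1) * ‖z‖ ^ (2 * n) := by
      rw [mul_pow, hq2, ← pow_mul, mul_comm n 2]
    rw [h4] at h1
    have h5 : 0 ≤ (2 * (n : ℝ) + 1) * ‖z‖ ^ (2 * n) := by positivity
    have h6 := mul_le_mul_of_nonneg_left h3 h5
    have h7 : 4 * (q * ‖z‖ ^ n) * ‖s z‖ * ‖τ z‖ ≤ 4 * (q * ‖z‖ ^ n) * (M * M) := by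
      rw [mul_assoc]
      gcongr
    have h8 := hk1 z hz
    have h9 : (2 * (n : ℝ) + 1) * ‖z‖ ^ (2 * n) * (a - 4 * M ^ 2 * (1 - ‖z‖)) =
        ((2 * n + 1) * ‖z‖ ^ (2 * n)) * (a - 4 * M ^ 2) +
        4 * M ^ 2 * ((2 * n + 1) * ‖z‖ ^ (2 * n + 1)) := by ring
    dsimp only
    linarith
  · have hi : ∀ m : ℕ, ∫ t in (0 : ℝ)..1, t ^ m = 1 / (m + 1) := fun m => by
      rw [integral_pow]; simp
    rw [intervalIntegral.integral_add (hk.intervalIntegrable _ _)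
        (Continuous.intervalIntegrable (by fun_prop) _ _),
      intervalIntegral.integral_sub (Continuous.intervalIntegrable (by fun_prop) _ _)
        (Continuous.intervalIntegrable (by fun_prop) _ _),
      intervalIntegral.integral_add (Continuous.intervalIntegrable (by fun_prop) _ _)
        (Continuous.intervalIntegrable (by fun_prop) _ _),
      intervalIntegral.integral_mul_const, intervalIntegral.integral_const_mul,
      intervalIntegral.integral_const_mul, intervalIntegral.integral_const_mul,
      intervalIntegral.integral_const_mul, hi, hi, hi]
    have e1 : (2 * (n : ℝ) + 1) * (1 / (((2 * n : ℕ) : ℝ) + 1)) = 1 := by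
      push_cast
      field_simp
    have e2 : (2 * (n : ℝ) + 1) * (1 / (((2 * n + 1 : ℕ) : ℝ) + 1)) =
        1 - 1 / (2 * (n : ℝ) + 2) := by
      push_cast
      field_simp
      ring
    have e3 : 4 * q * M ^ 2 * (1 / ((n : ℝ) + 1)) = 4 * M ^ 2 * (q / (n + 1)) := by ring
    rw [e1, e2, e3]
    linarith

/-- Two spinors together with their surfaces are `η`-close at `z`. -/
def Near (η : ℝ) (s s' : ℂ → ℂ × ℂ) (X X' : ℂ → R3) (z : ℂ) : Prop :=
  ‖s' z - s z‖ ≤ η ∧ ‖nullVec (s' z) - nullVec (s z)‖ ≤ η ∧ ‖X' z - X z‖ ≤ η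

set_option maxHeartbeats 1000000 in
lemma exists_oscillation_aux {R : ℝ} (hR : 1 < R) {s : ℂ → ℂ × ℂ} {X : ℂ → R3} (h : Spin R s X)
    {τ : ℂ → ℂ × ℂ} (hτ : Differentiable ℂ τ) {η ρ : ℝ} (hη : 0 < η) (hρ0 : 0 ≤ ρ) (hρ : ρ < 1) :
    ∃ s' X', Spin R s' X' ∧ (∀ z, ‖z‖ ≤ ρ → Near η s s' X X' z) ∧
      (∀ ζ, ‖ζ‖ = 1 → ∀ t ∈ Icc (0 : ℝ) 1, ∃ w : ℂ, ‖w‖ ≤ 1 ∧ (t = 1 → ‖w‖ = 1) ∧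
        ‖X' (t * ζ) - X (t * ζ) - reMap (nullVec (τ ζ)) w‖ ≤ η) ∧
      ∀ a, (∀ ζ, ‖ζ‖ = 1 → a ≤ spinSq (τ ζ)) → ∀ l, Grow s l → Grow s' (l + a - η) := by
  obtain ⟨M₁, hM₁0, hM₁⟩ := h.exists_bound hR
  obtain ⟨M₂, hM₂0, hM₂, -, hM₂L⟩ := exists_bound_entire hτ
  have hN : Differentiable ℂ (fun z => nullVec (τ z)) := differentiable_nullVec.comp hτ
  obtain ⟨M₃, hM₃0, hM₃, hM₃d, hM₃L⟩ := exists_bound_entire hN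
  set M := 1 + M₁ + M₂ + M₃ with hM
  have hM1 : 1 ≤ M := by linarith
  obtain ⟨δ, hδ0, hδ1, hδη⟩ : ∃ δ : ℝ, 0 < δ ∧ δ ≤ 1 ∧ 40 * δ * M ^ 2 ≤ η :=
    ⟨min 1 (η / (40 * M ^ 2)), by positivity, min_le_left _ _, by
      have := min_le_right 1 (η / (40 * M ^ 2))
      rw [le_div_iff₀ (by positivity)] at this
      linarith⟩
  have hδM : 40 * δ * M ≤ η := by nlinarith [mul_pos hδ0 (by linarith : 0 < M)]
  obtain ⟨n, q, hq1, hq2, hqρ, hqn, hnδ⟩ := exists_large_exponent hρ0 hρ hδ0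
  have hsd : DifferentiableOn ℂ (fun z => s z + ((q : ℂ) * z ^ n) • τ z) (ball 0 R) := by
    have h1 : DifferentiableOn ℂ (fun z : ℂ => (q : ℂ) * z ^ n) (ball 0 R) := by fun_prop
    exact h.1.add (h1.smul hτ.differentiableOn)
  obtain ⟨X', hX', hX0⟩ := exists_spin hsd (X 0)
  have hqz : ∀ z : ℂ, ‖(q : ℂ) * z ^ n‖ = q * ‖z‖ ^ n := fun z => by
    rw [norm_mul, norm_pow, Complex.norm_real, Real.norm_eq_abs, abs_of_nonneg (by linarith)]
  have hbs : ∀ z, ‖z‖ ≤ 1 → ‖s z‖ ≤ M := fun z hz => (hM₁ z hz).trans (by linarith)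
  have hbt : ∀ z, ‖z‖ ≤ 1 → ‖τ z‖ ≤ M := fun z hz => (hM₂ z hz).trans (by linarith)
  have hbN : ∀ z, ‖z‖ ≤ 1 → ‖nullVec (τ z)‖ ≤ M := fun z hz => (hM₃ z hz).trans (by linarith)
  have hD : ∀ z, ‖z‖ ≤ 1 → ‖X' z - X z - reMap (z ^ (2 * n + 1) • nullVec (τ z)) 1‖ ≤
      10 * δ * M ^ 2 := fun z hz => by
    have := norm_le_of_reMap_deriv hR
      (D := fun z => X' z - X z - reMap (z ^ (2 * n + 1) • nullVec (τ z)) 1) (n := n)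
      (m := 2 * n + 1) (c := fun z => (2 * (q * z ^ n)) • nullPolar (s z) (τ z) -
        z ^ (2 * n + 1) • deriv (fun z => nullVec (τ z)) z) (A := 4 * q * M ^ 2) (B := M)
      (fun z hz => by
        have h1 := (hX'.2 z hz).sub (h.2 z hz)
        have h2 : HasDerivAt (fun z : ℂ => z ^ (2 * n + 1) • nullVec (τ z))
            (z ^ (2 * n + 1) • deriv (fun z => nullVec (τ z)) z +
              ((q : ℂ) * z ^ n) ^ 2 • nullVec (τ z)) z := by
          refine ((hasDerivAt_pow (2 * n + 1) z).smul (hN z).hasDerivAt).congr_deriv ?_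
          have h3 : ((q : ℂ) * z ^ n) ^ 2 = (2 * n + 1) * z ^ (2 * n) := by
            rw [mul_pow, ← pow_mul, mul_comm n 2]
            congr 1
            exact_mod_cast hq2
          rw [h3]
          push_cast
          simp
        refine (h1.sub (hasFDerivAt_reMap_one h2)).congr_fderiv ?_
        rw [nullVec_add_smul, ← reMap_sub, ← reMap_sub]
        congr 1
        module) (by simp [hX0, reMap_zero])
      (fun z hz => by
        refine (norm_sub_le _ _).trans (add_le_add ?_ ?_)
        · rw [norm_smul, norm_mul, hqz]
          have h1 := norm_nullPolar_le (s z) (τ z)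
          have h2 : ‖s z‖ * ‖τ z‖ ≤ M * M :=
            mul_le_mul (hbs z hz) (hbt z hz) (norm_nonneg _) (by linarith)
          calc ‖(2 : ℂ)‖ * (q * ‖z‖ ^ n) * ‖nullPolar (s z) (τ z)‖
              ≤ 2 * (q * ‖z‖ ^ n) * (2 * (M * M)) := by
                rw [Complex.norm_ofNat]
                gcongr
                linarith
            _ = _ := by ring
        · rw [norm_smul, norm_pow, mul_comm]
          gcongr
          exact (hM₃d z hz).trans (by linarith)) hz (by positivity) (by linarith)
    refine this.trans ?_
    have h1 : 4 * q * M ^ 2 / (n + 1) ≤ 4 * M ^ 2 * δ := by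
      rw [show 4 * q * M ^ 2 / ((n : ℝ) + 1) = 4 * M ^ 2 * (q / (n + 1)) by ring]
      gcongr
    have h2 : M / (((2 * n + 1 : ℕ) : ℝ) + 1) ≤ M * δ := by
      rw [div_eq_mul_one_div]
      gcongr
      refine le_of_eq_of_le ?_ hnδ
      push_cast
      ring
    nlinarith [mul_pos hδ0 (by linarith : 0 < M)]
  refine ⟨_, X', hX', fun z hz => ?_, fun ζ hζ t ht => ?_, fun a ha l hl => ?_⟩
  · have hz1 : ‖z‖ ≤ 1 := hz.trans hρ.le
    have hq' : q * ‖z‖ ^ n ≤ δ := le_trans (by gcongr) hqρ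
    have h1 : ‖s z + ((q : ℂ) * z ^ n) • τ z - s z‖ ≤ δ * M := by
      rw [add_sub_cancel_left, norm_smul, hqz]
      exact mul_le_mul hq' (hbt z hz1) (norm_nonneg _) hδ0.le
    have h1' : ‖s z + ((q : ℂ) * z ^ n) • τ z‖ ≤ δ * M + M := by
      have := norm_add_le (s z + ((q : ℂ) * z ^ n) • τ z - s z) (s z)
      rw [sub_add_cancel] at this
      linarith [hbs z hz1]
    refine ⟨h1.trans (by nlinarith), (norm_nullVec_sub_le _ _).trans ?_, ?_⟩
    · calc _ ≤ 2 * (δ * M) * (3 * M) := by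
            have : δ * M + M + M ≤ 3 * M := by nlinarith
            refine mul_le_mul (by linarith) ?_ (by positivity) (by positivity)
            linarith [hbs z hz1]
        _ ≤ η := by nlinarith [mul_pos hδ0 (by positivity : 0 < M ^ 2)]
    · have h2 := hD z hz1
      have h3 : ‖reMap (z ^ (2 * n + 1) • nullVec (τ z)) 1‖ ≤ 2 * δ * M := by
        refine (norm_reMap_apply_le _ _).trans ?_
        rw [norm_smul, norm_pow, norm_one, mul_one, mul_assoc]
        have h4 : ‖z‖ ^ (2 * n + 1) ≤ ‖z‖ ^ n :=
          pow_le_pow_of_le_one (norm_nonneg _) hz1 (by omega)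
        have h5 : 0 ≤ ‖z‖ ^ n := by positivity
        have h6 : ‖z‖ ^ (2 * n + 1) ≤ δ := by nlinarith
        gcongr
        exact hbN z hz1
      have h4 := norm_add_le (X' z - X z - reMap (z ^ (2 * n + 1) • nullVec (τ z)) 1)
        (reMap (z ^ (2 * n + 1) • nullVec (τ z)) 1)
      rw [sub_add_cancel] at h4
      nlinarith [mul_pos hδ0 (by positivity : 0 < M ^ 2)]
  · have hnz := norm_ofReal_mul_unit hζ ht.1
    have hz1 : ‖(t : ℂ) * ζ‖ ≤ 1 := hnz.le.trans ht.2
    refine ⟨((t : ℂ) * ζ) ^ (2 * n + 1), ?_, fun h1 => ?_, ?_⟩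
    · rw [norm_pow]; exact pow_le_one₀ (norm_nonneg _) hz1
    · rw [norm_pow, hnz, h1, one_pow]
    · have h2 := hD _ hz1
      have h3 : reMap (((t : ℂ) * ζ) ^ (2 * n + 1) • nullVec (τ (t * ζ))) 1 -
          reMap (nullVec (τ ζ)) (((t : ℂ) * ζ) ^ (2 * n + 1)) =
          reMap (nullVec (τ (t * ζ)) - nullVec (τ ζ)) (((t : ℂ) * ζ) ^ (2 * n + 1)) := by
        rw [reMap_smul_apply, reMap_sub, mul_one]
        rfl
      have h4 := norm_reMap_apply_le (nullVec (τ (t * ζ)) - nullVec (τ ζ))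
        (((t : ℂ) * ζ) ^ (2 * n + 1))
      rw [norm_pow, hnz] at h4
      have h5 := hM₃L (t * ζ) ζ hz1 hζ.le
      rw [norm_sub_unit hζ ht.2] at h5
      have h6 := pow_mul_one_sub_le ht.1 ht.2 (2 * n + 1)
      have h7 : t ^ (2 * n + 1) * (1 - t) ≤ δ := h6.trans (le_of_eq_of_le (by
        push_cast
        ring) hnδ)
      have h8 : 2 * ‖nullVec (τ (t * ζ)) - nullVec (τ ζ)‖ * t ^ (2 * n + 1) ≤ 2 * M * δ := by
        have ht0 : 0 ≤ t ^ (2 * n + 1) := pow_nonneg ht.1 _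
        calc _ ≤ 2 * (M₃ * (1 - t)) * t ^ (2 * n + 1) := by gcongr
          _ = 2 * M₃ * (t ^ (2 * n + 1) * (1 - t)) := by ring
          _ ≤ 2 * M₃ * δ := by gcongr
          _ ≤ _ := by gcongr; linarith
      rw [← sub_add_sub_cancel _ (reMap (((t : ℂ) * ζ) ^ (2 * n + 1) • nullVec (τ (t * ζ))) 1) _,
        h3]
      refine (norm_add_le _ _).trans ?_
      nlinarith [mul_pos hδ0 (by positivity : 0 < M ^ 2)]
  · have h1 := hl.add_smul_pow (by linarith) hq2 hbs hbt
      (fun z w hz hw => (hM₂L z w hz hw).trans (by gcongr; linarith)) ha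
    obtain ⟨k, hk, hk1, hk2⟩ := h1
    refine ⟨k, hk, hk1, le_trans ?_ hk2⟩
    have e3 : 4 * M ^ 2 * (q / (n + 1)) ≤ 4 * M ^ 2 * δ := by gcongr
    have e4 : 4 * M ^ 2 * (1 / (2 * (n : ℝ) + 2)) ≤ 4 * M ^ 2 * δ := by gcongr
    nlinarith [mul_pos hδ0 (by positivity : 0 < M ^ 2)]

lemma exists_oscillation {R : ℝ} (hR : 1 < R) {s : ℂ → ℂ × ℂ} {X : ℂ → R3} (h : Spin R s X)
    {τ : ℂ → ℂ × ℂ} (hτ : Differentiable ℂ τ) {η ρ : ℝ} (hη : 0 < η) (hρ0 : 0 ≤ ρ) (hρ : ρ < 1) :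
    ∃ s' X', Spin R s' X' ∧ (∀ z, ‖z‖ ≤ ρ → Near η s s' X X' z) ∧
      (∀ ζ, ‖ζ‖ = 1 → ∀ t ∈ Icc (0 : ℝ) 1, ∃ w : ℂ, ‖w‖ ≤ 1 ∧ (t = 1 → ‖w‖ = 1) ∧
        ‖X' (t * ζ) - X (t * ζ) - reMap (nullVec (τ ζ)) w‖ ≤ η) ∧
      (∀ a, (∀ ζ, ‖ζ‖ = 1 → a ≤ spinSq (τ ζ)) → ∀ l, Grow s l → Grow s' (l + a - η)) ∧
      ∀ z, ‖z‖ ≤ 1 → s' z ≠ 0 := by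
  obtain ⟨s₁, X₁, h₁, hn₁, ho₁, hg₁⟩ := exists_oscillation_aux hR h hτ (half_pos hη) hρ0 hρ
  obtain ⟨s₂, X₂, h₂, hn₂, hg₂⟩ := exists_nonvanishing hR h₁ (half_pos hη)
  refine ⟨s₂, X₂, h₂, fun z hz => ?_, fun ζ hζ t ht => ?_, fun a ha l hl => ?_,
    fun z hz => (hn₂ z hz).2.2.2⟩
  · obtain ⟨a1, a2, a3⟩ := hn₁ z hz
    obtain ⟨b1, b2, b3, -⟩ := hn₂ z (hz.trans hρ.le)
    refine ⟨?_, ?_, ?_⟩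
    · rw [← sub_add_sub_cancel _ (s₁ z) _]
      exact (norm_add_le _ _).trans (by linarith)
    · rw [← sub_add_sub_cancel _ (nullVec (s₁ z)) _]
      exact (norm_add_le _ _).trans (by linarith)
    · rw [← sub_add_sub_cancel _ (X₁ z) _]
      exact (norm_add_le _ _).trans (by linarith)
  · obtain ⟨w, hw, hw1, hw2⟩ := ho₁ ζ hζ t ht
    have hb := (hn₂ (t * ζ) ((norm_ofReal_mul_unit hζ ht.1).le.trans ht.2)).2.2.1
    refine ⟨w, hw, hw1, ?_⟩
    rw [show X₂ (t * ζ) - X (t * ζ) - reMap (nullVec (τ ζ)) w = (X₂ (t * ζ) - X₁ (t * ζ)) +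
      (X₁ (t * ζ) - X (t * ζ) - reMap (nullVec (τ ζ)) w) by abel]
    exact (norm_add_le _ _).trans (by linarith)
  · convert hg₂ _ (hg₁ a ha l hl) using 1
    ring

lemma exists_polynomial_approx {g : ℂ → ℂ} (hg : ContinuousOn g (sphere 0 1)) {ε : ℝ}
    (hε : 0 < ε) : ∃ m₀ : ℕ, ∀ m ≥ m₀, ∃ p : Polynomial ℂ, ∀ ζ : ℂ, ‖ζ‖ = 1 →
      ‖p.eval ζ - ζ ^ m * g ζ‖ ≤ ε := by
  have : Fact ((0 : ℝ) < 1) := ⟨one_pos⟩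
  have hmem : ∀ x : AddCircle (1 : ℝ), (x.toCircle : ℂ) ∈ sphere (0 : ℂ) 1 := fun x => by
    rw [mem_sphere_zero_iff_norm, Circle.norm_coe]
  let G : C(AddCircle (1 : ℝ), ℂ) := ⟨fun x => g x.toCircle,
    hg.comp_continuous (continuous_subtype_val.comp AddCircle.continuous_toCircle) hmem⟩
  have hG : G ∈ (Submodule.span ℂ (Set.range (fourier (T := (1 : ℝ))))).topologicalClosure := by
    rw [span_fourier_closure_eq_top]; trivial
  obtain ⟨f, hf, hfG⟩ := Metric.mem_closure_iff.1 hG ε hε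
  have key : ∃ m₀ : ℕ, ∀ m ≥ m₀, ∃ p : Polynomial ℂ, ∀ x : AddCircle (1 : ℝ),
      p.eval (x.toCircle : ℂ) = (x.toCircle : ℂ) ^ m * f x := by
    clear hfG
    induction hf using Submodule.span_induction with
    | mem y hy =>
      obtain ⟨k, rfl⟩ := hy
      refine ⟨k.natAbs, fun m hm => ⟨Polynomial.X ^ (m + k).toNat, fun x => ?_⟩⟩
      have h0 : (x.toCircle : ℂ) ≠ 0 := Circle.coe_ne_zero _
      rw [fourier_apply, AddCircle.toCircle_zsmul, Polynomial.eval_pow, Polynomial.eval_X,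
        Circle.coe_zpow, ← zpow_natCast, ← zpow_natCast, ← zpow_add₀ h0]
      congr 1
      omega
    | zero => exact ⟨0, fun m _ => ⟨0, by simp⟩⟩
    | add a b _ _ iha ihb =>
      obtain ⟨m₁, h₁⟩ := iha
      obtain ⟨m₂, h₂⟩ := ihb
      refine ⟨max m₁ m₂, fun m hm => ?_⟩
      obtain ⟨p, hp⟩ := h₁ m (le_of_max_le_left hm)
      obtain ⟨q, hq⟩ := h₂ m (le_of_max_le_right hm)
      exact ⟨p + q, fun x => by simp [hp, hq, mul_add]⟩
    | smul c a _ iha =>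
      obtain ⟨m₁, h₁⟩ := iha
      refine ⟨m₁, fun m hm => ?_⟩
      obtain ⟨p, hp⟩ := h₁ m hm
      exact ⟨Polynomial.C c * p, fun x => by simp [hp]; ring⟩
  obtain ⟨m₀, hm₀⟩ := key
  refine ⟨m₀, fun m hm => ?_⟩
  obtain ⟨p, hp⟩ := hm₀ m hm
  refine ⟨p, fun ζ hζ => ?_⟩
  obtain ⟨x, hx⟩ := (AddCircle.homeomorphCircle one_ne_zero).surjective
    (⟨ζ, by simpa [Submonoid.unitSphere] using hζ⟩ : Circle)
  rw [AddCircle.homeomorphCircle_apply] at hx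
  have hxζ : (x.toCircle : ℂ) = ζ := by rw [hx]
  rw [← hxζ, hp, ← mul_sub, norm_mul, norm_pow, Circle.norm_coe, one_pow, one_mul]
  have := (ContinuousMap.dist_apply_le_dist (f := G) (g := f) x).trans hfG.le
  rwa [dist_comm, dist_eq_norm] at this

/-- The quadratic form `∑ nullVec s i * ν i` whose zeros are the spinors of null vectors
orthogonal to `ν`. -/
def spinQuad (ν : R3) (s : ℂ × ℂ) : ℂ := ∑ i, nullVec s i * (ν i : ℂ)

/-- A linear map onto an isotropic line of `spinQuad ν`. -/
def spinProj (ν : R3) (p : ℂ × ℂ) : ℂ × ℂ :=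
  ((‖ν‖ - ν 2) * p.1 + (ν 0 - Complex.I * ν 1) * p.2,
    (ν 0 + Complex.I * ν 1) * p.1 + (‖ν‖ + ν 2) * p.2)

lemma norm_sq_eq_three (ν : R3) : ‖ν‖ ^ 2 = ν 0 ^ 2 + ν 1 ^ 2 + ν 2 ^ 2 := by
  rw [EuclideanSpace.norm_sq_eq, Fin.sum_univ_three]
  simp

lemma spinQuad_spinProj (ν : R3) (p : ℂ × ℂ) : spinQuad ν (spinProj ν p) = 0 := by
  have h : (‖ν‖ : ℂ) ^ 2 = (ν 0 : ℂ) ^ 2 + (ν 1 : ℂ) ^ 2 + (ν 2 : ℂ) ^ 2 := by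
    exact_mod_cast norm_sq_eq_three ν
  have hI := Complex.I_sq
  simp only [spinQuad, Fin.sum_univ_three, nullVec, spinProj, Matrix.cons_val_zero,
    Matrix.cons_val_one, Matrix.cons_val_two, Matrix.head_cons, Matrix.tail_cons]
  generalize (‖ν‖ : ℂ) = n at *
  generalize ((ν 0 : ℝ) : ℂ) = a at *
  generalize ((ν 1 : ℝ) : ℂ) = b at *
  generalize ((ν 2 : ℝ) : ℂ) = c at *
  obtain ⟨x, y⟩ := p
  dsimp only
  generalize Complex.I = i at *
  linear_combination ((a + i * b) * x ^ 2 + 2 * c * x * y - (a - i * b) * y ^ 2) * h +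
    (2 * c * x * b ^ 2 * y + x ^ 2 * a * b ^ 2 + x ^ 2 * i * b ^ 3 - a * b ^ 2 * y ^ 2 +
      i * b ^ 3 * y ^ 2) * hI

lemma spinProj_ne_zero {ν e : R3} (hν : ν ≠ 0) (he : 0 < e 2) (h : ∀ t : ℝ, t • ν ≠ e) :
    spinProj ν (‖e‖ + e 2, -(e 0 + Complex.I * e 1)) ≠ 0 := by
  intro h0
  rw [spinProj, Prod.mk_eq_zero] at h0
  obtain ⟨h1, h2⟩ := h0
  have hn := norm_sq_eq_three ν
  have hm := norm_sq_eq_three e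
  have hν0 := norm_pos_iff.2 hν
  have r1 := congr_arg Complex.re h1
  have r2 := congr_arg Complex.re h2
  have i2 := congr_arg Complex.im h2
  simp at r1 r2 i2
  have hpos : 0 < ‖e‖ + e 2 := by positivity
  obtain ⟨k, hk⟩ : ∃ k, k = (‖ν‖ + ν 2) / (‖e‖ + e 2) := ⟨_, rfl⟩
  rw [eq_div_iff hpos.ne'] at hk
  have k0 : ν 0 = k * e 0 := by
    apply mul_right_cancel₀ hpos.ne'
    linear_combination r2 - e 0 * hk
  have k1 : ν 1 = k * e 1 := by
    apply mul_right_cancel₀ hpos.ne'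
    linear_combination i2 - e 1 * hk
  have k2' : ‖ν‖ - ν 2 = k * (‖e‖ - e 2) := by
    apply mul_right_cancel₀ hpos.ne'
    rw [k0, k1] at r1
    linear_combination r1 - k * hm
  have k2 : ν 2 = k * e 2 := by linarith
  have kn : ‖ν‖ = k * ‖e‖ := by linarith
  have hk0 : k ≠ 0 := by
    rintro rfl
    rw [zero_mul] at kn
    exact hν0.ne' kn
  refine h k⁻¹ ?_
  ext i
  fin_cases i
  · simp [k0, hk0]
  · simp [k1, hk0]
  · simp [k2, hk0]

lemma exists_generic_approx {ν : ℂ → R3} (hν : ContinuousOn ν (sphere 0 1)) {ε : ℝ} (hε : 0 < ε) :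
    ∃ (μ : ℂ → R3) (e : R3), Continuous μ ∧ (∀ ζ, ‖ζ‖ = 1 → ‖μ ζ - ν ζ‖ ≤ ε) ∧ 0 < e 2 ∧
      ∀ ζ, ‖ζ‖ = 1 → ∀ t : ℝ, t • μ ζ ≠ e := by
  have h1 : ∀ i, ∃ m₀ : ℕ, ∀ m ≥ m₀, ∃ p : Polynomial ℂ, ∀ ζ : ℂ, ‖ζ‖ = 1 →
      ‖p.eval ζ - ζ ^ m * (ν ζ i : ℂ)‖ ≤ ε / 2 := fun i => by
    refine exists_polynomial_approx ?_ (half_pos hε)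
    exact Complex.continuous_ofReal.comp_continuousOn
      ((EuclideanSpace.proj (𝕜 := ℝ) i).continuous.comp_continuousOn hν)
  choose m₀ hm₀ using h1
  obtain ⟨m, hm⟩ : ∃ m, ∀ i, m₀ i ≤ m :=
    ⟨∑ i, m₀ i, fun i => Finset.single_le_sum (fun _ _ => Nat.zero_le _) (Finset.mem_univ i)⟩
  choose p hp using fun i => hm₀ i m (hm i)
  let μ : ℂ → R3 := fun ζ => WithLp.toLp 2 fun i => ((starRingEnd ℂ) ζ ^ m * (p i).eval ζ).re
  have hμ : ContDiff ℝ 1 μ := by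
    refine contDiff_euclidean.2 fun i => ?_
    refine Complex.reCLM.contDiff.comp (((Complex.conjCLE.contDiff).pow m).mul ?_)
    exact ((p i).differentiable.contDiff (n := 1)).restrict_scalars ℝ
  have hdense : Dense (range fun q : ℝ × ℝ => q.1 • μ (Complex.exp (q.2 * Complex.I)))ᶜ := by
    refine ContDiff.dense_compl_range_of_finrank_lt_finrank ?_ (by simp)
    refine contDiff_fst.smul (hμ.comp ?_)
    refine (Complex.contDiff_exp (𝕜 := ℝ)).comp ?_
    exact (Complex.ofRealCLM.contDiff.comp contDiff_snd).mul contDiff_const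
  have hop : IsOpen {e : R3 | 0 < e 2} :=
    isOpen_lt continuous_const (EuclideanSpace.proj (𝕜 := ℝ) (2 : Fin 3)).continuous
  obtain ⟨e, he, heμ⟩ := hdense.inter_open_nonempty _ hop
    ⟨EuclideanSpace.single 2 1, by simp⟩
  refine ⟨μ, e, hμ.continuous, fun ζ hζ => ?_, he, fun ζ hζ t ht => ?_⟩
  · have h2 : ∀ i, |(μ ζ - ν ζ) i| ≤ ε / 2 := fun i => by
      have h3 : (starRingEnd ℂ) ζ ^ m * ζ ^ m = 1 := by
        rw [← mul_pow, mul_comm, Complex.mul_conj, Complex.normSq_eq_norm_sq, hζ]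
        simp
      have h4 : (μ ζ - ν ζ) i =
          ((starRingEnd ℂ) ζ ^ m * ((p i).eval ζ - ζ ^ m * (ν ζ i : ℂ))).re := by
        rw [mul_sub, ← mul_assoc, h3, one_mul, Complex.sub_re, Complex.ofReal_re]
        rfl
      rw [h4]
      refine (Complex.abs_re_le_norm _).trans ?_
      rw [norm_mul, norm_pow, Complex.norm_conj, hζ, one_pow, one_mul]
      exact hp i ζ hζ
    refine le_of_sq_le_sq ?_ hε.le
    rw [norm_sq_eq_three]
    have h3 : ∀ i, (μ ζ - ν ζ) i ^ 2 ≤ (ε / 2) ^ 2 := fun i => by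
      rw [← sq_abs]
      exact pow_le_pow_left₀ (abs_nonneg _) (h2 i) 2
    linarith [h3 0, h3 1, h3 2, sq_nonneg ε]
  · obtain ⟨θ, rfl⟩ := (Complex.norm_eq_one_iff ζ).1 hζ
    exact heμ ⟨(t, θ), ht⟩

lemma norm_nullVec_le (s : ℂ × ℂ) : ‖nullVec s‖ ≤ 2 * ‖s‖ ^ 2 := by
  have h : nullVec 0 = 0 := by
    ext i
    fin_cases i <;> simp [nullVec]
  have := norm_nullVec_sub_le s 0
  rw [h] at this
  simp at this
  linarith

lemma spinQuad_eq_re (ν : R3) (s : ℂ × ℂ) (w : ℂ) :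
    inner ℝ (reMap (nullVec s) w) ν = (spinQuad ν s * w).re := inner_reMap _ _ _

lemma abs_apply_le_norm (ν : R3) (i : Fin 3) : |ν i| ≤ ‖ν‖ := by
  simpa using PiLp.norm_apply_le ν i

lemma norm_sum_mul_le (c : Fin 3 → ℂ) (ν : R3) : ‖∑ i, c i * (ν i : ℂ)‖ ≤ 3 * ‖c‖ * ‖ν‖ := by
  refine (norm_sum_le _ _).trans ?_
  have h : ∀ i ∈ Finset.univ, ‖c i * (ν i : ℂ)‖ ≤ ‖c‖ * ‖ν‖ := fun i _ => by
    rw [norm_mul, Complex.norm_real]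
    exact mul_le_mul (norm_le_pi_norm c i) (abs_apply_le_norm ν i) (norm_nonneg _) (norm_nonneg _)
  refine (Finset.sum_le_card_nsmul _ _ _ h).trans ?_
  simp [mul_assoc]

lemma spinSq_smul (c : ℂ) (s : ℂ × ℂ) : spinSq (c • s) = ‖c‖ ^ 2 * spinSq s := by
  simp [spinSq]
  ring

lemma spinQuad_smul (ν : R3) (c : ℂ) (s : ℂ × ℂ) :
    spinQuad ν (c • s) = c ^ 2 * spinQuad ν s := by
  simp [spinQuad, nullVec_smul, Finset.mul_sum, mul_assoc]

lemma norm_sq_le_spinSq (s : ℂ × ℂ) : ‖s‖ ^ 2 ≤ spinSq s := by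
  rw [Prod.norm_def]
  unfold spinSq
  rcases max_choice ‖s.1‖ ‖s.2‖ with h | h <;> rw [h] <;> nlinarith [sq_nonneg ‖s.1‖, sq_nonneg ‖s.2‖]

lemma exists_null_polynomial {ν : ℂ → R3} (hν : ContinuousOn ν (sphere 0 1))
    (hν1 : ∀ ζ, ‖ζ‖ = 1 → ‖ν ζ‖ = 1) {r : ℂ → ℝ} (hr : ContinuousOn r (sphere 0 1))
    (hr0 : ∀ ζ, ‖ζ‖ = 1 → 0 < r ζ) {η : ℝ} (hη : 0 < η) :
    ∃ τ : ℂ → ℂ × ℂ, Differentiable ℂ τ ∧ ∀ ζ, ‖ζ‖ = 1 →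
      ‖spinQuad (ν ζ) (τ ζ)‖ ≤ η ∧ |spinSq (τ ζ) - r ζ| ≤ η := by
  obtain ⟨B₀, hB₀⟩ := (isCompact_sphere (0 : ℂ) 1).exists_bound_of_continuousOn hr
  obtain ⟨B, hB1, hB⟩ : ∃ B : ℝ, 1 ≤ B ∧ ∀ ζ, ‖ζ‖ = 1 → r ζ ≤ B :=
    ⟨max 1 B₀, le_max_left _ _, fun ζ hζ =>
      ((le_abs_self _).trans (hB₀ ζ (by simpa using hζ))).trans (le_max_right _ _)⟩
  obtain ⟨δ, hδ0, hδ1, hδη⟩ : ∃ δ : ℝ, 0 < δ ∧ δ ≤ 1 / 2 ∧ 36 * δ * B ^ 2 ≤ η :=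
    ⟨min (1 / 2) (η / (36 * B ^ 2)), by positivity, min_le_left _ _, by
      have := min_le_right (1 / 2) (η / (36 * B ^ 2))
      rw [le_div_iff₀ (by positivity)] at this
      linarith⟩
  obtain ⟨μ, e, hμ, hμν, he, hμe⟩ := exists_generic_approx hν hδ0
  have hμ0 : ∀ ζ, ‖ζ‖ = 1 → μ ζ ≠ 0 := fun ζ hζ h0 => by
    have := hμν ζ hζ
    rw [h0, zero_sub, norm_neg, hν1 ζ hζ] at this
    linarith
  obtain ⟨P, hP⟩ : ∃ P : ℂ → ℂ × ℂ,
    P = fun ζ => spinProj (μ ζ) (‖e‖ + e 2, -(e 0 + Complex.I * e 1)) := ⟨_, rfl⟩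
  have hP0 : ∀ ζ, ‖ζ‖ = 1 → 0 < spinSq (P ζ) := fun ζ hζ => by
    rw [hP]
    exact spinSq_pos (spinProj_ne_zero (hμ0 ζ hζ) he (hμe ζ hζ))
  have hPc : Continuous P := by
    rw [hP]
    unfold spinProj
    fun_prop
  obtain ⟨k, hk⟩ : ∃ k : ℂ → ℝ, k = fun ζ => √(r ζ / spinSq (P ζ)) := ⟨_, rfl⟩
  have hkc : ContinuousOn k (sphere 0 1) := by
    rw [hk]
    refine (ContinuousOn.div hr (continuous_spinSq.comp hPc).continuousOn fun ζ hζ => ?_).sqrt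
    exact (hP0 ζ (by simpa using hζ)).ne'
  obtain ⟨σ, hσ⟩ : ∃ σ : ℂ → ℂ × ℂ, σ = fun ζ => (k ζ : ℂ) • P ζ := ⟨_, rfl⟩
  have hσc : ContinuousOn σ (sphere 0 1) := by
    rw [hσ]
    exact (Complex.continuous_ofReal.comp_continuousOn hkc).smul hPc.continuousOn
  have hσr : ∀ ζ, ‖ζ‖ = 1 → spinSq (σ ζ) = r ζ := fun ζ hζ => by
    have h1 := hP0 ζ hζ
    have h2 := hr0 ζ hζ
    rw [hσ]
    dsimp only
    rw [spinSq_smul, Complex.norm_real, Real.norm_eq_abs, sq_abs, hk]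
    dsimp only
    rw [Real.sq_sqrt (by positivity)]
    field_simp
  have hσq : ∀ ζ, spinQuad (μ ζ) (σ ζ) = 0 := fun ζ => by
    rw [hσ, hP]
    dsimp only
    rw [spinQuad_smul, spinQuad_spinProj, mul_zero]
  obtain ⟨m₁, hm₁⟩ := exists_polynomial_approx (continuous_fst.comp_continuousOn hσc) hδ0
  obtain ⟨m₂, hm₂⟩ := exists_polynomial_approx (continuous_snd.comp_continuousOn hσc) hδ0
  obtain ⟨p, hp⟩ := hm₁ (max m₁ m₂) (le_max_left _ _)
  obtain ⟨q, hq⟩ := hm₂ (max m₁ m₂) (le_max_right _ _)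
  generalize max m₁ m₂ = m at *
  refine ⟨fun z => (p.eval z, q.eval z), p.differentiable.prodMk q.differentiable,
    fun ζ hζ => ?_⟩
  obtain ⟨T, hT⟩ : ∃ T : ℂ × ℂ, T = ζ ^ m • σ ζ := ⟨_, rfl⟩
  obtain ⟨S, hS⟩ : ∃ S : ℂ × ℂ, S = (p.eval ζ, q.eval ζ) := ⟨_, rfl⟩
  change ‖spinQuad (ν ζ) (p.eval ζ, q.eval ζ)‖ ≤ η ∧ |spinSq (p.eval ζ, q.eval ζ) - r ζ| ≤ η
  rw [← hS]
  have h1 : ‖S - T‖ ≤ δ := by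
    rw [hS, hT, Prod.norm_def]
    exact max_le (hp ζ hζ) (hq ζ hζ)
  have h2 : spinSq T = r ζ := by
    rw [hT, spinSq_smul, norm_pow, hζ, hσr ζ hζ]
    simp
  have h3 : ‖T‖ ≤ B := by
    have := norm_sq_le_spinSq T
    rw [h2] at this
    refine le_of_sq_le_sq (this.trans ((hB ζ hζ).trans ?_)) (by linarith)
    nlinarith
  have h4 : ‖S‖ ≤ B + δ := by
    have := norm_add_le (S - T) T
    rw [sub_add_cancel] at this
    linarith
  have h5 : 2 * ‖S - T‖ * (‖S‖ + ‖T‖) ≤ 6 * δ * B := by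
    calc _ ≤ 2 * δ * (3 * B) := by
          refine mul_le_mul (by linarith) (by linarith) (by positivity) (by positivity)
      _ = _ := by ring
  have h6 : δ * B ≤ δ * B ^ 2 := by
    gcongr
    nlinarith
  constructor
  · have e1 : spinQuad (ν ζ) S = (∑ i, (nullVec S - nullVec T) i * (ν ζ i : ℂ)) +
        ∑ i, nullVec T i * ((ν ζ - μ ζ) i : ℂ) := by
      have e2 : spinQuad (μ ζ) T = 0 := by
        rw [hT, spinQuad_smul, hσq, mul_zero]
      rw [← sub_zero (spinQuad (ν ζ) S), ← e2]
      simp only [spinQuad, Fin.sum_univ_three, Pi.sub_apply, PiLp.sub_apply, Complex.ofReal_sub]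
      ring
    rw [e1]
    refine (norm_add_le _ _).trans ?_
    have e2 := norm_sum_mul_le (nullVec S - nullVec T) (ν ζ)
    have e3 := norm_sum_mul_le (nullVec T) (ν ζ - μ ζ)
    rw [hν1 ζ hζ] at e2
    have e4 := norm_nullVec_sub_le S T
    have e5 := norm_nullVec_le T
    have e6 : ‖T‖ ^ 2 ≤ B ^ 2 := by gcongr
    have e7 : ‖ν ζ - μ ζ‖ ≤ δ := by rw [norm_sub_rev]; exact hμν ζ hζ
    have e8 : 3 * ‖nullVec T‖ * ‖ν ζ - μ ζ‖ ≤ 3 * (2 * B ^ 2) * δ := by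
      refine mul_le_mul (by linarith) e7 (by positivity) (by positivity)
    nlinarith
  · rw [← h2]
    exact (abs_spinSq_sub_le S T).trans (by nlinarith)

lemma exists_orthogonal_push {R : ℝ} (hR : 1 < R) {s : ℂ → ℂ × ℂ} {X : ℂ → R3} (h : Spin R s X)
    {ν : ℂ → R3} (hν : ContinuousOn ν (sphere 0 1)) (hν1 : ∀ ζ, ‖ζ‖ = 1 → ‖ν ζ‖ = 1)
    {r : ℂ → ℝ} (hr : ContinuousOn r (sphere 0 1)) (hr0 : ∀ ζ, ‖ζ‖ = 1 → 0 < r ζ)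
    {η ρ : ℝ} (hη : 0 < η) (hρ0 : 0 ≤ ρ) (hρ : ρ < 1) :
    ∃ s' X', Spin R s' X' ∧ (∀ z, ‖z‖ ≤ ρ → Near η s s' X X' z) ∧
      (∀ ζ, ‖ζ‖ = 1 → ∀ t ∈ Icc (0 : ℝ) 1,
        |inner ℝ (X' (t * ζ) - X (t * ζ)) (ν ζ)| ≤ η ∧ ‖X' (t * ζ) - X (t * ζ)‖ ≤ r ζ + η) ∧
      (∀ ζ, ‖ζ‖ = 1 → r ζ - η ≤ ‖X' ζ - X ζ‖) ∧
      (∀ a, (∀ ζ, ‖ζ‖ = 1 → a ≤ r ζ) → ∀ l, Grow s l → Grow s' (l + a - η)) ∧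
      ∀ z, ‖z‖ ≤ 1 → s' z ≠ 0 := by
  obtain ⟨τ, hτ, hτν⟩ := exists_null_polynomial hν hν1 hr hr0 (half_pos hη)
  obtain ⟨s', X', h', hn, ho, hg, h0⟩ := exists_oscillation hR h hτ (half_pos hη) hρ0 hρ
  refine ⟨s', X', h', fun z hz => ?_, fun ζ hζ t ht => ?_, fun ζ hζ => ?_, fun a ha l hl => ?_, h0⟩
  · obtain ⟨h1, h2, h3⟩ := hn z hz
    exact ⟨by linarith, by linarith, by linarith⟩
  · obtain ⟨w, hw, -, hw2⟩ := ho ζ hζ t ht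
    obtain ⟨e1, e2⟩ := hτν ζ hζ
    obtain ⟨D, hD⟩ : ∃ D, D = X' (t * ζ) - X (t * ζ) := ⟨_, rfl⟩
    rw [← hD] at hw2 ⊢
    have e3 : D = (D - reMap (nullVec (τ ζ)) w) + reMap (nullVec (τ ζ)) w := by abel
    constructor
    · rw [e3, inner_add_left, spinQuad_eq_re]
      refine (abs_add_le _ _).trans ?_
      have e4 := abs_real_inner_le_norm (D - reMap (nullVec (τ ζ)) w) (ν ζ)
      rw [hν1 ζ hζ, mul_one] at e4
      have e5 : |(spinQuad (ν ζ) (τ ζ) * w).re| ≤ η / 2 := by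
        refine (Complex.abs_re_le_norm _).trans ?_
        rw [norm_mul]
        nlinarith [norm_nonneg w, norm_nonneg (spinQuad (ν ζ) (τ ζ))]
      linarith
    · rw [e3]
      refine (norm_add_le _ _).trans ?_
      rw [norm_reMap_nullVec]
      have := (abs_le.1 e2).2
      nlinarith [norm_nonneg w, spinSq_nonneg (τ ζ)]
  · obtain ⟨w, hw, hw1, hw2⟩ := ho ζ hζ 1 (right_mem_Icc.2 zero_le_one)
    obtain ⟨-, e2⟩ := hτν ζ hζ
    rw [Complex.ofReal_one, one_mul] at hw2
    have e3 := norm_sub_norm_le (reMap (nullVec (τ ζ)) w) (X' ζ - X ζ)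
    rw [norm_sub_rev (reMap _ w), norm_reMap_nullVec, hw1 rfl, mul_one] at e3
    have := (abs_le.1 e2).1
    linarith
  · obtain ⟨k, hk, hk1, hk2⟩ := hg (a - η / 2) (fun ζ hζ => by
      have := (abs_le.1 (hτν ζ hζ).2).1
      linarith [ha ζ hζ]) l hl
    exact ⟨k, hk, hk1, by linarith⟩

lemma exists_radial_modulus {X : ℂ → R3} (hX : ContinuousOn X (closedBall 0 1)) {μ ρ : ℝ}
    (hμ : 0 < μ) (hρ : ρ < 1) :
    ∃ ρ', ρ ≤ ρ' ∧ 0 ≤ ρ' ∧ ρ' < 1 ∧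
      ∀ ζ : ℂ, ‖ζ‖ = 1 → ∀ t : ℝ, ρ' ≤ t → t ≤ 1 → ‖X (t * ζ) - X ζ‖ ≤ μ := by
  have hu := (isCompact_closedBall (0 : ℂ) 1).uniformContinuousOn_of_continuous hX
  obtain ⟨δ, hδ, hu⟩ := Metric.uniformContinuousOn_iff.1 hu μ hμ
  refine ⟨max (max ρ 0) (1 - δ / 2), (le_max_left _ _).trans (le_max_left _ _),
    (le_max_right _ _).trans (le_max_left _ _), by simp [hρ, hδ], fun ζ hζ t ht ht1 => ?_⟩
  have ht0 : 0 ≤ t := ((le_max_right _ _).trans (le_max_left _ _)).trans ht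
  have ht2 : 1 - δ / 2 ≤ t := (le_max_right _ _).trans ht
  rw [← dist_eq_norm]
  refine (hu _ ?_ _ ?_ ?_).le
  · rw [mem_closedBall_zero_iff, norm_ofReal_mul_unit hζ ht0]
    exact ht1
  · rw [mem_closedBall_zero_iff, hζ]
  · rw [dist_eq_norm, norm_sub_unit hζ ht1]
    linarith

lemma continuousOn_unit {E : Type*} [TopologicalSpace E] {R : ℝ} (hR : 1 < R) {X : ℂ → E}
    (hX : ContinuousOn X (ball 0 R)) : ContinuousOn X (closedBall 0 1) :=
  hX.mono (closedBall_subset_ball hR)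

lemma Near.trans {η η' : ℝ} {s s' s'' : ℂ → ℂ × ℂ} {X X' X'' : ℂ → R3} {z : ℂ}
    (h : Near η s s' X X' z) (h' : Near η' s' s'' X' X'' z) : Near (η + η') s s'' X X'' z := by
  obtain ⟨a1, a2, a3⟩ := h
  obtain ⟨b1, b2, b3⟩ := h'
  refine ⟨?_, ?_, ?_⟩
  · rw [← sub_add_sub_cancel _ (s' z) _]
    exact (norm_add_le _ _).trans (by linarith)
  · rw [← sub_add_sub_cancel _ (nullVec (s' z)) _]
    exact (norm_add_le _ _).trans (by linarith)
  · rw [← sub_add_sub_cancel _ (X' z) _]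
    exact (norm_add_le _ _).trans (by linarith)

lemma Near.mono {η η' : ℝ} {s s' : ℂ → ℂ × ℂ} {X X' : ℂ → R3} {z : ℂ}
    (h : Near η s s' X X' z) (hη : η ≤ η') : Near η' s s' X X' z :=
  ⟨h.1.trans hη, h.2.1.trans hη, h.2.2.trans hη⟩

lemma Near.refl (s : ℂ → ℂ × ℂ) (X : ℂ → R3) (z : ℂ) : Near 0 s s X X z := by simp [Near]

/-- Pythagorean estimate for an almost orthogonal displacement. -/
lemma norm_add_sq_bounds {v d : R3} {N μ A B : ℝ} (hv : ‖v‖ ≤ N) (hv0 : v ≠ 0)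
    (h : |inner ℝ d (‖v‖⁻¹ • v)| ≤ μ) (hA0 : 0 ≤ A) (hA : A ≤ ‖d‖) (hB : ‖d‖ ≤ B) :
    ‖v‖ ^ 2 - 2 * μ * N + A ^ 2 ≤ ‖v + d‖ ^ 2 ∧ ‖v + d‖ ^ 2 ≤ ‖v‖ ^ 2 + 2 * μ * N + B ^ 2 := by
  have hn : 0 < ‖v‖ := norm_pos_iff.2 hv0
  have e1 : |inner ℝ v d| ≤ μ * N := by
    rw [inner_smul_right, abs_mul, abs_of_pos (inv_pos.2 hn), inv_mul_le_iff₀ hn,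
      real_inner_comm] at h
    have h0 : 0 ≤ μ := by
      by_contra! h'
      have := abs_nonneg (inner ℝ v d)
      nlinarith
    nlinarith
  have e2 := norm_add_sq_real v d
  have e3 := abs_le.1 e1
  have e4 := pow_le_pow_left₀ hA0 hA 2
  have e5 := pow_le_pow_left₀ (norm_nonneg d) hB 2
  constructor <;> linarith

set_option maxHeartbeats 400000 in
lemma exists_growth_step {R : ℝ} (hR : 1 < R) {s : ℂ → ℂ × ℂ} {X : ℂ → R3} (h : Spin R s X)
    {η₀ a μ ρ b : ℝ} (hη₀ : 0 < η₀) (ha : 0 < a) (hμ : 0 < μ) (hρ : ρ < 1)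
    (hμa : μ ≤ a / 10) (hμ2 : 10 * μ * η₀ ≤ a ^ 2) (hμη : μ ≤ η₀) {e : R3} (he : ‖e‖ = 1)
    {s₁ : ℂ → ℂ × ℂ} {X₁ : ℂ → R3} (h₁ : Spin R s₁ X₁) (hb : b + 2 * a ^ 2 ≤ 4 * η₀ ^ 2)
    (hlow : ∀ ζ, ‖ζ‖ = 1 → η₀ ^ 2 ≤ ‖X₁ ζ - X ζ + η₀ • e‖ ^ 2)
    (hup : ∀ ζ, ‖ζ‖ = 1 → ‖X₁ ζ - X ζ + η₀ • e‖ ^ 2 ≤ b) :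
    ∃ s₂ X₂, Spin R s₂ X₂ ∧ (∀ z, ‖z‖ ≤ ρ → Near μ s₁ s₂ X₁ X₂ z) ∧
      (∀ z, ‖z‖ ≤ 1 → ‖X₂ z - X z‖ ≤ 4 * η₀ + μ ∨ ‖X₂ z - X₁ z‖ ≤ μ) ∧
      (∀ ζ, ‖ζ‖ = 1 → η₀ ^ 2 ≤ ‖X₂ ζ - X ζ + η₀ • e‖ ^ 2) ∧
      (∀ ζ, ‖ζ‖ = 1 → ‖X₂ ζ - X ζ + η₀ • e‖ ^ 2 ≤ b + 2 * a ^ 2) ∧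
      ∀ l, Grow s₁ l → Grow s₂ (l + (a - μ)) := by
  obtain ⟨v, hv⟩ : ∃ v : ℂ → R3, v = fun ζ => X₁ ζ - X ζ + η₀ • e := ⟨_, rfl⟩
  have hXc := continuousOn_unit hR h.continuousOn
  have hX₁c := continuousOn_unit hR h₁.continuousOn
  have hvc : ContinuousOn v (sphere 0 1) := by
    rw [hv]
    exact ((hX₁c.sub hXc).add continuousOn_const).mono sphere_subset_closedBall
  have hvb : ∀ ζ, ‖ζ‖ = 1 → η₀ ≤ ‖v ζ‖ ∧ ‖v ζ‖ ≤ 2 * η₀ := fun ζ hζ => by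
    rw [hv]
    refine ⟨le_of_sq_le_sq (hlow ζ hζ) (norm_nonneg _),
      le_of_sq_le_sq ((hup ζ hζ).trans ?_) (by linarith)⟩
    nlinarith
  have hv0 : ∀ ζ, ‖ζ‖ = 1 → v ζ ≠ 0 := fun ζ hζ =>
    norm_pos_iff.1 (hη₀.trans_le (hvb ζ hζ).1)
  obtain ⟨ρ₁, hρ₁, -, hρ₁1, hosc₁⟩ := exists_radial_modulus hXc hμ hρ
  obtain ⟨ρ₂, hρ₂, hρ₂0, hρ₂1, hosc₂⟩ := exists_radial_modulus hX₁c hμ hρ₁1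
  obtain ⟨s₂, X₂, h₂, hn, ho, ho1, hg, -⟩ := exists_orthogonal_push hR h₁
    (ν := fun ζ => ‖v ζ‖⁻¹ • v ζ) (r := fun _ => a)
    ((hvc.norm.inv₀ fun ζ hζ => (norm_pos_iff.2 (hv0 ζ (by simpa using hζ))).ne').smul hvc)
    (fun ζ hζ => by
      have := norm_pos_iff.2 (hv0 ζ hζ)
      rw [norm_smul, norm_inv, norm_norm]
      field_simp) continuousOn_const (fun _ _ => ha) hμ hρ₂0 hρ₂1
  have hcirc : ∀ ζ, ‖ζ‖ = 1 → X₂ ζ - X ζ + η₀ • e = v ζ + (X₂ ζ - X₁ ζ) := fun ζ _ => by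
    rw [hv]
    dsimp only
    abel
  have hsq : ∀ ζ, ‖ζ‖ = 1 → ‖v ζ‖ ^ 2 ≤ b := fun ζ hζ => by
    rw [hv]
    exact hup ζ hζ
  have hbd : ∀ ζ, ‖ζ‖ = 1 → ∀ t ∈ Icc (0 : ℝ) 1,
      ‖v ζ + (X₂ (t * ζ) - X₁ (t * ζ))‖ ^ 2 ≤ b + 2 * a ^ 2 := fun ζ hζ t ht => by
    obtain ⟨e1, e2⟩ := ho ζ hζ t ht
    have := (norm_add_sq_bounds (hvb ζ hζ).2 (hv0 ζ hζ) e1 le_rfl (norm_nonneg _) e2).2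
    nlinarith [hsq ζ hζ]
  refine ⟨s₂, X₂, h₂, fun z hz => hn z (hz.trans (hρ₁.trans hρ₂)), fun z hz => ?_,
    fun ζ hζ => ?_, fun ζ hζ => ?_, fun l hl => ?_⟩
  · rcases le_total ‖z‖ ρ₂ with hz2 | hz2
    · exact Or.inr (hn z hz2).2.2
    · left
      obtain ⟨ζ, hζ, hzζ⟩ := exists_unit_smul z
      have e1 := hbd ζ hζ ‖z‖ ⟨norm_nonneg _, hz⟩
      have e2 := hosc₁ ζ hζ ‖z‖ (hρ₂.trans hz2) hz
      have e3 := hosc₂ ζ hζ ‖z‖ hz2 hz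
      rw [← hzζ] at e1 e2 e3
      have e4 : ‖v ζ + (X₂ z - X₁ z)‖ ≤ 2 * η₀ :=
        le_of_sq_le_sq (e1.trans (by nlinarith)) (by linarith)
      have e5 : X₂ z - X z = (v ζ + (X₂ z - X₁ z)) + (X₁ z - X₁ ζ) - (X z - X ζ) - η₀ • e := by
        rw [hv]
        dsimp only
        abel
      rw [e5]
      have e6 : ‖η₀ • e‖ = η₀ := by rw [norm_smul, he, mul_one, Real.norm_of_nonneg hη₀.le]
      refine (norm_sub_le _ _).trans ?_
      have := norm_sub_le ((v ζ + (X₂ z - X₁ z)) + (X₁ z - X₁ ζ)) (X z - X ζ)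
      have := norm_add_le (v ζ + (X₂ z - X₁ z)) (X₁ z - X₁ ζ)
      linarith
  · have e0 := ho ζ hζ 1 (right_mem_Icc.2 zero_le_one)
    rw [Complex.ofReal_one, one_mul] at e0
    rw [hcirc ζ hζ]
    have := (norm_add_sq_bounds (hvb ζ hζ).2 (hv0 ζ hζ) e0.1 (by linarith) (ho1 ζ hζ) e0.2).1
    have e1 := pow_le_pow_left₀ hη₀.le (hvb ζ hζ).1 2
    nlinarith
  · have e0 := hbd ζ hζ 1 (right_mem_Icc.2 zero_le_one)
    rw [Complex.ofReal_one, one_mul] at e0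
    rwa [hcirc ζ hζ]
  · rw [← add_sub_assoc]
    exact hg a (fun _ _ => le_rfl) l hl

lemma exists_growth {R : ℝ} (hR : 1 < R) {s : ℂ → ℂ × ℂ} {X : ℂ → R3} (h : Spin R s X)
    {η ρ : ℝ} (hη : 0 < η) (hρ : ρ < 1) :
    ∃ s' X', Spin R s' X' ∧ (∀ z, ‖z‖ ≤ ρ → Near η s s' X X' z) ∧
      (∀ z, ‖z‖ ≤ 1 → ‖X' z - X z‖ ≤ η) ∧ ∀ l, Grow s l → Grow s' (l + 1) := by
  obtain ⟨η₀, hη₀, hη₀'⟩ : ∃ η₀, 0 < η₀ ∧ 8 * η₀ = η := ⟨η / 8, by positivity, by ring⟩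
  obtain ⟨K, hK⟩ := exists_nat_gt (8 / (3 * η₀ ^ 2))
  have hK0 : (0 : ℝ) < K := lt_trans (by positivity) hK
  obtain ⟨a, ha, haK⟩ : ∃ a : ℝ, 0 < a ∧ K * a = 2 := ⟨2 / K, by positivity, by field_simp⟩
  have hKa : K * (2 * a ^ 2) ≤ 3 * η₀ ^ 2 := by
    rw [div_lt_iff₀ (by positivity)] at hK
    have : K * (K * (2 * a ^ 2)) = 8 := by linear_combination (2 * (K * a) + 4) * haK
    by_contra! h'
    nlinarith
  obtain ⟨μ, hμ0, hμ1, hμ2, hμ3⟩ : ∃ μ : ℝ, 0 < μ ∧ μ ≤ a / 10 ∧ 10 * μ * η₀ ≤ a ^ 2 ∧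
      K * μ ≤ η₀ := by
    refine ⟨min (a / 10) (min (a ^ 2 / (10 * η₀)) (η₀ / K)), by positivity, min_le_left _ _,
      ?_, ?_⟩
    · have := (min_le_right (a / 10) (min (a ^ 2 / (10 * η₀)) (η₀ / K))).trans (min_le_left _ _)
      rw [le_div_iff₀ (by positivity)] at this
      linarith
    · have := (min_le_right (a / 10) (min (a ^ 2 / (10 * η₀)) (η₀ / K))).trans (min_le_right _ _)
      rw [le_div_iff₀ (by positivity)] at this
      linarith
  have hK1 : (1 : ℝ) ≤ K := by exact_mod_cast (by exact_mod_cast hK0 : 0 < K)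
  have hμη : μ ≤ η₀ := by nlinarith
  obtain ⟨e, he⟩ : ∃ e : R3, ‖e‖ = 1 := ⟨EuclideanSpace.single 0 1, by simp⟩
  have key : ∀ j : ℕ, j ≤ K → ∃ s₁ X₁, Spin R s₁ X₁ ∧ (∀ z, ‖z‖ ≤ ρ → Near (j * μ) s s₁ X X₁ z) ∧
      (∀ z, ‖z‖ ≤ 1 → ‖X₁ z - X z‖ ≤ 4 * η₀ + j * μ) ∧
      (∀ ζ, ‖ζ‖ = 1 → η₀ ^ 2 ≤ ‖X₁ ζ - X ζ + η₀ • e‖ ^ 2) ∧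
      (∀ ζ, ‖ζ‖ = 1 → ‖X₁ ζ - X ζ + η₀ • e‖ ^ 2 ≤ η₀ ^ 2 + j * (2 * a ^ 2)) ∧
      ∀ l, Grow s l → Grow s₁ (l + j * (a - μ)) := by
    intro j
    induction j with
    | zero =>
      refine fun _ => ⟨s, X, h, fun z _ => by simpa using Near.refl s X z, fun z _ => ?_,
        fun ζ _ => ?_, fun ζ _ => ?_, fun l hl => by simpa using hl⟩
      · simp
        linarith
      · simp [norm_smul, he]
      · simp [norm_smul, he]
    | succ j ih =>
      intro hj
      obtain ⟨s₁, X₁, h₁, hn₁, hc₁, hl₁, hu₁, hg₁⟩ := ih (by omega)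
      have hjK : ((j : ℝ) + 1) * (2 * a ^ 2) ≤ K * (2 * a ^ 2) := by
        gcongr
        exact_mod_cast hj
      obtain ⟨s₂, X₂, h₂, hn₂, hc₂, hl₂, hu₂, hg₂⟩ := exists_growth_step hR h hη₀ ha hμ0 hρ hμ1 hμ2
        hμη he h₁ (by linarith) hl₁ hu₁
      have hj0 : (0 : ℝ) ≤ j := j.cast_nonneg
      push_cast
      refine ⟨s₂, X₂, h₂, fun z hz => ?_, fun z hz => ?_, hl₂, fun ζ hζ => ?_, fun l hl => ?_⟩
      · rw [add_mul, one_mul]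
        exact (hn₁ z hz).trans (hn₂ z hz)
      · rcases hc₂ z hz with h3 | h3
        · nlinarith
        · have h4 := hc₁ z hz
          rw [← sub_add_sub_cancel _ (X₁ z) _]
          exact (norm_add_le _ _).trans (by linarith)
      · linarith [hu₂ ζ hζ]
      · rw [add_mul, one_mul, ← add_assoc]
        exact hg₂ _ (hg₁ l hl)
  obtain ⟨s', X', h', hn, hc, -, -, hg⟩ := key K le_rfl
  refine ⟨s', X', h', fun z hz => (hn z hz).mono (by linarith),
    fun z hz => (hc z hz).trans (by linarith), fun l hl => ?_⟩
  obtain ⟨k, hk, hk1, hk2⟩ := hg l hl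
  refine ⟨k, hk, hk1, le_trans ?_ hk2⟩
  nlinarith

/-- An outer unit normal `n` at the boundary point nearest to `x`, expressed through the
exterior ball of radius `R` and the interior ball of radius `r` at that point. -/
def NormalAt (C : Set R3) (r R : ℝ) (x n : R3) : Prop :=
  ‖n‖ = 1 ∧ (∀ y ∈ closure C, ‖y - x + (R - infDist x Cᶜ) • n‖ ≤ R) ∧
    ∀ y, ‖y - x + (r - infDist x Cᶜ) • n‖ < r → y ∈ C

lemma sub_eq_smul_of_closedBall_subset {p a q : R3} {ρ R : ℝ} (hR : 0 < R) (hρ : 0 ≤ ρ)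
    (ha : ‖p - a‖ = ρ) (hq : ‖p - q‖ = R) (hs : closedBall a ρ ⊆ closedBall q R) :
    p - a = ρ • (R⁻¹ • (p - q)) := by
  obtain ⟨m, hm⟩ : ∃ m, m = R⁻¹ • (p - q) := ⟨_, rfl⟩
  have hm1 : ‖m‖ = 1 := by
    rw [hm, norm_smul, hq, Real.norm_of_nonneg (inv_nonneg.2 hR.le), inv_mul_cancel₀ hR.ne']
  have hmR : p - q = R • m := by rw [hm, smul_smul, mul_inv_cancel₀ hR.ne', one_smul]
  rw [← hm]
  have hb : a + ρ • m ∈ closedBall q R := hs (by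
    rw [mem_closedBall_iff_norm, add_sub_cancel_left, norm_smul, hm1, mul_one,
      Real.norm_of_nonneg hρ])
  rw [mem_closedBall_iff_norm] at hb
  have e1 : a + ρ • m - q = R • m + (ρ • m - (p - a)) := by rw [← hmR]; abel
  rw [e1] at hb
  have e2 := norm_add_sq_real (R • m) (ρ • m - (p - a))
  rw [real_inner_smul_left, inner_sub_right, real_inner_smul_right, real_inner_self_eq_norm_sq,
    hm1, norm_smul, hm1, Real.norm_of_nonneg hR.le] at e2
  have e3 := real_inner_le_norm m (p - a)
  rw [hm1, ha] at e3
  have e4 := pow_le_pow_left₀ (norm_nonneg _) hb 2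
  have e5 : ‖ρ • m - (p - a)‖ ^ 2 ≤ 0 := by nlinarith
  have e6 : ‖ρ • m - (p - a)‖ = 0 := by
    have := norm_nonneg (ρ • m - (p - a)); nlinarith
  exact (sub_eq_zero.1 (norm_eq_zero.1 e6)).symm

lemma ball_infDist_compl_subset (C : Set R3) (x : R3) : ball x (infDist x Cᶜ) ⊆ C := by
  intro y hy
  by_contra h
  have := infDist_le_dist_of_mem (x := x) (mem_compl h)
  rw [mem_ball, dist_comm] at hy
  linarith

lemma infDist_compl_pos {C : Set R3} (hC : IsOpen C) (hn : Cᶜ.Nonempty) {x : R3} (hx : x ∈ C) :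
    0 < infDist x Cᶜ :=
  (hC.isClosed_compl.notMem_iff_infDist_pos hn).1 (by simpa using hx)

lemma exists_normalAt {C : Set R3} (hC : IsOpen C) (hconv : Convex ℝ C) (hn : Cᶜ.Nonempty)
    {r R : ℝ} (hr : 0 < r) (hrR : r ≤ R) (hsph : ∀ p ∈ frontier C,
      (∃ x, p ∈ sphere x r ∧ closedBall x r ⊆ closure C) ∧
      (∃ y, p ∈ sphere y R ∧ closure C ⊆ closedBall y R)) {x : R3} (hx : x ∈ C) :
    ∃ n, NormalAt C r R x n := by
  have hR := hr.trans_le hrR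
  have hd := infDist_compl_pos hC hn hx
  obtain ⟨p, hp, hpd⟩ := hC.isClosed_compl.exists_infDist_eq_dist hn x
  obtain ⟨d, hdd⟩ : ∃ d, d = infDist x Cᶜ := ⟨_, rfl⟩
  rw [← hdd] at hpd hd
  have hxC : closedBall x d ⊆ closure C := by
    rw [← closure_ball x hd.ne', hdd]
    exact closure_mono (ball_infDist_compl_subset C x)
  have hpx : ‖p - x‖ = d := by rw [hpd, dist_comm, dist_eq_norm]
  have hpf : p ∈ frontier C := by
    rw [hC.frontier_eq]
    exact ⟨hxC (by rw [mem_closedBall_iff_norm, hpx]), hp⟩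
  obtain ⟨⟨y, hpy, hy⟩, q, hpq, hq⟩ := hsph p hpf
  rw [mem_sphere_iff_norm] at hpy hpq
  have e1 := sub_eq_smul_of_closedBall_subset hR hd.le hpx hpq (hxC.trans hq)
  have e2 := sub_eq_smul_of_closedBall_subset hR hr.le hpy hpq (hy.trans hq)
  obtain ⟨m, hm⟩ : ∃ m, m = R⁻¹ • (p - q) := ⟨_, rfl⟩
  have hmR : p - q = R • m := by rw [hm, smul_smul, mul_inv_cancel₀ hR.ne', one_smul]
  rw [← hm] at e1 e2
  refine ⟨m, ?_, fun z hz => ?_, fun z hz => ?_⟩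
  · rw [hm, norm_smul, hpq, Real.norm_of_nonneg (inv_nonneg.2 hR.le), inv_mul_cancel₀ hR.ne']
  · have : z - x + (R - infDist x Cᶜ) • m = z - q := by
      rw [← hdd, sub_smul, ← e1, ← hmR]; abel
    rw [this, ← mem_closedBall_iff_norm]
    exact hq hz
  · have : z - x + (r - infDist x Cᶜ) • m = z - y := by
      rw [← hdd, sub_smul, ← e1, ← e2]; abel
    rw [this, ← mem_ball_iff_norm] at hz
    have h1 : z ∈ interior (closure C) :=
      mem_interior.2 ⟨ball y r, ball_subset_closedBall.trans hy, isOpen_ball, hz⟩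
    rwa [hconv.interior_closure_eq_interior_of_nonempty_interior (by
      rw [hC.interior_eq]; exact ⟨x, hx⟩), hC.interior_eq] at h1

lemma norm_add_le_of_closedBall_subset {q y : R3} {ρ R : ℝ} (hρ : 0 ≤ ρ)
    (hs : closedBall y ρ ⊆ closedBall q R) : ‖y - q‖ + ρ ≤ R := by
  obtain ⟨m, hm, hmy⟩ : ∃ m : R3, ‖m‖ = 1 ∧ y - q = ‖y - q‖ • m := by
    by_cases h : y - q = 0
    · exact ⟨EuclideanSpace.single 0 1, by simp, by simp [h]⟩
    · exact ⟨‖y - q‖⁻¹ • (y - q), by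
        rw [norm_smul, norm_inv, norm_norm, inv_mul_cancel₀ (norm_ne_zero_iff.2 h)], by
        rw [smul_smul, mul_inv_cancel₀ (norm_ne_zero_iff.2 h), one_smul]⟩
  have hb : y + ρ • m ∈ closedBall q R := hs (by
    rw [mem_closedBall_iff_norm, add_sub_cancel_left, norm_smul, hm, mul_one,
      Real.norm_of_nonneg hρ])
  rw [mem_closedBall_iff_norm] at hb
  have : y + ρ • m - q = (‖y - q‖ + ρ) • m := by
    rw [add_smul, ← hmy]; abel
  rw [this, norm_smul, hm, mul_one, Real.norm_of_nonneg (by positivity)] at hb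
  exact hb

namespace NormalAt

variable {C : Set R3} {r R : ℝ} {x n : R3}

lemma infDist_le (hN : NormalAt C r R x n) (hC : IsOpen C) (hn : Cᶜ.Nonempty) {y : R3}
    (hy : y ∈ C) : infDist y Cᶜ ≤ R - ‖y - x + (R - infDist x Cᶜ) • n‖ := by
  have h1 := norm_add_le_of_closedBall_subset (q := x - (R - infDist x Cᶜ) • n) (y := y) (R := R)
    (ρ := infDist y Cᶜ) infDist_nonneg (by
      rw [← closure_ball y (infDist_compl_pos hC hn hy).ne']
      refine (closure_mono (ball_infDist_compl_subset C y)).trans fun z hz => ?_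
      rw [mem_closedBall_iff_norm, sub_sub_eq_add_sub, add_sub_right_comm]
      exact hN.2.1 z hz)
  rw [sub_sub_eq_add_sub, add_sub_right_comm] at h1
  linarith

lemma inner_le (hN : NormalAt C r R x n) {y : R3} (hy : y ∈ closure C) :
    inner ℝ (y - x) n ≤ infDist x Cᶜ := by
  have h1 := (real_inner_le_norm (y - x + (R - infDist x Cᶜ) • n) n).trans
    (mul_le_mul_of_nonneg_right (hN.2.1 y hy) (norm_nonneg _))
  rw [inner_add_left, real_inner_smul_left, real_inner_self_eq_norm_sq, hN.1] at h1
  linarith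

lemma infDist_le_sub_inner (hN : NormalAt C r R x n) (hC : IsOpen C) (hn : Cᶜ.Nonempty) {y : R3}
    (hy : y ∈ C) : infDist y Cᶜ ≤ infDist x Cᶜ - inner ℝ (y - x) n := by
  have h1 := hN.infDist_le hC hn hy
  have h2 := real_inner_le_norm (y - x + (R - infDist x Cᶜ) • n) n
  rw [inner_add_left, real_inner_smul_left, real_inner_self_eq_norm_sq, hN.1] at h2
  linarith

lemma norm_sub_sq_le (hN : NormalAt C r R x n) (hr : 0 ≤ r) {x' n' : R3}
    (hN' : NormalAt C r R x' n') (hcl : ∀ y, ‖y - x + (r - infDist x Cᶜ) • n‖ ≤ r → y ∈ closure C) :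
    (r - infDist x Cᶜ) * ‖n - n'‖ ^ 2 ≤ 4 * ‖x - x'‖ := by
  have h1 : x - (r - infDist x Cᶜ) • n + r • n' ∈ closure C := hcl _ (by
    have : x - (r - infDist x Cᶜ) • n + r • n' - x + (r - infDist x Cᶜ) • n = r • n' := by abel
    rw [this, norm_smul, hN'.1, mul_one, Real.norm_of_nonneg hr])
  have h2 := hN'.inner_le h1
  have h3 : x - (r - infDist x Cᶜ) • n + r • n' - x' = (x - x') - (r - infDist x Cᶜ) • n + r • n' := by
    abel
  rw [h3, inner_add_left, inner_sub_left, real_inner_smul_left, real_inner_smul_left,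
    real_inner_self_eq_norm_sq, hN'.1] at h2
  have h4 := norm_sub_sq_real n n'
  rw [hN.1, hN'.1] at h4
  have h5 := neg_le_of_abs_le (abs_real_inner_le_norm (x - x') n')
  rw [hN'.1] at h5
  have h6 : infDist x' Cᶜ ≤ infDist x Cᶜ + ‖x - x'‖ := by
    rw [← dist_eq_norm, dist_comm]
    exact infDist_le_infDist_add_dist
  rw [h4]
  nlinarith

end NormalAt

lemma NormalAt.mem_closure {C : Set R3} {r R : ℝ} {x n : R3} (hN : NormalAt C r R x n)
    (hr : 0 < r) {y : R3} (hy : ‖y - x + (r - infDist x Cᶜ) • n‖ ≤ r) : y ∈ closure C := by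
  have h1 : ball (x - (r - infDist x Cᶜ) • n) r ⊆ C := fun z hz => hN.2.2 z (by
    rwa [mem_ball_iff_norm, sub_sub_eq_add_sub, add_sub_right_comm] at hz)
  apply closure_mono h1
  rw [closure_ball _ hr.ne', mem_closedBall_iff_norm, sub_sub_eq_add_sub, add_sub_right_comm]
  exact hy

lemma exists_continuous_normal {C : Set R3} {r R : ℝ} (hr : 0 < r)
    (hN : ∀ x ∈ C, ∃ n, NormalAt C r R x n) :
    ∃ N : R3 → R3, (∀ x ∈ C, NormalAt C r R x (N x)) ∧
      ContinuousOn N {x ∈ C | infDist x Cᶜ ≤ r / 2} := by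
  choose! N hN using hN
  refine ⟨N, hN, fun x hx => ?_⟩
  rw [ContinuousWithinAt, tendsto_iff_norm_sub_tendsto_zero]
  have h1 : Tendsto (fun y => √(8 / r * ‖x - y‖)) (𝓝[{x ∈ C | infDist x Cᶜ ≤ r / 2}] x) (𝓝 0) := by
    have : Continuous fun y => √(8 / r * ‖x - y‖) := by fun_prop
    simpa using (this.tendsto x).mono_left nhdsWithin_le_nhds
  refine squeeze_zero' (Eventually.of_forall fun _ => norm_nonneg _) ?_ h1
  filter_upwards [self_mem_nhdsWithin] with y hy
  apply Real.le_sqrt_of_sq_le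
  have h2 := (hN x hx.1).norm_sub_sq_le hr.le (hN y hy.1) fun _ h => (hN x hx.1).mem_closure hr h
  have h3 := hx.2
  rw [norm_sub_rev, div_mul_eq_mul_div, le_div_iff₀ hr]
  nlinarith [sq_nonneg ‖N x - N y‖]

lemma norm_add_smul_sq {u n : R3} (hn : ‖n‖ = 1) (c : ℝ) :
    ‖u + c • n‖ ^ 2 = ‖u‖ ^ 2 + 2 * c * inner ℝ u n + c ^ 2 := by
  rw [norm_add_sq_real, real_inner_smul_right, norm_smul, hn, mul_one, Real.norm_eq_abs, sq_abs]
  ring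

lemma norm_add_smul_lt {u n : R3} {d r τ : ℝ} (hn : ‖n‖ = 1) (hd : 0 < d) (hdr : d ≤ r / 2)
    (hτ : 0 ≤ τ) (hτd : 10 * τ < d) (hu : ‖u‖ ≤ √(r * d) + τ) (hi : |inner ℝ u n| ≤ τ) :
    ‖u + (r - d) • n‖ < r := by
  have hr : 0 < r := by linarith
  have h1 := norm_add_smul_sq (u := u) hn (r - d)
  have h2 := Real.sq_sqrt (show 0 ≤ r * d by positivity)
  have h3 : √(r * d) ≤ r := Real.sqrt_le_iff.2 ⟨hr.le, by nlinarith⟩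
  have h4 := pow_le_pow_left₀ (norm_nonneg u) hu 2
  have h5 := (abs_le.1 hi).2
  refine lt_of_pow_lt_pow_left₀ 2 hr.le ?_
  have h6 : √(r * d) * τ ≤ r * τ := mul_le_mul_of_nonneg_right h3 hτ
  have h7 : (r - d) * inner ℝ u n ≤ r * τ :=
    (mul_le_mul_of_nonneg_left h5 (by linarith)).trans
      (mul_le_mul_of_nonneg_right (by linarith) hτ)
  have h8 : r * (10 * τ) < r * d := mul_lt_mul_of_pos_left hτd hr
  nlinarith

lemma sub_norm_add_smul_le {u n : R3} {d r R τ : ℝ} (hn : ‖n‖ = 1) (hd : 0 < d) (hdr : d ≤ r / 2)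
    (hrR : r ≤ R) (hτ : 0 ≤ τ) (hτd : 8 * R * τ ≤ r * d) (hu : √(r * d) - τ ≤ ‖u‖)
    (hi : |inner ℝ u n| ≤ τ) :
    R - ‖u + (R - d) • n‖ ≤ (1 - r / (4 * R)) * d := by
  have hr : 0 < r := by linarith
  have hR : 0 < R := by linarith
  have h1 := norm_add_smul_sq (u := u) hn (R - d)
  have h2 := Real.sq_sqrt (show 0 ≤ r * d by positivity)
  have h0 := Real.sqrt_nonneg (r * d)
  have h3 : √(r * d) ≤ r := Real.sqrt_le_iff.2 ⟨hr.le, by nlinarith⟩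
  have h4 : r * d - 2 * R * τ ≤ ‖u‖ ^ 2 := by
    have : √(r * d) * τ ≤ R * τ := mul_le_mul_of_nonneg_right (h3.trans hrR) hτ
    rcases le_total τ (√(r * d)) with h | h
    · have := pow_le_pow_left₀ (sub_nonneg.2 h) hu 2
      nlinarith
    · nlinarith [sq_nonneg ‖u‖]
  have h5 := (abs_le.1 hi).1
  have h7 : -(R * τ) ≤ (R - d) * inner ℝ u n := by
    have := mul_le_mul_of_nonneg_left h5 (show 0 ≤ R - d by linarith)
    nlinarith
  obtain ⟨q, hq, hqR⟩ : ∃ q, q = r / (4 * R) ∧ 4 * R * q = r := ⟨_, rfl, by field_simp⟩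
  rw [← hq]
  have hq0 : 0 < q := by rw [hq]; positivity
  have hq1 : q ≤ 1 / 4 := by nlinarith
  rw [sub_le_comm]
  refine le_of_sq_le_sq ?_ (norm_nonneg _)
  rw [h1]
  have h8 : ((1 - q) * d) ^ 2 ≤ d ^ 2 := by
    exact pow_le_pow_left₀ (mul_nonneg (by linarith) hd.le) (by nlinarith) 2
  have h9 : R * (q * d) * 4 = r * d := by rw [← hqR]; ring
  nlinarith

lemma exists_boundary_push {C : Set R3} (hC : IsOpen C) (hn : Cᶜ.Nonempty) {r R₀ : ℝ} (hr : 0 < r)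
    (hrR : r ≤ R₀) (hN : ∀ x ∈ C, ∃ n, NormalAt C r R₀ x n)
    {R : ℝ} (hR : 1 < R) {s : ℂ → ℂ × ℂ} {X : ℂ → R3} (h : Spin R s X)
    (hX : ∀ z, ‖z‖ ≤ 1 → X z ∈ C) {δ : ℝ} (hδ : ∀ ζ, ‖ζ‖ = 1 → infDist (X ζ) Cᶜ ≤ δ)
    (hδr : δ ≤ r / 2) {η ρ : ℝ} (hη : 0 < η) (hρ : ρ < 1) :
    ∃ s' X', Spin R s' X' ∧ (∀ z, ‖z‖ ≤ ρ → Near η s s' X X' z) ∧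
      (∀ z, ‖z‖ ≤ 1 → X' z ∈ C ∧ ‖X' z - X z‖ ≤ √(r * δ) + η ∧
        infDist (X' z) Cᶜ ≤ max (infDist (X z) Cᶜ) δ + η) ∧
      (∀ ζ, ‖ζ‖ = 1 → infDist (X' ζ) Cᶜ ≤ (1 - r / (4 * R₀)) * δ) ∧
      (∀ l, Grow s l → Grow s' (l - η)) ∧ ∀ z, ‖z‖ ≤ 1 → s' z ≠ 0 := by
  have hXc := continuousOn_unit hR h.continuousOn
  have hR₀ := hr.trans_le hrR
  obtain ⟨m, hm, hmX⟩ : ∃ m, 0 < m ∧ ∀ z, ‖z‖ ≤ 1 → m ≤ infDist (X z) Cᶜ := by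
    obtain ⟨z₀, hz₀, hmin⟩ := (isCompact_closedBall (0 : ℂ) 1).exists_isMinOn ⟨0, by simp⟩
      ((continuous_infDist_pt Cᶜ).comp_continuousOn hXc)
    exact ⟨_, infDist_compl_pos hC hn (hX z₀ (by simpa using hz₀)),
      fun z hz => hmin (by simpa using hz)⟩
  obtain ⟨N, hNN, hNc⟩ := exists_continuous_normal hr hN
  obtain ⟨τ, hτ, hτη, hτm, hτR⟩ : ∃ τ : ℝ, 0 < τ ∧ 2 * τ ≤ η ∧ 10 * (2 * τ) < m ∧
      8 * R₀ * (2 * τ) ≤ r * m := by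
    refine ⟨min (η / 2) (min (m / 30) (r * m / (16 * R₀))), by positivity, ?_, ?_, ?_⟩
    · linarith [min_le_left (η / 2) (min (m / 30) (r * m / (16 * R₀)))]
    · linarith [(min_le_right (η / 2) (min (m / 30) (r * m / (16 * R₀)))).trans (min_le_left _ _)]
    · have := (min_le_right (η / 2) (min (m / 30) (r * m / (16 * R₀)))).trans (min_le_right _ _)
      rw [le_div_iff₀ (by positivity)] at this
      linarith
  obtain ⟨ρ₁, hρ₁, hρ₁0, hρ₁1, hosc⟩ := exists_radial_modulus hXc hτ hρ
  have hcirc : MapsTo X (sphere 0 1) {x ∈ C | infDist x Cᶜ ≤ r / 2} := fun ζ hζ => by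
    rw [mem_sphere_zero_iff_norm] at hζ
    exact ⟨hX ζ hζ.le, (hδ ζ hζ).trans hδr⟩
  have hXs := hXc.mono sphere_subset_closedBall
  obtain ⟨s', X', h', hn', ho, ho1, hg, hs'⟩ := exists_orthogonal_push hR h
    (ν := fun ζ => N (X ζ)) (r := fun ζ => √(r * infDist (X ζ) Cᶜ))
    (hNc.comp hXs hcirc) (fun ζ hζ => (hNN _ (hX ζ hζ.le)).1)
    (Real.continuous_sqrt.comp_continuousOn
      (continuousOn_const.mul ((continuous_infDist_pt Cᶜ).comp_continuousOn hXs)))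
    (fun ζ hζ => Real.sqrt_pos.2 (mul_pos hr (hm.trans_le (hmX ζ hζ.le)))) hτ hρ₁0 hρ₁1
  have hsq : ∀ ζ, ‖ζ‖ = 1 → √(r * infDist (X ζ) Cᶜ) ≤ √(r * δ) := fun ζ hζ =>
    Real.sqrt_le_sqrt (mul_le_mul_of_nonneg_left (hδ ζ hζ) hr.le)
  have hsmall : ∀ z, ‖z‖ ≤ 1 → ‖z‖ ≤ ρ₁ → X' z ∈ C := fun z hz1 hz => by
    have e1 := (hn' z hz).2.2
    by_contra hc
    have e2 := infDist_le_dist_of_mem (x := X z) (mem_compl hc)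
    rw [dist_comm, dist_eq_norm] at e2
    linarith [hmX z hz1]
  have hray : ∀ ζ, ‖ζ‖ = 1 → ∀ t : ℝ, ρ₁ ≤ t → t ≤ 1 →
      ‖X' (t * ζ) - X ζ‖ ≤ √(r * infDist (X ζ) Cᶜ) + 2 * τ ∧
      |inner ℝ (X' (t * ζ) - X ζ) (N (X ζ))| ≤ 2 * τ := fun ζ hζ t ht0 ht1 => by
    obtain ⟨e1, e2⟩ := ho ζ hζ t ⟨hρ₁0.trans ht0, ht1⟩
    have e3 := hosc ζ hζ t ht0 ht1
    have e4 : X' (t * ζ) - X ζ = (X' (t * ζ) - X (t * ζ)) + (X (t * ζ) - X ζ) := by abel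
    rw [e4]
    constructor
    · linarith [norm_add_le (X' (t * ζ) - X (t * ζ)) (X (t * ζ) - X ζ)]
    · rw [inner_add_left]
      have e5 := abs_real_inner_le_norm (X (t * ζ) - X ζ) (N (X ζ))
      rw [(hNN _ (hX ζ hζ.le)).1] at e5
      linarith [abs_add_le (inner ℝ (X' (t * ζ) - X (t * ζ)) (N (X ζ)))
        (inner ℝ (X (t * ζ) - X ζ) (N (X ζ)))]
  have hrayC : ∀ ζ, ‖ζ‖ = 1 → ∀ t : ℝ, ρ₁ ≤ t → t ≤ 1 → X' (t * ζ) ∈ C := fun ζ hζ t ht0 ht1 => by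
    obtain ⟨e1, e2⟩ := hray ζ hζ t ht0 ht1
    exact (hNN _ (hX ζ hζ.le)).2.2 _ (norm_add_smul_lt (hNN _ (hX ζ hζ.le)).1
      (hm.trans_le (hmX ζ hζ.le)) ((hδ ζ hζ).trans hδr) (by positivity)
      (hτm.trans_le (hmX ζ hζ.le)) e1 e2)
  refine ⟨s', X', h', fun z hz => (hn' z (hz.trans hρ₁)).mono (by linarith), fun z hz => ?_,
    fun ζ hζ => ?_, fun l hl => ?_, hs'⟩
  · obtain ⟨ζ, hζ, hzζ⟩ := exists_unit_smul z
    have e1 := (ho ζ hζ ‖z‖ ⟨norm_nonneg _, hz⟩).2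
    rw [← hzζ] at e1
    refine ⟨?_, by linarith [hsq ζ hζ], ?_⟩
    · rcases le_total ‖z‖ ρ₁ with hz1 | hz1
      · exact hsmall z hz hz1
      · rw [hzζ]
        exact hrayC ζ hζ _ hz1 hz
    · rcases le_total ‖z‖ ρ₁ with hz1 | hz1
      · have e2 := (hn' z hz1).2.2
        rw [← dist_eq_norm] at e2
        have e3 := infDist_le_infDist_add_dist (s := Cᶜ) (x := X' z) (y := X z)
        linarith [le_max_left (infDist (X z) Cᶜ) δ]
      · have e2 := (hNN _ (hX ζ hζ.le)).infDist_le_sub_inner hC hn (hrayC ζ hζ _ hz1 hz)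
        have e3 := (abs_le.1 (hray ζ hζ _ hz1 hz).2).1
        rw [← hzζ] at e2 e3
        linarith [le_max_right (infDist (X z) Cᶜ) δ, hδ ζ hζ]
  · have e1 := hrayC ζ hζ 1 hρ₁1.le le_rfl
    have e2 := (hray ζ hζ 1 hρ₁1.le le_rfl).2
    rw [Complex.ofReal_one, one_mul] at e1 e2
    refine ((hNN _ (hX ζ hζ.le)).infDist_le hC hn e1).trans
      ((sub_norm_add_smul_le (τ := 2 * τ) (hNN _ (hX ζ hζ.le)).1 (hm.trans_le (hmX ζ hζ.le))
        ((hδ ζ hζ).trans hδr) hrR (by positivity) (hτR.trans ?_) ?_ e2).trans ?_)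
    · exact mul_le_mul_of_nonneg_left (hmX ζ hζ.le) hr.le
    · linarith [ho1 ζ hζ]
    · refine mul_le_mul_of_nonneg_left (hδ ζ hζ) ?_
      rw [sub_nonneg, div_le_one (by positivity)]
      linarith
  · have := hg 0 (fun _ _ => Real.sqrt_nonneg _) l hl
    rw [add_zero] at this
    obtain ⟨g, hgc, hg1, hg2⟩ := this
    exact ⟨g, hgc, hg1, by linarith⟩

lemma exists_seq_of_step {α : Type*} {P : ℕ → α → Prop} {Q : ℕ → α → α → Prop} {a₀ : α}
    (h0 : P 0 a₀) (hs : ∀ k a, P k a → ∃ b, P (k + 1) b ∧ Q k a b) :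
    ∃ f : ℕ → α, f 0 = a₀ ∧ (∀ k, P k (f k)) ∧ ∀ k, Q k (f k) (f (k + 1)) := by
  choose! F hF using hs
  refine ⟨fun k => Nat.rec a₀ F k, rfl, ?_, ?_⟩
  · intro k
    induction k with
    | zero => exact h0
    | succ k ih => exact (hF k _ ih).1
  · intro k
    have : P k (Nat.rec a₀ F k) := by
      induction k with
      | zero => exact h0
      | succ k ih => exact (hF k _ ih).1
    exact (hF k _ this).2

lemma Grow.mono {s : ℂ → ℂ × ℂ} {l l' : ℝ} (h : Grow s l) (hl : l' ≤ l) : Grow s l' := by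
  obtain ⟨g, hg, hg1, hg2⟩ := h
  exact ⟨g, hg, hg1, hl.trans hg2⟩

lemma exists_infDist_lower_bound {C : Set R3} (hC : IsOpen C) (hn : Cᶜ.Nonempty) {X : ℂ → R3}
    (hXc : ContinuousOn X (closedBall 0 1)) (hX : ∀ z, ‖z‖ ≤ 1 → X z ∈ C) :
    ∃ m, 0 < m ∧ ∀ z, ‖z‖ ≤ 1 → m ≤ infDist (X z) Cᶜ := by
  obtain ⟨z₀, hz₀, hmin⟩ := (isCompact_closedBall (0 : ℂ) 1).exists_isMinOn ⟨0, by simp⟩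
    ((continuous_infDist_pt Cᶜ).comp_continuousOn hXc)
  exact ⟨_, infDist_compl_pos hC hn (hX z₀ (by simpa using hz₀)), fun z hz => hmin (by simpa using hz)⟩

lemma mem_of_norm_sub_lt_infDist {C : Set R3} {x y : R3} (h : ‖y - x‖ < infDist x Cᶜ) : y ∈ C := by
  by_contra hc
  have := infDist_le_dist_of_mem (x := x) (mem_compl hc)
  rw [dist_comm, dist_eq_norm] at this
  linarith

lemma exists_growth_push {C : Set R3} (hC : IsOpen C) (hn : Cᶜ.Nonempty) {r R₀ : ℝ} (hr : 0 < r)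
    (hrR : r ≤ R₀) (hN : ∀ x ∈ C, ∃ n, NormalAt C r R₀ x n)
    {R : ℝ} (hR : 1 < R) {s : ℂ → ℂ × ℂ} {X : ℂ → R3} (h : Spin R s X)
    (hX : ∀ z, ‖z‖ ≤ 1 → X z ∈ C) {δ : ℝ} (hδ0 : 0 < δ)
    (hδ : ∀ ζ, ‖ζ‖ = 1 → infDist (X ζ) Cᶜ ≤ δ)
    (hδr : δ ≤ r / 4) {η ρ : ℝ} (hη : 0 < η) (hρ : ρ < 1) :
    ∃ s' X', Spin R s' X' ∧ (∀ z, ‖z‖ ≤ ρ → Near η s s' X X' z) ∧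
      (∀ z, ‖z‖ ≤ 1 → X' z ∈ C ∧ ‖X' z - X z‖ ≤ √(2 * r * δ) + η ∧
        infDist (X' z) Cᶜ ≤ max (infDist (X z) Cᶜ) δ + η) ∧
      (∀ ζ, ‖ζ‖ = 1 → infDist (X' ζ) Cᶜ ≤ (1 - r / (8 * R₀)) * δ) ∧
      (∀ l, Grow s l → Grow s' (l + 1 / 2)) ∧ ∀ z, ‖z‖ ≤ 1 → s' z ≠ 0 := by
  have hXc := continuousOn_unit hR h.continuousOn
  have hR₀ := hr.trans_le hrR
  obtain ⟨m, hm, hmX⟩ := exists_infDist_lower_bound hC hn hXc hX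
  obtain ⟨τ, hτ, hτη, hτm, hτδ, hτδ1, hτ1⟩ : ∃ τ : ℝ, 0 < τ ∧ 2 * τ ≤ η ∧ 2 * τ ≤ m ∧
      τ ≤ r / (8 * R₀) * δ ∧ τ ≤ δ ∧ τ ≤ 1 / 2 := by
    refine ⟨min (min (η / 2) (m / 2)) (min (r / (8 * R₀) * δ) (min δ (1 / 2))), by positivity,
      ?_, ?_, ?_, ?_, ?_⟩
    · linarith [(min_le_left (min (η / 2) (m / 2))
        (min (r / (8 * R₀) * δ) (min δ (1 / 2)))).trans (min_le_left _ _)]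
    · linarith [(min_le_left (min (η / 2) (m / 2))
        (min (r / (8 * R₀) * δ) (min δ (1 / 2)))).trans (min_le_right _ _)]
    · exact (min_le_right _ _).trans (min_le_left _ _)
    · exact (min_le_right _ _).trans ((min_le_right _ _).trans (min_le_left _ _))
    · exact (min_le_right _ _).trans ((min_le_right _ _).trans (min_le_right _ _))
  obtain ⟨s₁, X₁, h₁, hn₁, hX₁, hg₁⟩ := exists_growth hR h hτ hρ
  have hd : ∀ z, ‖z‖ ≤ 1 → infDist (X₁ z) Cᶜ ≤ infDist (X z) Cᶜ + τ := fun z hz => by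
    have := infDist_le_infDist_add_dist (s := Cᶜ) (x := X₁ z) (y := X z)
    rw [dist_eq_norm] at this
    linarith [hX₁ z hz]
  obtain ⟨s₂, X₂, h₂, hn₂, hX₂, hc₂, hg₂, hs₂⟩ := exists_boundary_push hC hn hr hrR hN hR h₁
    (fun z hz => mem_of_norm_sub_lt_infDist (x := X z) (by linarith [hX₁ z hz, hmX z hz]))
    (δ := δ + τ) (fun ζ hζ => (hd ζ hζ.le).trans (by linarith [hδ ζ hζ])) (by linarith) hτ hρ
  refine ⟨s₂, X₂, h₂, fun z hz => ((hn₁ z hz).trans (hn₂ z hz)).mono (by linarith),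
    fun z hz => ?_, fun ζ hζ => (hc₂ ζ hζ).trans ?_, fun l hl => (hg₂ _ (hg₁ l hl)).mono (by linarith),
    hs₂⟩
  · obtain ⟨e1, e2, e3⟩ := hX₂ z hz
    refine ⟨e1, ?_, ?_⟩
    · have e4 : √(r * (δ + τ)) ≤ √(2 * r * δ) := Real.sqrt_le_sqrt (by nlinarith)
      have e5 := norm_add_le (X₂ z - X₁ z) (X₁ z - X z)
      rw [sub_add_sub_cancel] at e5
      linarith [hX₁ z hz]
    · have : max (infDist (X₁ z) Cᶜ) (δ + τ) ≤ max (infDist (X z) Cᶜ) δ + τ :=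
        max_le ((hd z hz).trans (by linarith [le_max_left (infDist (X z) Cᶜ) δ]))
          (by linarith [le_max_right (infDist (X z) Cᶜ) δ])
      linarith
  · obtain ⟨q, hq, hq'⟩ : ∃ q, q = r / (8 * R₀) ∧ r / (4 * R₀) = 2 * q :=
      ⟨_, rfl, by field_simp; norm_num⟩
    rw [← hq] at hτδ ⊢
    have hq0 : 0 < q := by rw [hq]; positivity
    rw [hq']
    nlinarith

/-- The data of one step of the construction: a null disc with its spinor, an inner radius, a
tolerance for later perturbations, and a radial lower bound for the metric. -/
structure Stage where
  spin : ℂ → ℂ × ℂ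
  map : ℂ → R3
  rad : ℝ
  tol : ℝ
  dens : ℝ → ℝ

structure Stage.Valid (C : Set R3) (R δ L : ℝ) (a : Stage) : Prop where
  isSpin : Spin R a.spin a.map
  mem : ∀ z, ‖z‖ ≤ 1 → a.map z ∈ C
  circle : ∀ ζ, ‖ζ‖ = 1 → infDist (a.map ζ) Cᶜ ≤ δ
  grow : Grow a.spin L
  rad_nonneg : 0 ≤ a.rad
  rad_lt : a.rad < 1
  tol_pos : 0 < a.tol
  tol_le : a.tol ≤ δ
  osc : ∀ ζ, ‖ζ‖ = 1 → ∀ t : ℝ, a.rad ≤ t → t ≤ 1 → ‖a.map (t * ζ) - a.map ζ‖ ≤ δ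
  spin_ne : ∀ z, ‖z‖ ≤ 1 → ∀ t, ‖t - a.spin z‖ ≤ 2 * a.tol → t ≠ 0
  mem_near : ∀ z, ‖z‖ ≤ 1 → ∀ y, ‖y - a.map z‖ ≤ 2 * a.tol → y ∈ C
  dens_cont : Continuous a.dens
  dens_nonneg : ∀ t, 0 ≤ a.dens t
  dens_le : ∀ z, ‖z‖ ≤ 1 → ∀ t, ‖t - a.spin z‖ ≤ 2 * a.tol → a.dens ‖z‖ ≤ spinSq t
  integral_ge : L - 2 ≤ ∫ t in (0 : ℝ)..a.rad, a.dens t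

lemma exists_stage {C : Set R3} (hC : IsOpen C) (hn : Cᶜ.Nonempty) {R : ℝ} (hR : 1 < R)
    {s : ℂ → ℂ × ℂ} {X : ℂ → R3} (h : Spin R s X) (hX : ∀ z, ‖z‖ ≤ 1 → X z ∈ C) {δ : ℝ}
    (hδ0 : 0 < δ) (hδ : ∀ ζ, ‖ζ‖ = 1 → infDist (X ζ) Cᶜ ≤ δ) {L : ℝ} (hL : Grow s L)
    (hs : ∀ z, ‖z‖ ≤ 1 → s z ≠ 0) {ρ η : ℝ} (hρ : ρ < 1) (hη : 0 < η) :
    ∃ a : Stage, a.Valid C R δ L ∧ a.spin = s ∧ a.map = X ∧ ρ ≤ a.rad ∧ a.tol ≤ η := by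
  have hXc := continuousOn_unit hR h.continuousOn
  obtain ⟨m, hm, hmX⟩ := exists_infDist_lower_bound hC hn hXc hX
  obtain ⟨m', hm', hmS⟩ : ∃ m, 0 < m ∧ ∀ z, ‖z‖ ≤ 1 → m ≤ ‖s z‖ := by
    have hsc : ContinuousOn s (closedBall 0 1) :=
      h.1.continuousOn.mono (closedBall_subset_ball hR)
    obtain ⟨z₀, hz₀, hmin⟩ := (isCompact_closedBall (0 : ℂ) 1).exists_isMinOn ⟨0, by simp⟩ hsc.norm
    exact ⟨_, norm_pos_iff.2 (hs z₀ (by simpa using hz₀)), fun z hz => hmin (by simpa using hz)⟩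
  obtain ⟨M, hM, hMs⟩ := h.exists_bound hR
  obtain ⟨g, hg, hg1, hg2⟩ := hL
  obtain ⟨τ, hτ, hτη, hτδ, hτm, hτm', hτ1, hτM⟩ : ∃ τ : ℝ, 0 < τ ∧ τ ≤ η ∧ τ ≤ δ ∧ 2 * τ < m ∧
      2 * τ < m' ∧ τ ≤ 1 ∧ τ * (8 * M + 8) ≤ 1 := by
    obtain ⟨τ, hτ, hτ'⟩ : ∃ τ : ℝ, 0 < τ ∧
        τ ≤ min (min (min η δ) (min (m / 3) (m' / 3))) (min 1 (1 / (8 * M + 8))) :=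
      ⟨_, by positivity, le_rfl⟩
    simp only [le_min_iff] at hτ'
    obtain ⟨⟨⟨e1, e2⟩, e3, e4⟩, e5, e6⟩ := hτ'
    rw [le_div_iff₀ (by positivity)] at e6
    exact ⟨τ, hτ, e1, e2, by linarith, by linarith, e5, e6⟩
  obtain ⟨k, hk⟩ : ∃ k : ℝ → ℝ, k = fun t => max (g t - 1) 0 := ⟨_, rfl⟩
  have hkc : Continuous k := by rw [hk]; fun_prop
  have hk0 : ∀ t, 0 ≤ k t := fun t => by rw [hk]; exact le_max_right _ _
  have hki : L - 1 ≤ ∫ t in (0 : ℝ)..1, k t := by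
    have e1 : ∫ t in (0 : ℝ)..1, (g t - 1) ≤ ∫ t in (0 : ℝ)..1, k t :=
      intervalIntegral.integral_mono_on zero_le_one
        ((hg.sub continuous_const).intervalIntegrable _ _) (hkc.intervalIntegrable _ _)
        fun t _ => by rw [hk]; exact le_max_left _ _
    rw [intervalIntegral.integral_sub (hg.intervalIntegrable _ _)
      (continuous_const.intervalIntegrable _ _)] at e1
    simp only [intervalIntegral.integral_const] at e1
    norm_num at e1
    linarith
  obtain ⟨ρ₁, hρ₁, hρ₁0, hρ₁1, hosc⟩ := exists_radial_modulus hXc hδ0 hρ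
  obtain ⟨ρ₂, hρ₂, hρ₂1, hint⟩ : ∃ ρ₂, ρ₁ ≤ ρ₂ ∧ ρ₂ < 1 ∧ L - 2 ≤ ∫ t in (0 : ℝ)..ρ₂, k t := by
    have e1 : Continuous fun x => ∫ t in (0 : ℝ)..x, k t :=
      intervalIntegral.continuous_primitive (fun a b => hkc.intervalIntegrable a b) 0
    have e2 : ∀ᶠ x in 𝓝[<] (1 : ℝ), L - 2 < ∫ t in (0 : ℝ)..x, k t :=
      ((e1.tendsto 1).mono_left nhdsWithin_le_nhds).eventually_const_lt (by linarith)
    obtain ⟨x, hx1, hx2, hx3⟩ := (e2.and (Ioo_mem_nhdsLT hρ₁1)).exists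
    exact ⟨x, hx2.le, hx3, hx1.le⟩
  refine ⟨⟨s, X, ρ₂, τ, k⟩, ⟨h, hX, hδ, ⟨g, hg, hg1, hg2⟩, hρ₁0.trans hρ₂, hρ₂1, hτ, hτδ,
    fun ζ hζ t ht => hosc ζ hζ t (hρ₂.trans ht), fun z hz t ht h0 => ?_, fun z hz y hy => ?_,
    hkc, hk0, fun z hz t ht => ?_, hint⟩, rfl, rfl, hρ₁.trans hρ₂, hτη⟩
  · simp only [h0, zero_sub, norm_neg] at ht
    linarith [hmS z hz]
  · exact mem_of_norm_sub_lt_infDist (x := X z) (lt_of_le_of_lt hy (by linarith [hmX z hz]))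
  · simp only [hk]
    refine max_le ?_ (spinSq_nonneg t)
    simp only at ht
    have e1 := (abs_le.1 (abs_spinSq_sub_le t (s z))).1
    have e2 := hMs z hz
    have e3 := norm_sub_norm_le t (s z)
    have e4 : ‖t‖ + ‖s z‖ ≤ 2 * M + 2 := by linarith
    have e5 : ‖t - s z‖ * (‖t‖ + ‖s z‖) ≤ 2 * τ * (2 * M + 2) :=
      mul_le_mul ht e4 (by positivity) (by positivity)
    have := hg1 z hz
    nlinarith

lemma tendsto_zero_of_halving {τ : ℕ → ℝ} (hτ : ∀ k, τ (k + 1) ≤ τ k / 2) (hτ0 : ∀ k, 0 < τ k) :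
    Tendsto τ atTop (𝓝 0) := by
  have h1 : ∀ k, τ k ≤ τ 0 * (1 / 2) ^ k := by
    intro k
    induction k with
    | zero => simp
    | succ k ih => rw [pow_succ]; linarith [hτ k]
  refine squeeze_zero (fun k => (hτ0 k).le) h1 ?_
  simpa using (tendsto_pow_atTop_nhds_zero_of_lt_one (by norm_num : (0 : ℝ) ≤ 1 / 2)
    (by norm_num)).const_mul (τ 0)

lemma near_of_halving {s : ℕ → ℂ → ℂ × ℂ} {X : ℕ → ℂ → R3} {ρ τ : ℕ → ℝ} (hρ : Monotone ρ)
    (hτ : ∀ k, τ (k + 1) ≤ τ k / 2)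
    (hnear : ∀ k z, ‖z‖ ≤ ρ k → Near (τ k) (s k) (s (k + 1)) (X k) (X (k + 1)) z)
    {k : ℕ} {z : ℂ} (hz : ‖z‖ ≤ ρ k) (j : ℕ) :
    Near (2 * τ k - 2 * τ (k + j)) (s k) (s (k + j)) (X k) (X (k + j)) z := by
  induction j with
  | zero => simpa using Near.refl (s k) (X k) z
  | succ j ih =>
    refine (ih.trans (hnear (k + j) z (hz.trans (hρ (Nat.le_add_right k j))))).mono ?_
    have := hτ (k + j)
    rw [← add_assoc]
    linarith

lemma exists_spin_limit {R : ℝ} (hR : 1 ≤ R) {s : ℕ → ℂ → ℂ × ℂ} {X : ℕ → ℂ → R3}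
    (hS : ∀ k, Spin R (s k) (X k)) {ρ τ : ℕ → ℝ} (hρ : Monotone ρ)
    (hρ1 : ∀ x : ℝ, x < 1 → ∃ k, x < ρ k)
    (hτ : ∀ k, τ (k + 1) ≤ τ k / 2) (hτ0 : ∀ k, 0 < τ k)
    (hnear : ∀ k z, ‖z‖ ≤ ρ k → Near (τ k) (s k) (s (k + 1)) (X k) (X (k + 1)) z) :
    ∃ S Y, Spin 1 S Y ∧ ∀ k z, ‖z‖ ≤ ρ k → Near (2 * τ k) (s k) S (X k) Y z := by
  have hlim := tendsto_zero_of_halving hτ hτ0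
  have hpt : ∀ z : ℂ, ∃ p : (ℂ × ℂ) × R3, ∀ k, ‖z‖ ≤ ρ k → ‖p.1 - s k z‖ ≤ 2 * τ k ∧
      ‖nullVec p.1 - nullVec (s k z)‖ ≤ 2 * τ k ∧ ‖p.2 - X k z‖ ≤ 2 * τ k := fun z => by
    by_cases hz : ∃ K, ‖z‖ ≤ ρ K
    · obtain ⟨K, hK⟩ := hz
      have hb : Tendsto (fun n => 2 * τ (K + n)) atTop (𝓝 0) := by
        have : Tendsto (fun n => K + n) atTop atTop := by
          simpa only [add_comm K] using tendsto_add_atTop_nat K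
        simpa using (hlim.comp this).const_mul 2
      have hn : ∀ n m, n ≤ m →
          Near (2 * τ (K + n)) (s (K + n)) (s (K + m)) (X (K + n)) (X (K + m)) z := by
        intro n m hnm
        obtain ⟨j, rfl⟩ := Nat.exists_eq_add_of_le hnm
        have := near_of_halving hρ hτ hnear (hK.trans (hρ (Nat.le_add_right K n))) j
        rw [add_assoc] at this
        exact this.mono (by linarith [hτ0 (K + (n + j))])
      obtain ⟨p, hp⟩ := cauchySeq_tendsto_of_complete (cauchySeq_of_le_tendsto_0'
        (s := fun n => s (K + n) z) _ (fun n m hnm => by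
          rw [dist_comm, dist_eq_norm]; exact (hn n m hnm).1) hb)
      obtain ⟨p', hp'⟩ := cauchySeq_tendsto_of_complete (cauchySeq_of_le_tendsto_0'
        (s := fun n => X (K + n) z) _ (fun n m hnm => by
          rw [dist_comm, dist_eq_norm]; exact (hn n m hnm).2.2) hb)
      refine ⟨(p, p'), fun k hk => ?_⟩
      have hev : ∀ᶠ n in atTop, Near (2 * τ k) (s k) (s (K + n)) (X k) (X (K + n)) z := by
        filter_upwards [eventually_ge_atTop k] with n hn
        obtain ⟨j, hj⟩ := Nat.exists_eq_add_of_le (hn.trans (Nat.le_add_left n K))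
        rw [hj]
        exact (near_of_halving hρ hτ hnear hk j).mono (by linarith [hτ0 (k + j)])
      exact ⟨le_of_tendsto (hp.sub_const _).norm (hev.mono fun n h => h.1),
        le_of_tendsto ((((continuous_nullVec.tendsto p).comp hp).sub_const _).norm)
          (hev.mono fun n h => h.2.1),
        le_of_tendsto (hp'.sub_const _).norm (hev.mono fun n h => h.2.2)⟩
    · exact ⟨0, fun k hk => (hz ⟨k, hk⟩).elim⟩
  choose p hp using hpt
  have hunif : ∀ ε > 0, ∀ x ∈ ball (0 : ℂ) 1, ∃ t ∈ 𝓝[ball (0 : ℂ) 1] x, ∀ᶠ n in atTop, ∀ y ∈ t,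
      ‖y‖ ≤ ρ n ∧ 4 * τ n < ε := fun ε hε x hx => by
    obtain ⟨K, hK⟩ := hρ1 ‖x‖ (by simpa using hx)
    refine ⟨ball 0 (ρ K), mem_nhdsWithin_of_mem_nhds (isOpen_ball.mem_nhds (by simpa using hK)), ?_⟩
    filter_upwards [eventually_ge_atTop K, (hlim.const_mul 4).eventually_lt_const (by simpa using hε)]
      with n hn hn2 y hy
    exact ⟨(by simpa using hy : ‖y‖ < ρ K).le.trans (hρ hn), hn2⟩
  refine ⟨fun z => (p z).1, fun z => (p z).2, ⟨?_, fun z hz => ?_⟩, fun k z hz => hp z k hz⟩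
  · have : TendstoLocallyUniformlyOn s (fun z => (p z).1) atTop (ball 0 1) := by
      rw [Metric.tendstoLocallyUniformlyOn_iff]
      intro ε hε x hx
      obtain ⟨t, ht, h⟩ := hunif ε hε x hx
      refine ⟨t, ht, h.mono fun n hn y hy => ?_⟩
      rw [dist_eq_norm]
      linarith [(hp y n (hn y hy).1).1, (hn y hy).2, hτ0 n]
    exact this.differentiableOn
      (Eventually.of_forall fun n => (hS n).1.mono (ball_subset_ball hR)) isOpen_ball
  · refine hasFDerivAt_of_tendstoLocallyUniformlyOn (l := atTop) (f := X)
      (f' := fun n z => reMap (nullVec (s n z))) (g' := fun z => reMap (nullVec (p z).1))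
      isOpen_ball ?_ (fun n x hx => (hS n).2 x (ball_subset_ball hR hx)) (fun x hx => ?_) hz
    · rw [Metric.tendstoLocallyUniformlyOn_iff]
      intro ε hε x hx
      obtain ⟨t, ht, h⟩ := hunif ε hε x hx
      refine ⟨t, ht, h.mono fun n hn y hy => ?_⟩
      rw [dist_eq_norm, ← reMap_sub]
      exact (norm_reMap_le _).trans_lt
        (by linarith [(hp y n (hn y hy).1).2.1, (hn y hy).2])
    · rw [tendsto_iff_norm_sub_tendsto_zero]
      obtain ⟨K, hK⟩ := hρ1 ‖x‖ (by simpa using hx)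
      refine squeeze_zero' (Eventually.of_forall fun _ => norm_nonneg _) ?_
        (by simpa using hlim.const_mul 2)
      filter_upwards [eventually_ge_atTop K] with n hn
      rw [norm_sub_rev]
      exact (hp x n (hK.le.trans (hρ hn))).2.2

lemma exists_index_between {ρ : ℕ → ℝ} (hρ : Monotone ρ) {x : ℝ} (hx : ∃ n, x < ρ n) {K : ℕ}
    (hK : ρ K ≤ x) : ∃ k, K ≤ k ∧ ρ k ≤ x ∧ x < ρ (k + 1) := by
  classical
  have h1 := Nat.find_spec hx
  have h2 : K < Nat.find hx := by
    by_contra! h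
    exact (h1.trans_le ((hρ h).trans hK)).false
  obtain ⟨k, hk⟩ := Nat.exists_eq_succ_of_ne_zero (Nat.ne_zero_of_lt h2)
  refine ⟨k, by omega, not_lt.1 (Nat.find_min hx (m := k) (by omega)), ?_⟩
  rwa [hk] at h1

structure Stage.Step (C : Set R3) (r δ ρ : ℝ) (a b : Stage) : Prop where
  near : ∀ z, ‖z‖ ≤ a.rad → Near a.tol a.spin b.spin a.map b.map z
  displacement : ∀ z, ‖z‖ ≤ 1 → ‖b.map z - a.map z‖ ≤ √(2 * r * δ) + a.tol
  depth : ∀ z, ‖z‖ ≤ 1 → infDist (b.map z) Cᶜ ≤ max (infDist (a.map z) Cᶜ) δ + a.tol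
  rad_le : a.rad ≤ b.rad
  le_rad : ρ ≤ b.rad
  tol_le : b.tol ≤ a.tol / 2

lemma exists_stage_seq {C : Set R3} (hC : IsOpen C) (hn : Cᶜ.Nonempty) {r R₀ : ℝ} (hr : 0 < r)
    (hrR : r ≤ R₀) (hN : ∀ x ∈ C, ∃ n, NormalAt C r R₀ x n)
    {R : ℝ} (hR : 1 < R) {s : ℂ → ℂ × ℂ} {X : ℂ → R3} (h : Spin R s X)
    (hX : ∀ z, ‖z‖ ≤ 1 → X z ∈ C) {δ : ℝ} (hδ0 : 0 < δ)
    (hδ : ∀ ζ, ‖ζ‖ = 1 → infDist (X ζ) Cᶜ ≤ δ) (hδr : δ ≤ r / 4) (hs : ∀ z, ‖z‖ ≤ 1 → s z ≠ 0) :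
    ∃ f : ℕ → Stage, (f 0).map = X ∧
      (∀ k : ℕ, (f k).Valid C R ((1 - r / (8 * R₀)) ^ k * δ) (k / 2)) ∧
      ∀ k : ℕ, (f k).Step C r ((1 - r / (8 * R₀)) ^ k * δ) (1 - 1 / ((k : ℝ) + 2)) (f (k + 1)) := by
  have hR₀ := hr.trans_le hrR
  obtain ⟨κ, hκ⟩ : ∃ κ, κ = 1 - r / (8 * R₀) := ⟨_, rfl⟩
  have hκ0 : 0 < κ := by
    rw [hκ, sub_pos, div_lt_one (by positivity)]; linarith
  have hκ1 : κ ≤ 1 := by rw [hκ, sub_le_self_iff]; positivity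
  rw [← hκ]
  obtain ⟨a₀, ha₀, -, hX₀, -⟩ := exists_stage hC hn hR h hX hδ0 hδ (L := 0)
    ⟨fun _ => 0, continuous_const, fun z _ => spinSq_nonneg _, by simp⟩ hs zero_lt_one zero_lt_one
  obtain ⟨f, hf0, hf1, hf2⟩ := exists_seq_of_step (a₀ := a₀)
    (P := fun k a => a.Valid C R (κ ^ k * δ) (k / 2))
    (Q := fun k a b => a.Step C r (κ ^ k * δ) (1 - 1 / ((k : ℝ) + 2)) b)
    (by simpa using ha₀) (fun k a ha => by
      have hδk : 0 < κ ^ k * δ := by positivity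
      have hδk' : κ ^ k * δ ≤ δ := mul_le_of_le_one_left hδ0.le (pow_le_one₀ hκ0.le hκ1)
      obtain ⟨s', X', h', hn', hX', hc', hg', hs'⟩ := exists_growth_push hC hn hr hrR hN hR ha.isSpin
        ha.mem hδk ha.circle (hδk'.trans hδr) ha.tol_pos ha.rad_lt
      rw [← hκ, ← mul_assoc, ← pow_succ'] at hc'
      obtain ⟨b, hb, rfl, rfl, hb1, hb2⟩ := exists_stage hC hn hR h' (fun z hz => (hX' z hz).1)
        (by positivity) hc' (hg' _ ha.grow) hs' (ρ := max a.rad (1 - 1 / ((k : ℝ) + 2)))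
        (η := a.tol / 2) (max_lt ha.rad_lt (sub_lt_self _ (by positivity))) (half_pos ha.tol_pos)
      refine ⟨b, ?_, hn', fun z hz => (hX' z hz).2.1, fun z hz => (hX' z hz).2.2,
        (le_max_left _ _).trans hb1, (le_max_right _ _).trans hb1, hb2⟩
      convert hb using 1
      push_cast
      ring)
  exact ⟨f, by rw [hf0, hX₀], hf1, hf2⟩

lemma exists_complete_spin {C : Set R3} (hC : IsOpen C) (hn : Cᶜ.Nonempty) {r R₀ : ℝ} (hr : 0 < r)
    (hrR : r ≤ R₀) (hN : ∀ x ∈ C, ∃ n, NormalAt C r R₀ x n)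
    {R : ℝ} (hR : 1 < R) {s : ℂ → ℂ × ℂ} {X : ℂ → R3} (h : Spin R s X)
    (hX : ∀ z, ‖z‖ ≤ 1 → X z ∈ C) {δ : ℝ} (hδ0 : 0 < δ)
    (hδ : ∀ ζ, ‖ζ‖ = 1 → infDist (X ζ) Cᶜ ≤ δ) (hδr : δ ≤ r / 4) (hs : ∀ z, ‖z‖ ≤ 1 → s z ≠ 0)
    {q : ℝ} (hq0 : 0 < q) (hq1 : q < 1) (hq : q ^ 2 = 1 - r / (8 * R₀)) :
    ∃ S Y, Spin 1 S Y ∧ (∀ z, ‖z‖ < 1 → S z ≠ 0 ∧ Y z ∈ C) ∧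
      (∀ L : ℝ, ∃ ρ, 0 ≤ ρ ∧ ρ < 1 ∧ ∃ g : ℝ → ℝ, Continuous g ∧ (∀ t, 0 ≤ g t) ∧
        (∀ z, ‖z‖ ≤ ρ → g ‖z‖ ≤ spinSq (S z)) ∧ L ≤ ∫ t in (0 : ℝ)..ρ, g t) ∧
      (∀ ε > 0, ∃ ρ < 1, ∀ z, ρ ≤ ‖z‖ → ‖z‖ < 1 → infDist (Y z) Cᶜ ≤ ε) ∧
      ∃ ρ, 0 ≤ ρ ∧ ρ < 1 ∧ ∀ ζ, ‖ζ‖ = 1 → ∀ t : ℝ, ρ ≤ t → t < 1 →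
        ‖Y (t * ζ) - X ζ‖ ≤ (√(2 * r * δ) + δ) / (1 - q) + 3 * δ := by
  obtain ⟨f, hf0, hV, hQ⟩ := exists_stage_seq hC hn hr hrR hN hR h hX hδ0 hδ hδr hs
  rw [← hq] at hV hQ
  obtain ⟨δs, hδs⟩ : ∃ δs : ℕ → ℝ, δs = fun k => (q ^ 2) ^ k * δ := ⟨_, rfl⟩
  have hV : ∀ k : ℕ, (f k).Valid C R (δs k) (k / 2) := by rw [hδs]; exact hV
  have hQ : ∀ k : ℕ, (f k).Step C r (δs k) (1 - 1 / ((k : ℝ) + 2)) (f (k + 1)) := by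
    rw [hδs]; exact hQ
  have hδs0 : ∀ k, 0 < δs k := fun k => by rw [hδs]; positivity
  have hq2 : q ^ 2 < 1 := pow_lt_one₀ hq0.le hq1 two_ne_zero
  have hδlim : Tendsto δs atTop (𝓝 0) := by
    rw [hδs]
    simpa using (tendsto_pow_atTop_nhds_zero_of_lt_one (by positivity) hq2).mul_const δ
  have hδsq : ∀ k, δs k ≤ q ^ k * δ := fun k => by
    rw [hδs]
    dsimp only
    rw [← pow_mul, mul_comm 2, pow_mul]
    have h1 : q ^ k ≤ 1 := pow_le_one₀ hq0.le hq1.le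
    have h2 : 0 < q ^ k := by positivity
    have : (q ^ k) ^ 2 ≤ q ^ k := by nlinarith
    exact mul_le_mul_of_nonneg_right this hδ0.le
  have hδsδ : ∀ k, δs k ≤ δ := fun k =>
    (hδsq k).trans (mul_le_of_le_one_left hδ0.le (pow_le_one₀ hq0.le hq1.le))
  have hsqrt : ∀ k, √(2 * r * δs k) = q ^ k * √(2 * r * δ) := fun k => by
    rw [hδs]
    dsimp only
    rw [show 2 * r * ((q ^ 2) ^ k * δ) = (q ^ k) ^ 2 * (2 * r * δ) by ring,
      Real.sqrt_mul (by positivity), Real.sqrt_sq (by positivity)]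
  have hρ : Monotone fun k => (f k).rad := monotone_nat_of_le_succ fun k => (hQ k).rad_le
  have hρ1 : ∀ x : ℝ, x < 1 → ∃ k, x < (f k).rad := fun x hx => by
    obtain ⟨k, hk⟩ := exists_nat_gt (1 / (1 - x))
    rw [div_lt_iff₀ (by linarith)] at hk
    refine ⟨k + 1, lt_of_lt_of_le ?_ (hQ k).le_rad⟩
    rw [lt_sub_comm, div_lt_iff₀ (by positivity)]
    nlinarith
  obtain ⟨S, Y, hSY, hnear⟩ := exists_spin_limit hR.le (fun k => (hV k).isSpin) hρ hρ1
    (fun k => (hQ k).tol_le) (fun k => (hV k).tol_pos) (fun k => (hQ k).near)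
  have hbet : ∀ K (z : ℂ), (f K).rad ≤ ‖z‖ → ‖z‖ < 1 → ∃ k, K ≤ k ∧ (f k).rad ≤ ‖z‖ ∧
      ‖z‖ < (f (k + 1)).rad := fun K z h1 h2 => exists_index_between hρ (hρ1 _ h2) h1
  refine ⟨S, Y, hSY, fun z hz => ?_, fun L => ?_, fun ε hε => ?_, (f 0).rad, (hV 0).rad_nonneg,
    (hV 0).rad_lt, fun ζ hζ t ht0 ht1 => ?_⟩
  · obtain ⟨k, hk⟩ := hρ1 _ hz
    exact ⟨(hV k).spin_ne z hz.le _ (hnear k z hk.le).1,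
      (hV k).mem_near z hz.le _ (hnear k z hk.le).2.2⟩
  · obtain ⟨k, hk⟩ := exists_nat_gt (2 * (L + 2))
    refine ⟨(f k).rad, (hV k).rad_nonneg, (hV k).rad_lt, (f k).dens, (hV k).dens_cont,
      (hV k).dens_nonneg, fun z hz => (hV k).dens_le z (hz.trans (hV k).rad_lt.le) _
        (hnear k z hz).1, ?_⟩
    linarith [(hV k).integral_ge]
  · obtain ⟨K, hK⟩ := (hδlim.eventually_lt_const (by positivity : (0 : ℝ) < ε / 5)).exists_forall_of_atTop
    refine ⟨(f K).rad, (hV K).rad_lt, fun z hz hz1 => ?_⟩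
    obtain ⟨k, hKk, hk1, hk2⟩ := hbet K z hz hz1
    have e1 := (hnear (k + 1) z hk2.le).2.2
    have e2 := (hQ k).depth z hz1.le
    have e3 : infDist ((f k).map z) Cᶜ ≤ 2 * δs k := by
      obtain ⟨ζ, hζ, hzζ⟩ := exists_unit_smul z
      have a1 := (hV k).osc ζ hζ ‖z‖ hk1 hz1.le
      rw [← hzζ, ← dist_eq_norm] at a1
      have a2 := infDist_le_infDist_add_dist (s := Cᶜ) (x := (f k).map z) (y := (f k).map ζ)
      linarith [(hV k).circle ζ hζ]
    have e4 := infDist_le_infDist_add_dist (s := Cᶜ) (x := Y z) (y := (f (k + 1)).map z)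
    rw [dist_eq_norm] at e4
    have e5 := max_le e3 (by linarith [hδs0 k] : δs k ≤ 2 * δs k)
    linarith [(hV k).tol_le, (hQ k).tol_le, hK k hKk]
  · have hz : ‖(t : ℂ) * ζ‖ = t := norm_ofReal_mul_unit hζ ((hV 0).rad_nonneg.trans ht0)
    obtain ⟨E, hE⟩ : ∃ E, E = (√(2 * r * δ) + δ) / (1 - q) := ⟨_, rfl⟩
    have hE1 : E * (1 - q) = √(2 * r * δ) + δ := by
      rw [hE, div_mul_cancel₀ _ (by linarith)]
    have hE0 : 0 ≤ E := by
      rw [hE]; exact div_nonneg (by positivity) (by linarith)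
    rw [← hE]
    have hstep : ∀ k z, ‖z‖ ≤ 1 → ‖(f (k + 1)).map z - (f k).map z‖ ≤ E * (q ^ k - q ^ (k + 1)) := by
      intro k z hz
      refine ((hQ k).displacement z hz).trans ?_
      rw [hsqrt]
      have : E * (q ^ k - q ^ (k + 1)) = q ^ k * √(2 * r * δ) + q ^ k * δ := by
        rw [← mul_add, ← hE1]; ring
      linarith [(hV k).tol_le, hδsq k]
    have hsum : ∀ k z, ‖z‖ ≤ 1 → ‖(f k).map z - X z‖ ≤ E * (1 - q ^ k) := by
      intro k z hz
      induction k with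
      | zero => simp [hf0]
      | succ k ih =>
        have := norm_add_le ((f (k + 1)).map z - (f k).map z) ((f k).map z - X z)
        rw [sub_add_sub_cancel] at this
        linarith [hstep k z hz]
    obtain ⟨k, -, hk1, hk2⟩ := hbet 0 (t * ζ) (by rwa [hz]) (by rwa [hz])
    have e1 := (hnear (k + 1) _ hk2.le).2.2
    have e2 := hstep k (t * ζ) (by rw [hz]; exact ht1.le)
    have e3 := (hV k).osc ζ hζ t (by rwa [hz] at hk1) ht1.le
    have e4 := hsum k ζ hζ.le
    have e5 : Y (t * ζ) - X ζ = (Y (t * ζ) - (f (k + 1)).map (t * ζ)) +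
        ((f (k + 1)).map (t * ζ) - (f k).map (t * ζ)) + ((f k).map (t * ζ) - (f k).map ζ) +
        ((f k).map ζ - X ζ) := by abel
    rw [e5]
    refine norm_add₄_le.trans ?_
    have e6 : 0 ≤ E * q ^ (k + 1) := by positivity
    have e7 := (hV (k + 1)).tol_le
    linarith [hδsδ k, hδsδ (k + 1)]

/-- `reMap` as a real-linear map in the vector. -/
def reMapL : (Fin 3 → ℂ) →L[ℝ] ℂ →L[ℝ] R3 :=
  LinearMap.toContinuousLinearMap
    { toFun := reMap
      map_add' := reMap_add
      map_smul' := fun a c => by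
        ext v i
        simp [mul_assoc] }

lemma Spin.contDiffOn {R : ℝ} {s : ℂ → ℂ × ℂ} {X : ℂ → R3} (h : Spin R s X) :
    ContDiffOn ℝ (⊤ : ℕ∞) X (ball 0 R) := by
  have h1 : ContDiffOn ℝ (⊤ : ℕ∞) (fun z => reMap (nullVec (s z))) (ball 0 R) := by
    have e1 : ContDiffOn ℂ (⊤ : ℕ∞) (fun z => nullVec (s z)) (ball 0 R) :=
      (differentiable_nullVec.comp_differentiableOn h.1).contDiffOn isOpen_ball
    exact reMapL.contDiff.comp_contDiffOn (e1.restrict_scalars ℝ)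
  refine (contDiffOn_infty_iff_fderiv_of_isOpen isOpen_ball).2
    ⟨fun z hz => (h.2 z hz).differentiableAt.differentiableWithinAt,
      h1.congr fun z hz => (h.2 z hz).fderiv⟩

lemma Spin.harmOn {R : ℝ} {s : ℂ → ℂ × ℂ} {X : ℂ → R3} (h : Spin R s X) (i : Fin 3) :
    HarmOn (fun z => X z i) (ball 0 R) := by
  intro z hz
  have hX : ∀ w ∈ ball (0 : ℂ) R, ∀ v, fderiv ℝ (fun z => X z i) w v = (nullVec (s w) i * v).re := by
    intro w hw v
    have e1 : HasFDerivAt (fun z => X z i)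
        ((EuclideanSpace.proj i : R3 →L[ℝ] ℝ).comp (reMap (nullVec (s w)))) w :=
      (EuclideanSpace.proj i : R3 →L[ℝ] ℝ).hasFDerivAt.comp w (h.2 w hw)
    rw [e1.fderiv]
    simp
  have hd : DifferentiableAt ℂ (fun w => nullVec (s w) i) z :=
    (differentiable_pi.1 differentiable_nullVec i _).comp z
      (h.1.differentiableAt (isOpen_ball.mem_nhds hz))
  have key : ∀ v u : ℂ, fderiv ℝ (fun w => fderiv ℝ (fun z => X z i) w v) z u =
      (deriv (fun w => nullVec (s w) i) z * v * u).re := by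
    intro v u
    have e1 : (fun w => fderiv ℝ (fun z => X z i) w v) =ᶠ[𝓝 z] fun w => (nullVec (s w) i * v).re :=
      (isOpen_ball.mem_nhds hz : ball (0 : ℂ) R ∈ 𝓝 z) |> Filter.eventually_of_mem <| fun w hw =>
        hX w hw v
    rw [e1.fderiv_eq]
    have e2 := Complex.reCLM.hasFDerivAt.comp z
      ((hd.hasDerivAt.mul_const v).hasFDerivAt.restrictScalars ℝ)
    have e3 : fderiv ℝ (fun w => (nullVec (s w) i * v).re) z = _ := e2.fderiv
    rw [e3]
    simp [mul_comm u]
  rw [key, key, mul_assoc, mul_assoc, Complex.I_mul_I]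
  simp

lemma Spin.confMinImmOn {R : ℝ} {s : ℂ → ℂ × ℂ} {X : ℂ → R3} (h : Spin R s X)
    (hs : ∀ z ∈ ball (0 : ℂ) R, s z ≠ 0) : ConfMinImmOn X (ball 0 R) :=
  ⟨h.contDiffOn, h.harmOn, fun z hz => ⟨spinSq (s z), spinSq_pos (hs z hz), fun v => by
    rw [(h.2 z hz).fderiv, norm_reMap_nullVec]⟩⟩

lemma Spin.hasStrictFDerivAt {R : ℝ} {s : ℂ → ℂ × ℂ} {X : ℂ → R3} (h : Spin R s X) {z : ℂ}
    (hz : z ∈ ball (0 : ℂ) R) : HasStrictFDerivAt X (reMap (nullVec (s z))) z := by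
  refine hasStrictFDerivAt_of_hasFDerivAt_of_continuousAt (f' := fun z => reMap (nullVec (s z)))
    (eventually_of_mem (isOpen_ball.mem_nhds hz) h.2) ?_
  exact (continuous_reMap.comp continuous_nullVec).continuousAt.comp
    (h.1.continuousOn.continuousAt (isOpen_ball.mem_nhds hz))

/-- A radial primitive of a lower bound for the metric is locally Lipschitz for the induced
length. -/
lemma exists_local_metric_bound {R : ℝ} {s : ℂ → ℂ × ℂ} {X : ℂ → R3} (h : Spin R s X) {ρ : ℝ}
    {g : ℝ → ℝ} (hg : Continuous g) (hg0 : ∀ t, 0 ≤ g t)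
    (hle : ∀ z, ‖z‖ ≤ ρ → g ‖z‖ ≤ spinSq (s z)) {z : ℂ} (hz : z ∈ ball (0 : ℂ) R) (hs : s z ≠ 0) :
    ∃ U, IsOpen U ∧ z ∈ U ∧ ∀ a ∈ U, ∀ b ∈ U,
      |(∫ t in (0 : ℝ)..min ‖a‖ ρ, g t) - ∫ t in (0 : ℝ)..min ‖b‖ ρ, g t| ≤ 4 * ‖X a - X b‖ := by
  rcases lt_or_ge ρ ‖z‖ with hzρ | hzρ
  · refine ⟨{w | ρ < ‖w‖}, isOpen_lt continuous_const continuous_norm, hzρ, fun a ha b hb => ?_⟩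
    rw [min_eq_right (le_of_lt ha), min_eq_right (le_of_lt hb), sub_self, abs_zero]
    positivity
  · obtain ⟨c, hc⟩ : ∃ c, c = spinSq (s z) := ⟨_, rfl⟩
    have hc0 : 0 < c := hc ▸ spinSq_pos hs
    have h1 : ∀ᶠ p : ℂ × ℂ in 𝓝 (z, z),
        ‖X p.1 - X p.2 - reMap (nullVec (s z)) (p.1 - p.2)‖ ≤ c / 2 * ‖p.1 - p.2‖ :=
      (h.hasStrictFDerivAt hz).isLittleO.def (half_pos hc0)
    obtain ⟨δ₁, hδ₁, h1⟩ := Metric.eventually_nhds_iff.1 h1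
    have h2 : ∀ᶠ t in 𝓝 ‖z‖, g t < 2 * c :=
      (hg.tendsto ‖z‖).eventually_lt_const (by linarith [hc ▸ hle z hzρ])
    obtain ⟨δ₂, hδ₂, h2⟩ := Metric.eventually_nhds_iff.1 h2
    refine ⟨ball z (min δ₁ δ₂), isOpen_ball, mem_ball_self (by positivity), fun a ha b hb => ?_⟩
    have hmin : ∀ w ∈ ball z (min δ₁ δ₂), |min ‖w‖ ρ - ‖z‖| < δ₂ := fun w hw => by
      have e1 := abs_min_sub_min_le_max ‖w‖ ρ ‖z‖ ρ
      rw [min_eq_left hzρ, sub_self, abs_zero, max_eq_left (abs_nonneg _)] at e1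
      rw [mem_ball_iff_norm] at hw
      exact e1.trans_lt ((abs_norm_sub_norm_le w z).trans_lt (hw.trans_le (min_le_right _ _)))
    have e1 : ‖X a - X b - reMap (nullVec (s z)) (a - b)‖ ≤ c / 2 * ‖a - b‖ := by
      refine h1 (y := (a, b)) ?_
      rw [Prod.dist_eq]
      exact max_lt ((mem_ball.1 ha).trans_le (min_le_left _ _))
        ((mem_ball.1 hb).trans_le (min_le_left _ _))
    have e2 := norm_reMap_nullVec (s z) (a - b)
    rw [← hc] at e2
    have e3 := norm_sub_norm_le (reMap (nullVec (s z)) (a - b)) (X a - X b)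
    rw [norm_sub_rev (reMap (nullVec (s z)) (a - b))] at e3
    have e4 : |(∫ t in (0 : ℝ)..min ‖a‖ ρ, g t) - ∫ t in (0 : ℝ)..min ‖b‖ ρ, g t| ≤
        2 * c * ‖a - b‖ := by
      rw [intervalIntegral.integral_interval_sub_left (hg.intervalIntegrable _ _)
        (hg.intervalIntegrable _ _), ← Real.norm_eq_abs]
      refine (intervalIntegral.norm_integral_le_of_norm_le_const (C := 2 * c) fun t ht => ?_).trans ?_
      · rw [Real.norm_of_nonneg (hg0 t)]
        refine (h2 ?_).le
        rw [Real.dist_eq]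
        have a1 := abs_lt.1 (hmin a ha)
        have a2 := abs_lt.1 (hmin b hb)
        rw [abs_lt]
        rcases uIoc_subset_uIcc ht with ⟨b1, b2⟩
        rcases le_total (min ‖a‖ ρ) (min ‖b‖ ρ) with hab | hab
        · rw [inf_eq_right.2 hab] at b1
          rw [sup_eq_left.2 hab] at b2
          constructor <;> linarith
        · rw [inf_eq_left.2 hab] at b1
          rw [sup_eq_right.2 hab] at b2
          constructor <;> linarith
      · refine mul_le_mul_of_nonneg_left ?_ (by positivity)
        have e5 := abs_min_sub_min_le_max ‖a‖ ρ ‖b‖ ρ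
        rw [sub_self, abs_zero, max_eq_left (abs_nonneg _)] at e5
        exact e5.trans (abs_norm_sub_norm_le a b)
    linarith

lemma Spin.completeOn {s : ℂ → ℂ × ℂ} {X : ℂ → R3} (h : Spin 1 s X)
    (hs : ∀ z ∈ ball (0 : ℂ) 1, s z ≠ 0)
    (hgrow : ∀ L : ℝ, ∃ ρ, 0 ≤ ρ ∧ ρ < 1 ∧ ∃ g : ℝ → ℝ, Continuous g ∧ (∀ t, 0 ≤ g t) ∧
        (∀ z, ‖z‖ ≤ ρ → g ‖z‖ ≤ spinSq (s z)) ∧ L ≤ ∫ t in (0 : ℝ)..ρ, g t) :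
    CompleteOn X (ball 0 1) := by
  rintro γ ⟨hγ, hγD, hγK⟩
  have hγ0 : ‖γ 0‖ < 1 := by simpa using hγD (left_mem_Ico.2 zero_lt_one)
  obtain ⟨B, hB0, hB⟩ : ∃ B, 0 ≤ B ∧ ∀ z, ‖z‖ ≤ ‖γ 0‖ → spinSq (s z) ≤ B := by
    have hc : ContinuousOn (fun z => spinSq (s z)) (closedBall 0 ‖γ 0‖) :=
      continuous_spinSq.comp_continuousOn (h.1.continuousOn.mono (closedBall_subset_ball hγ0))
    obtain ⟨B, hB⟩ := (isCompact_closedBall (0 : ℂ) ‖γ 0‖).exists_bound_of_continuousOn hc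
    refine ⟨max B 0, le_max_right _ _, fun z hz =>
      (le_abs_self _).trans ((hB z (by simpa using hz)).trans (le_max_left _ _))⟩
  refine ENNReal.eq_top_of_forall_nnreal_le fun M => ?_
  obtain ⟨ρ, hρ0, hρ1, g, hg, hg0, hgs, hgi⟩ := hgrow (4 * M + B)
  obtain ⟨t₀, ht₀, htK⟩ := hγK (closedBall 0 ρ) (isCompact_closedBall _ _)
    (closedBall_subset_ball hρ1)
  have hρt : ρ < ‖γ t₀‖ := by simpa using htK t₀ ⟨le_rfl, ht₀.2⟩
  obtain ⟨φ, hφ⟩ : ∃ φ : ℂ → ℝ, φ = fun z => ∫ t in (0 : ℝ)..min ‖z‖ ρ, g t := ⟨_, rfl⟩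
  have hφ0 : φ (γ 0) ≤ B := by
    have hm0 : 0 ≤ min ‖γ 0‖ ρ := le_min (norm_nonneg _) hρ0
    have e1 := intervalIntegral.norm_integral_le_of_norm_le_const (a := 0) (b := min ‖γ 0‖ ρ)
      (f := g) (C := B) fun t ht => by
        rw [uIoc_of_le hm0] at ht
        have e2 : ‖(t : ℂ)‖ = t := by
          rw [Complex.norm_real, Real.norm_of_nonneg ht.1.le]
        have e3 := hgs t (by rw [e2]; exact ht.2.trans (min_le_right _ _))
        rw [e2] at e3
        rw [Real.norm_of_nonneg (hg0 t)]
        exact e3.trans (hB t (by rw [e2]; exact ht.2.trans (min_le_left _ _)))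
    rw [hφ]
    refine (le_abs_self _).trans (e1.trans ?_)
    rw [sub_zero, abs_of_nonneg hm0]
    exact mul_le_of_le_one_right hB0 ((min_le_right _ _).trans hρ1.le)
  have hφ1 : 4 * M + B ≤ φ (γ t₀) := by
    rw [hφ]
    dsimp only
    rwa [min_eq_right hρt.le]
  have hU : ∀ z : ball (0 : ℂ) 1, ∃ U, IsOpen U ∧ (z : ℂ) ∈ U ∧ ∀ a ∈ U, ∀ b ∈ U,
      |φ a - φ b| ≤ 4 * ‖X a - X b‖ := fun z => by
    rw [hφ]
    exact exists_local_metric_bound h hg hg0 hgs z.2 (hs z z.2)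
  choose U hUo hzU hU using hU
  have hsub : Icc 0 t₀ ⊆ Ico (0 : ℝ) 1 := Icc_subset_Ico_right ht₀.2
  have hγc : Continuous fun t : Icc 0 t₀ => γ t := (hγ.mono hsub).domRestrict
  obtain ⟨u, hu0, humono, ⟨m, hm⟩, hucov⟩ := exists_monotone_Icc_subset_open_cover_Icc ht₀.1
    (c := fun z => (fun t : Icc 0 t₀ => γ t) ⁻¹' U z) (fun z => (hUo z).preimage hγc)
    (fun t _ => mem_iUnion.2 ⟨⟨γ t, hγD (hsub t.2)⟩, hzU _⟩)
  have hstep : ∀ n, |φ (γ (u (n + 1))) - φ (γ (u n))| ≤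
      4 * ‖X (γ (u (n + 1))) - X (γ (u n))‖ := fun n => by
    obtain ⟨z, hz⟩ := hucov n
    exact hU z _ (hz (right_mem_Icc.2 (humono (Nat.le_succ n)))) _
      (hz (left_mem_Icc.2 (humono (Nat.le_succ n))))
  have hsum : (M : ℝ) ≤ ∑ n ∈ Finset.range m, ‖X (γ (u (n + 1))) - X (γ (u n))‖ := by
    have e1 := Finset.sum_range_sub (fun n => φ (γ (u n))) m
    rw [hu0, hm m le_rfl] at e1
    have e2 : ∑ n ∈ Finset.range m, (φ (γ (u (n + 1))) - φ (γ (u n))) ≤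
        ∑ n ∈ Finset.range m, 4 * ‖X (γ (u (n + 1))) - X (γ (u n))‖ :=
      Finset.sum_le_sum fun n _ => (le_abs_self _).trans (hstep n)
    rw [← Finset.mul_sum] at e2
    linarith
  have hvar := eVariationOn.sum_le (f := X ∘ γ) (s := Ico 0 1) (n := m) (u := fun n => (u n : ℝ))
    (fun a b hab => humono hab) (fun n => hsub (u n).2)
  refine le_trans ?_ hvar
  have e3 : ∑ n ∈ Finset.range m, edist ((X ∘ γ) (u (n + 1))) ((X ∘ γ) (u n)) =
      ENNReal.ofReal (∑ n ∈ Finset.range m, ‖X (γ (u (n + 1))) - X (γ (u n))‖) := by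
    rw [ENNReal.ofReal_sum_of_nonneg fun _ _ => norm_nonneg _]
    refine Finset.sum_congr rfl fun n _ => ?_
    rw [edist_dist, dist_eq_norm]
    rfl
  rw [e3, ← ENNReal.ofReal_coe_nnreal]
  exact ENNReal.ofReal_le_ofReal hsum

/-- A translate of a smooth space curve avoids a given half-line. -/
lemma exists_translate_add_pos {w : ℝ → R3} (hw : ContDiff ℝ 1 w) {η : ℝ} (hη : 0 < η) :
    ∃ c : R3, ‖c‖ ≤ η ∧ ∀ t, 0 < ‖w t + c‖ + (w t + c) 0 := by
  have hd : Dense (range fun p : ℝ × ℝ => -w p.1 - p.2 ^ 2 • EuclideanSpace.single (0 : Fin 3) (1 : ℝ))ᶜ := by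
    refine ContDiff.dense_compl_range_of_finrank_lt_finrank ?_ (by simp)
    fun_prop
  obtain ⟨c, hc, hcη⟩ := Metric.mem_closure_iff.1 (hd.closure_eq ▸ mem_univ (0 : R3)) η hη
  rw [dist_zero_left] at hcη
  refine ⟨c, hcη.le, fun t => ?_⟩
  obtain ⟨v, hv⟩ : ∃ v, v = w t + c := ⟨_, rfl⟩
  rw [← hv]
  have h1 : -‖v‖ ≤ v 0 := (abs_le.1 (abs_apply_le_norm v 0)).1
  refine lt_of_le_of_ne (by linarith) fun h0 => hc ⟨(t, √‖v‖), ?_⟩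
  have h2 : ‖v‖ ^ 2 = v 0 ^ 2 + v 1 ^ 2 + v 2 ^ 2 := by
    rw [EuclideanSpace.norm_sq_eq, Fin.sum_univ_three]
    simp
  have h3 : v 0 = -‖v‖ := by linarith
  rw [h3] at h2
  have h4 : v 1 = 0 := by nlinarith [sq_nonneg (v 1), sq_nonneg (v 2)]
  have h5 : v 2 = 0 := by nlinarith [sq_nonneg (v 1), sq_nonneg (v 2)]
  have h6 : c = v - w t := by rw [hv]; abel
  have h7 : v = -(‖v‖ • EuclideanSpace.single (0 : Fin 3) (1 : ℝ)) := by
    ext i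
    fin_cases i
    · simpa using h3
    · simpa using h4
    · simpa using h5
  dsimp only
  rw [Real.sq_sqrt (norm_nonneg _), h6]
  nth_rw 2 [h7]
  abel

/-- The spinor of a vector off the negative first axis. -/
def spinLift (v : R3) : ℂ × ℂ :=
  let u := √((‖v‖ + v 0) / 2)
  ((u : ℂ) + ((-v 1 / (2 * u) : ℝ) : ℂ) * Complex.I, ((v 2 / (2 * u) : ℝ) : ℂ))

lemma reMap_nullVec_spinLift {v : R3} (hv : 0 < ‖v‖ + v 0) :
    reMap (nullVec (spinLift v)) 1 = v := by
  obtain ⟨u, hu⟩ : ∃ u, u = √((‖v‖ + v 0) / 2) := ⟨_, rfl⟩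
  have hu0 : 0 < u := hu ▸ Real.sqrt_pos.2 (by positivity)
  have hu2 : u ^ 2 = (‖v‖ + v 0) / 2 := by rw [hu, Real.sq_sqrt (by positivity)]
  have h2 : ‖v‖ ^ 2 = v 0 ^ 2 + v 1 ^ 2 + v 2 ^ 2 := by
    rw [EuclideanSpace.norm_sq_eq, Fin.sum_univ_three]
    simp
  have hn : ‖v‖ = 2 * u ^ 2 - v 0 := by linarith
  have key : v 1 ^ 2 + v 2 ^ 2 = 4 * u ^ 2 * (u ^ 2 - v 0) := by
    rw [hn] at h2
    linarith
  obtain ⟨a, ha⟩ : ∃ a, a = -v 1 / (2 * u) := ⟨_, rfl⟩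
  obtain ⟨b, hb⟩ : ∃ b, b = v 2 / (2 * u) := ⟨_, rfl⟩
  have hl : spinLift v = ((u : ℂ) + (a : ℂ) * Complex.I, (b : ℂ)) := by
    rw [ha, hb, hu]; rfl
  have h1 : v 1 = -(2 * u * a) := by rw [ha]; field_simp
  have h2 : v 2 = 2 * u * b := by rw [hb]; field_simp
  ext i
  rw [reMap_apply, mul_one, hl]
  fin_cases i
  · rw [h1, h2] at key
    have h3 : u ^ 2 * (a ^ 2 + b ^ 2) = u ^ 2 * (u ^ 2 - v 0) := by linarith
    have h4 := mul_left_cancel₀ (by positivity) h3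
    simp [nullVec, pow_two]
    linarith
  · simp [nullVec, pow_two, h1]
    ring
  · simp [nullVec, h2]

/-- Every smooth velocity field along a segment is approximated by the real part of an entire
null field. -/
lemma exists_entire_spinor {w : ℝ → R3} (hw : ContDiff ℝ 1 w) {η : ℝ} (hη : 0 < η) :
    ∃ σ : ℂ → ℂ × ℂ, Differentiable ℂ σ ∧ ∀ t ∈ Icc (0 : ℝ) 1,
      ‖reMap (nullVec (σ t)) 1 - w t‖ ≤ η := by
  obtain ⟨c, hc, hpos⟩ := exists_translate_add_pos hw (half_pos hη)
  obtain ⟨y, hy⟩ : ∃ y, y = fun t => w t + c := ⟨_, rfl⟩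
  have hyc : Continuous y := hy ▸ hw.continuous.add continuous_const
  have hyp : ∀ t, 0 < ‖y t‖ + y t 0 := fun t => by rw [hy]; exact hpos t
  obtain ⟨u, hu⟩ : ∃ u : ℝ → ℝ, u = fun t => √((‖y t‖ + y t 0) / 2) := ⟨_, rfl⟩
  have hyi : ∀ i, Continuous fun t => y t i := fun i => by fun_prop
  have huc : Continuous u := by
    rw [hu]
    exact (((hyc.norm).add (hyi 0)).div_const 2).sqrt
  have hu0 : ∀ t, 2 * u t ≠ 0 := fun t => by
    have := Real.sqrt_pos.2 (half_pos (hyp t))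
    rw [hu]
    positivity
  have hac : Continuous fun t => -y t 1 / (2 * u t) :=
    (hyi 1).neg.div (continuous_const.mul huc) hu0
  have hbc : Continuous fun t => y t 2 / (2 * u t) :=
    (hyi 2).div (continuous_const.mul huc) hu0
  obtain ⟨l, hl⟩ : ∃ l, l = fun t => spinLift (y t) := ⟨_, rfl⟩
  have hl1 : ∀ t, l t = ((u t : ℂ) + ((-y t 1 / (2 * u t) : ℝ) : ℂ) * Complex.I,
      ((y t 2 / (2 * u t) : ℝ) : ℂ)) := fun t => by rw [hl, hu]; rfl
  have hlc : Continuous l := by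
    rw [funext hl1]
    exact ((Complex.continuous_ofReal.comp huc).add
      ((Complex.continuous_ofReal.comp hac).mul continuous_const)).prodMk
      (Complex.continuous_ofReal.comp hbc)
  obtain ⟨M, hM⟩ := (isCompact_Icc (a := (0 : ℝ)) (b := 1)).exists_bound_of_continuousOn
    hlc.continuousOn
  have hM0 : 0 ≤ M := (norm_nonneg _).trans (hM 0 (by simp))
  obtain ⟨e, he0, he1, he2⟩ : ∃ e, 0 < e ∧ e ≤ 1 / 2 ∧ 8 * e * (2 * M + 1) ≤ η / 2 := by
    refine ⟨min (1 / 2) (η / (16 * (2 * M + 1))), by positivity, min_le_left _ _, ?_⟩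
    have := min_le_right (1 / 2) (η / (16 * (2 * M + 1)))
    rw [le_div_iff₀ (by positivity)] at this
    linarith
  obtain ⟨p, hp⟩ := exists_polynomial_near_of_continuousOn 0 1 _ huc.continuousOn e he0
  obtain ⟨q, hq⟩ := exists_polynomial_near_of_continuousOn 0 1 _ hac.continuousOn e he0
  obtain ⟨b, hb⟩ := exists_polynomial_near_of_continuousOn 0 1 _ hbc.continuousOn e he0
  have hev : ∀ (f : Polynomial ℝ) (t : ℝ), Polynomial.aeval (t : ℂ) f = ((f.eval t : ℝ) : ℂ) :=
    fun f t => by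
      rw [← Complex.coe_algebraMap, Polynomial.aeval_algebraMap_apply, Polynomial.aeval_def]
      simp
  refine ⟨fun z => (Polynomial.aeval z p + Polynomial.aeval z q * Complex.I,
    Polynomial.aeval z b), ?_, fun t ht => ?_⟩
  · exact ((Polynomial.differentiable_aeval p).add
      ((Polynomial.differentiable_aeval q).mul_const _)).prodMk (Polynomial.differentiable_aeval b)
  obtain ⟨s, hs⟩ : ∃ s : ℂ × ℂ, s = (Polynomial.aeval (t : ℂ) p +
    Polynomial.aeval (t : ℂ) q * Complex.I, Polynomial.aeval (t : ℂ) b) := ⟨_, rfl⟩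
  dsimp only
  rw [← hs]
  have hsl : ‖s - l t‖ ≤ 2 * e := by
    rw [hs, hl1, Prod.mk_sub_mk, Prod.norm_mk, hev, hev, hev]
    refine max_le ?_ ?_
    · have e1 : ((p.eval t : ℝ) : ℂ) + ((q.eval t : ℝ) : ℂ) * Complex.I -
          ((u t : ℂ) + ((-y t 1 / (2 * u t) : ℝ) : ℂ) * Complex.I) =
          ((p.eval t - u t : ℝ) : ℂ) + ((q.eval t - -y t 1 / (2 * u t) : ℝ) : ℂ) * Complex.I := by
        push_cast
        ring
      rw [e1]
      refine (norm_add_le _ _).trans ?_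
      rw [norm_mul, Complex.norm_I, mul_one, Complex.norm_real, Complex.norm_real]
      have e2 := (hp t ht).le
      have e3 := (hq t ht).le
      rw [Real.norm_eq_abs, Real.norm_eq_abs]
      linarith
    · rw [← Complex.ofReal_sub, Complex.norm_real, Real.norm_eq_abs]
      have e3 := (hb t ht).le
      linarith
  have hll : reMap (nullVec (l t)) 1 = w t + c := by
    have e1 := reMap_nullVec_spinLift (hyp t)
    rw [hl]
    rw [e1, hy]
  have e1 : ‖nullVec s - nullVec (l t)‖ ≤ 2 * (2 * e) * (2 * M + 1) := by
    refine (norm_nullVec_sub_le _ _).trans ?_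
    have e2 := hM t ht
    have e3 : ‖s‖ ≤ ‖s - l t‖ + ‖l t‖ := by simpa using norm_add_le (s - l t) (l t)
    exact mul_le_mul (by linarith) (by linarith) (by positivity) (by positivity)
  have e2 := norm_reMap_apply_le (nullVec s - nullVec (l t)) 1
  rw [reMap_sub, sub_apply, hll, norm_one, mul_one] at e2
  have e3 : reMap (nullVec s) 1 - w t = (reMap (nullVec s) 1 - (w t + c)) + c := by abel
  rw [e3]
  refine (norm_add_le _ _).trans ?_
  linarith

/-- A conformal map of a neighbourhood of the closed disc onto a thin neighbourhood of the unit
segment, whose derivative is a square. -/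
lemma exists_thin_disc {κ : ℝ} (hκ : 0 < κ) :
    ∃ R > 1, ∃ f h : ℂ → ℂ, DifferentiableOn ℂ h (ball 0 R) ∧
      (∀ z ∈ ball (0 : ℂ) R, HasDerivAt f (h z ^ 2) z) ∧ (∃ M, ∀ z ∈ ball (0 : ℂ) R, ‖f z‖ ≤ M) ∧
      (∀ z, ‖z‖ ≤ 1 → (f z).re ∈ Icc (0 : ℝ) 1 ∧ |(f z).im| ≤ κ * Real.pi) ∧
      ∀ t ∈ Icc (0 : ℝ) 1, ∃ ζ, ‖ζ‖ = 1 ∧ (f ζ).re = t := by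
  obtain ⟨e, he⟩ : ∃ e, e = Real.exp (1 / (2 * κ)) := ⟨_, rfl⟩
  have he1 : 1 < e := he ▸ Real.one_lt_exp_iff.2 (by positivity)
  have hel : κ * Real.log e = 1 / 2 := by
    rw [he, Real.log_exp]
    field_simp
  obtain ⟨r, hr⟩ : ∃ r, r = (e - 1) / (e + 1) := ⟨_, rfl⟩
  have hr0 : 0 < r := hr ▸ div_pos (by linarith) (by linarith)
  have hr1 : r < 1 := by
    rw [hr, div_lt_one (by linarith)]
    linarith
  have hre : (1 + r) / (1 - r) = e := by
    have : 1 - r ≠ 0 := by linarith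
    rw [div_eq_iff this, hr]
    field_simp
    ring
  have hlog : κ * (Real.log (1 + r) - Real.log (1 - r)) = 1 / 2 := by
    rw [← Real.log_div (by linarith) (by linarith), hre, hel]
  have hR : 1 < 1 / r := (one_lt_div hr0).2 hr1
  have hsub : closedBall (0 : ℂ) ((1 + 1 / r) / 2) ⊆ ball 0 (1 / r) :=
    closedBall_subset_ball (by linarith)
  have hrz : ∀ z ∈ ball (0 : ℂ) (1 / r), ‖(r : ℂ) * z‖ < 1 := fun z hz => by
    rw [mem_ball_zero_iff, lt_div_iff₀ hr0] at hz
    rw [norm_mul, Complex.norm_real, Real.norm_of_nonneg hr0.le]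
    linarith
  have hre1 : ∀ z ∈ ball (0 : ℂ) (1 / r), 0 < (1 + (r : ℂ) * z).re ∧ 0 < (1 - (r : ℂ) * z).re :=
    fun z hz => by
      have := abs_lt.1 ((Complex.abs_re_le_norm _).trans_lt (hrz z hz))
      rw [Complex.add_re, Complex.sub_re, Complex.one_re]
      exact ⟨by linarith, by linarith⟩
  have hd1 : ∀ z ∈ ball (0 : ℂ) (1 / r),
      HasDerivAt (fun z => Complex.log (1 + (r : ℂ) * z)) (r / (1 + r * z)) z := fun z hz => by
    have e1 : HasDerivAt (fun z => 1 + (r : ℂ) * z) r z := by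
      simpa using ((hasDerivAt_id z).const_mul (r : ℂ)).const_add 1
    exact e1.clog (Or.inl (hre1 z hz).1)
  have hd2 : ∀ z ∈ ball (0 : ℂ) (1 / r),
      HasDerivAt (fun z => Complex.log (1 - (r : ℂ) * z)) (-r / (1 - r * z)) z := fun z hz => by
    have e1 : HasDerivAt (fun z => 1 - (r : ℂ) * z) (-r) z := by
      simpa using ((hasDerivAt_id z).const_mul (r : ℂ)).const_sub 1
    exact e1.clog (Or.inl (hre1 z hz).2)
  obtain ⟨f, hf⟩ : ∃ f : ℂ → ℂ, f = fun z => 1 / 2 +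
    (κ : ℂ) * (Complex.log (1 + (r : ℂ) * z) - Complex.log (1 - (r : ℂ) * z)) := ⟨_, rfl⟩
  obtain ⟨h, hh⟩ : ∃ h : ℂ → ℂ, h = fun z => ((√(2 * κ * r) : ℝ) : ℂ) *
    Complex.exp (-(Complex.log (1 + (r : ℂ) * z) + Complex.log (1 - (r : ℂ) * z)) / 2) := ⟨_, rfl⟩
  have hhd : DifferentiableOn ℂ h (ball 0 (1 / r)) := fun z hz => by
    rw [hh]
    exact (((((hd1 z hz).differentiableAt.add (hd2 z hz).differentiableAt).neg.div_const
      2).cexp).const_mul _).differentiableWithinAt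
  have hfd : ∀ z ∈ ball (0 : ℂ) (1 / r), HasDerivAt f (h z ^ 2) z := fun z hz => by
    have e1 := (((hd1 z hz).sub (hd2 z hz)).const_mul (κ : ℂ)).const_add (1 / 2)
    refine HasDerivAt.congr_deriv (hf ▸ e1) ?_
    have n1 : 1 + (r : ℂ) * z ≠ 0 := fun h0 => by
      have := (hre1 z hz).1
      rw [h0] at this
      simp at this
    have n2 : 1 - (r : ℂ) * z ≠ 0 := fun h0 => by
      have := (hre1 z hz).2
      rw [h0] at this
      simp at this
    rw [hh]
    dsimp only
    rw [mul_pow, ← Complex.ofReal_pow, Real.sq_sqrt (by positivity), ← Complex.exp_nat_mul]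
    have e2 : ((2 : ℕ) : ℂ) *
        (-(Complex.log (1 + (r : ℂ) * z) + Complex.log (1 - (r : ℂ) * z)) / 2) =
        -(Complex.log (1 + (r : ℂ) * z) + Complex.log (1 - (r : ℂ) * z)) := by
      push_cast
      ring
    rw [e2, Complex.exp_neg, Complex.exp_add, Complex.exp_log n1, Complex.exp_log n2]
    push_cast
    field_simp
    ring
  have hfc : ContinuousOn f (ball 0 (1 / r)) := fun z hz =>
    (hfd z hz).continuousAt.continuousWithinAt
  have hfre : ∀ z, (f z).re = 1 / 2 + κ * (Real.log ‖1 + (r : ℂ) * z‖ -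
      Real.log ‖1 - (r : ℂ) * z‖) := fun z => by
    rw [hf]
    simp [Complex.log_re]
  have hbnd : ∀ z : ℂ, ‖z‖ ≤ 1 → z ∈ ball (0 : ℂ) (1 / r) := fun z hz =>
    mem_ball_zero_iff.2 (hz.trans_lt hR)
  have hnb : ∀ z : ℂ, ‖z‖ ≤ 1 → Real.log (1 - r) ≤ Real.log ‖1 + (r : ℂ) * z‖ ∧
      Real.log ‖1 + (r : ℂ) * z‖ ≤ Real.log (1 + r) := fun z hz => by
    have e1 : ‖(r : ℂ) * z‖ ≤ r := by
      rw [norm_mul, Complex.norm_real, Real.norm_of_nonneg hr0.le]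
      exact mul_le_of_le_one_right hr0.le hz
    have e2 : 1 - r ≤ ‖1 + (r : ℂ) * z‖ := by
      have := norm_sub_le_norm_add (1 : ℂ) ((r : ℂ) * z)
      rw [norm_one] at this
      linarith
    have e3 : ‖1 + (r : ℂ) * z‖ ≤ 1 + r := by
      have := norm_add_le (1 : ℂ) ((r : ℂ) * z)
      rw [norm_one] at this
      linarith
    exact ⟨Real.log_le_log (by linarith) e2, Real.log_le_log (by linarith) e3⟩
  have hnb2 : ∀ z : ℂ, ‖z‖ ≤ 1 → Real.log (1 - r) ≤ Real.log ‖1 - (r : ℂ) * z‖ ∧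
      Real.log ‖1 - (r : ℂ) * z‖ ≤ Real.log (1 + r) := fun z hz => by
    simpa [sub_eq_add_neg] using hnb (-z) (by rwa [norm_neg])
  refine ⟨(1 + 1 / r) / 2, by linarith, f, h, hhd.mono (ball_subset_closedBall.trans hsub),
    fun z hz => hfd z (hsub (ball_subset_closedBall hz)), ?_, fun z hz => ⟨?_, ?_⟩, fun t ht => ?_⟩
  · obtain ⟨M, hM⟩ := (isCompact_closedBall (0 : ℂ) _).exists_bound_of_continuousOn (hfc.mono hsub)
    exact ⟨M, fun z hz => hM z (ball_subset_closedBall hz)⟩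
  · rw [hfre]
    have e1 := mul_le_mul_of_nonneg_left (sub_le_sub (hnb z hz).2 (hnb2 z hz).1) hκ.le
    have e2 := mul_le_mul_of_nonneg_left (sub_le_sub (hnb z hz).1 (hnb2 z hz).2) hκ.le
    constructor <;> linarith
  · have e1 := Complex.abs_arg_le_pi_div_two_iff.2 (hre1 z (hbnd z hz)).1.le
    have e2 := Complex.abs_arg_le_pi_div_two_iff.2 (hre1 z (hbnd z hz)).2.le
    have e3 : (f z).im = κ * (Complex.arg (1 + (r : ℂ) * z) - Complex.arg (1 - (r : ℂ) * z)) := by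
      rw [hf]
      simp [Complex.log_im]
    rw [e3, abs_mul, abs_of_pos hκ]
    refine mul_le_mul_of_nonneg_left ((abs_sub _ _).trans ?_) hκ.le
    linarith
  · have e1 : (f 1).re = 1 := by
      rw [hfre, mul_one, ← Complex.ofReal_one, ← Complex.ofReal_add, ← Complex.ofReal_sub,
        Complex.norm_real, Complex.norm_real, Real.norm_of_nonneg (by linarith),
        Real.norm_of_nonneg (by linarith)]
      linarith
    have e2 : (f (-1)).re = 0 := by
      rw [hfre, mul_neg, mul_one, sub_neg_eq_add, ← sub_eq_add_neg, ← Complex.ofReal_one,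
        ← Complex.ofReal_add, ← Complex.ofReal_sub,
        Complex.norm_real, Complex.norm_real, Real.norm_of_nonneg (by linarith),
        Real.norm_of_nonneg (by linarith)]
      linarith
    have hc : ContinuousOn (fun z => (f z).re) (sphere 0 1) :=
      Complex.continuous_re.comp_continuousOn (hfc.mono fun z hz =>
        hbnd z (by simpa using (mem_sphere_zero_iff_norm.1 hz).le))
    have hs : IsPreconnected (sphere (0 : ℂ) 1) :=
      isPreconnected_sphere (by rw [Complex.rank_real_complex]; norm_num) 0 1
    obtain ⟨ζ, hζ, hζt⟩ := hs.intermediate_value (a := -1) (b := 1) (by simp) (by simp) hc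
      (by rw [e1, e2]; exact ht)
    exact ⟨ζ, by simpa using hζ, hζt⟩

lemma Spin.comp {R R' : ℝ} {σ : ℂ → ℂ × ℂ} {Y : ℂ → R3} (hY : Spin R' σ Y) {f h : ℂ → ℂ}
    (hh : DifferentiableOn ℂ h (ball 0 R)) (hf : ∀ z ∈ ball (0 : ℂ) R, HasDerivAt f (h z ^ 2) z)
    (hfR : MapsTo f (ball 0 R) (ball 0 R')) : Spin R (fun z => h z • σ (f z)) (Y ∘ f) := by
  refine ⟨hh.smul (hY.1.comp (fun z hz => (hf z hz).differentiableAt.differentiableWithinAt) hfR),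
    fun z hz => ?_⟩
  have e1 := (hY.2 (f z) (hfR hz)).comp z ((hf z hz).hasFDerivAt.restrictScalars ℝ)
  refine e1.congr_fderiv (ContinuousLinearMap.ext fun v => ?_)
  rw [nullVec_smul, reMap_smul_apply]
  simp [mul_comm]

/-- Every smooth arc is approximated by thin minimal discs. -/
lemma exists_thin_minimal_disc {Γ : ℝ → R3} (hΓ : ContDiff ℝ 2 Γ) {η : ℝ} (hη : 0 < η) :
    ∃ R > 1, ∃ s X, Spin R s X ∧ (∀ z, ‖z‖ ≤ 1 → s z ≠ 0) ∧
      (∀ z, ‖z‖ ≤ 1 → ∃ t ∈ Icc (0 : ℝ) 1, ‖X z - Γ t‖ ≤ η) ∧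
      ∀ t ∈ Icc (0 : ℝ) 1, ∃ ζ, ‖ζ‖ = 1 ∧ ‖X ζ - Γ t‖ ≤ η := by
  have hΓ' : ContDiff ℝ 1 (deriv Γ) := by
    have h : ContDiff ℝ (1 + 1) Γ := hΓ.of_le (by rw [one_add_one_eq_two])
    exact (contDiff_succ_iff_deriv.1 h).2.2
  obtain ⟨σ, hσ, hσΓ⟩ := exists_entire_spinor hΓ' (show 0 < η / 4 by positivity)
  obtain ⟨B, hB⟩ := (isCompact_closedBall (0 : ℂ) 2).exists_bound_of_continuousOn
    (continuous_nullVec.comp hσ.continuous).continuousOn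
  have hB0 : 0 ≤ B := (norm_nonneg _).trans (hB 0 (by simp))
  obtain ⟨κ, hκ0, hκ1, hκ2⟩ : ∃ κ, 0 < κ ∧ κ * Real.pi ≤ 1 ∧ 2 * B * (κ * Real.pi) ≤ η / 4 := by
    have hpi := Real.pi_pos
    refine ⟨min 1 (η / (8 * (B + 1))) / Real.pi, by positivity, ?_, ?_⟩
    · rw [div_mul_cancel₀ _ hpi.ne']
      exact min_le_left _ _
    · rw [div_mul_cancel₀ _ hpi.ne']
      have h1 := min_le_right 1 (η / (8 * (B + 1)))
      have h2 : 0 ≤ min 1 (η / (8 * (B + 1))) := by positivity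
      rw [le_div_iff₀ (by positivity)] at h1
      linarith
  obtain ⟨R, hR, f, h, hh, hf, ⟨M, hM⟩, hfI, hfs⟩ := exists_thin_disc hκ0
  obtain ⟨Y, hY, hY0⟩ := exists_spin (R := max M 2 + 1) hσ.differentiableOn (Γ 0)
  have hsub : closedBall (0 : ℂ) 2 ⊆ ball 0 (max M 2 + 1) :=
    closedBall_subset_ball (by linarith [le_max_right M 2])
  have hreal : ∀ t ∈ Icc (0 : ℝ) 1, (t : ℂ) ∈ closedBall (0 : ℂ) 2 := fun t ht => by
    rw [mem_closedBall_zero_iff, Complex.norm_real, Real.norm_of_nonneg ht.1]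
    linarith [ht.2]
  have hYΓ : ∀ t ∈ Icc (0 : ℝ) 1, ‖Y t - Γ t‖ ≤ η / 4 := fun t ht => by
    have e1 : ∀ x ∈ Icc (0 : ℝ) 1, HasDerivWithinAt (fun t : ℝ => Y t - Γ t)
        (reMap (nullVec (σ x)) 1 - deriv Γ x) (Icc 0 1) x := fun x hx => by
      have e2 := (hY.2 x (hsub (hreal x hx))).comp_hasDerivAt x
        (Complex.ofRealCLM.hasDerivAt (x := x))
      simp only [Complex.ofRealCLM_apply, Complex.ofReal_one] at e2
      exact (e2.sub (hΓ.differentiable (by norm_num) x).hasDerivAt).hasDerivWithinAt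
    have e2 := norm_image_sub_le_of_norm_deriv_le_segment' e1
      (fun x hx => hσΓ x (Ico_subset_Icc_self hx)) t ht
    have e3 : Y ((0 : ℝ) : ℂ) = Γ 0 := by rw [Complex.ofReal_zero, hY0]
    rw [e3, sub_self, sub_zero, sub_zero] at e2
    exact e2.trans (mul_le_of_le_one_right (by positivity) ht.2)
  have hYf : ∀ z, ‖z‖ ≤ 1 → ‖Y (f z) - Y ((f z).re : ℂ)‖ ≤ η / 4 := fun z hz => by
    obtain ⟨e1, e2⟩ := hfI z hz
    have e3 : f z ∈ closedBall (0 : ℂ) 2 := by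
      rw [mem_closedBall_zero_iff]
      refine (Complex.norm_le_abs_re_add_abs_im _).trans ?_
      rw [abs_of_nonneg e1.1]
      linarith [e1.2]
    have e4 := (convex_closedBall (0 : ℂ) 2).norm_image_sub_le_of_norm_hasFDerivWithin_le
      (𝕜 := ℝ) (fun x hx => (hY.2 x (hsub hx)).hasFDerivWithinAt)
      (C := 2 * B) (fun x hx => (norm_reMap_le _).trans (by have := hB x hx; simpa using this))
      (hreal _ e1) e3
    have e5 : f z - ((f z).re : ℂ) = ((f z).im : ℂ) * Complex.I :=
      Complex.ext (by simp) (by simp)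
    rw [e5, norm_mul, Complex.norm_I, mul_one, Complex.norm_real, Real.norm_eq_abs] at e4
    exact e4.trans ((mul_le_mul_of_nonneg_left e2 (by positivity)).trans hκ2)
  have hX := hY.comp hh hf fun z hz => by
    rw [mem_ball_zero_iff]
    exact (hM z hz).trans_lt (by linarith [le_max_left M 2])
  obtain ⟨s', X', hX', hn, -⟩ := exists_nonvanishing hR hX (show 0 < η / 4 by positivity)
  have key : ∀ z, ‖z‖ ≤ 1 → ‖X' z - Γ (f z).re‖ ≤ η := fun z hz => by
    have e1 := (hn z hz).2.2.1
    have e2 := hYf z hz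
    have e3 := hYΓ _ (hfI z hz).1
    have e4 : X' z - Γ (f z).re = (X' z - (Y ∘ f) z) + (Y (f z) - Y ((f z).re : ℂ)) +
        (Y ((f z).re : ℂ) - Γ (f z).re) := by
      rw [comp_apply]
      abel
    rw [e4]
    refine (norm_add₃_le).trans ?_
    linarith
  refine ⟨R, hR, s', X', hX', fun z hz => (hn z hz).2.2.2, fun z hz => ⟨_, (hfI z hz).1, key z hz⟩,
    fun t ht => ?_⟩
  obtain ⟨ζ, hζ, hζt⟩ := hfs t ht
  exact ⟨ζ, hζ, hζt ▸ key ζ hζ.le⟩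

lemma properIn_of_infDist {C : Set R3} {Y : ℂ → R3} (hC : IsOpen C) (hn : Cᶜ.Nonempty)
    (hY : ContinuousOn Y (ball 0 1))
    (hb : ∀ ε > 0, ∃ ρ < 1, ∀ z, ρ ≤ ‖z‖ → ‖z‖ < 1 → infDist (Y z) Cᶜ ≤ ε) :
    ProperIn Y (ball 0 1) C := by
  intro K hK hKC
  rcases K.eq_empty_or_nonempty with rfl | hKn
  · simp
  obtain ⟨x, hxK, hx⟩ := hK.exists_isMinOn hKn (continuous_infDist_pt Cᶜ).continuousOn
  have hm := infDist_compl_pos hC hn (hKC hxK)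
  obtain ⟨ρ, hρ, hρY⟩ := hb _ (half_pos hm)
  have hsub : closedBall (0 : ℂ) ρ ⊆ ball 0 1 := closedBall_subset_ball hρ
  have : ball (0 : ℂ) 1 ∩ Y ⁻¹' K = closedBall 0 ρ ∩ Y ⁻¹' K := by
    ext z
    refine ⟨fun hz => ⟨?_, hz.2⟩, fun hz => ⟨hsub hz.1, hz.2⟩⟩
    rw [mem_closedBall_zero_iff]
    by_contra! h
    have e1 := hρY z h.le (mem_ball_zero_iff.1 hz.1)
    have e2 : infDist x Cᶜ ≤ infDist (Y z) Cᶜ := hx hz.2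
    linarith
  rw [this]
  exact (isCompact_closedBall (0 : ℂ) ρ).of_isClosed_subset
    ((hY.mono hsub).preimage_isClosed_of_isClosed isClosed_closedBall hK.isClosed)
    inter_subset_left

lemma limitSet_eq_of_properIn {C : Set R3} {Y : ℂ → R3} (hC : IsOpen C)
    (hY : ContinuousOn Y (ball 0 1)) (hm : MapsTo Y (ball 0 1) C)
    (hp : ProperIn Y (ball 0 1) C) : limitSet Y = closure (Y '' ball 0 1) ∩ Cᶜ := by
  refine Subset.antisymm (fun p hp' => ⟨hp'.1, fun hpC => hp'.2 ?_⟩)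
    fun p hp' => ⟨hp'.1, fun h => hp'.2 (hm.image_subset h)⟩
  obtain ⟨m, hm0, hmC⟩ := Metric.nhds_basis_closedBall.mem_iff.1 (hC.mem_nhds hpC)
  have hK := hp _ (isCompact_closedBall p m) hmC
  have hK' := (hK.image_of_continuousOn (hY.mono inter_subset_left)).isClosed
  have h1 : p ∈ closure (Y '' ball 0 1 ∩ closedBall p m) := by
    rw [Metric.mem_closure_iff]
    intro e he
    obtain ⟨y, hy, hye⟩ := Metric.mem_closure_iff.1 hp'.1 (min e m) (lt_min he hm0)
    refine ⟨y, ⟨hy, ?_⟩, hye.trans_le (min_le_left _ _)⟩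
    rw [mem_closedBall, dist_comm]
    exact (hye.trans_le (min_le_right _ _)).le
  have h2 : Y '' ball 0 1 ∩ closedBall p m ⊆ Y '' (ball 0 1 ∩ Y ⁻¹' closedBall p m) := by
    rintro _ ⟨⟨z, hz, rfl⟩, hzm⟩
    exact ⟨z, ⟨hz, hzm⟩, rfl⟩
  exact image_mono inter_subset_left (closure_minimal h2 hK' h1)

/-- Points over the boundary circle close to `X ζ` in the limit set. -/
lemma exists_mem_limitSet {C : Set R3} {Y : ℂ → R3} (hC : IsOpen C) (hn : Cᶜ.Nonempty)
    (hCb : Bornology.IsBounded C) (hm : MapsTo Y (ball 0 1) C)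
    (hb : ∀ ε > 0, ∃ ρ < 1, ∀ z, ρ ≤ ‖z‖ → ‖z‖ < 1 → infDist (Y z) Cᶜ ≤ ε)
    {ζ : ℂ} (hζ : ‖ζ‖ = 1) {x : R3} {A ρ : ℝ} (hρ : ρ < 1)
    (hA : ∀ t : ℝ, ρ ≤ t → t < 1 → ‖Y (t * ζ) - x‖ ≤ A) :
    ∃ p ∈ closure (Y '' ball 0 1) ∩ Cᶜ, ‖p - x‖ ≤ A := by
  obtain ⟨t, ht0, ht1, htt⟩ : ∃ t : ℕ → ℝ, (∀ n, 0 ≤ t n) ∧ (∀ n, t n < 1) ∧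
      Tendsto t atTop (𝓝 1) := by
    refine ⟨fun n => 1 - 1 / ((n : ℝ) + 1), fun n => ?_, fun n => ?_, ?_⟩
    · have : 1 / ((n : ℝ) + 1) ≤ 1 := by
        rw [div_le_one (by positivity)]
        linarith [n.cast_nonneg (α := ℝ)]
      linarith
    · have : 0 < 1 / ((n : ℝ) + 1) := by positivity
      linarith
    · simpa using tendsto_one_div_add_atTop_nhds_zero_nat.const_sub (1 : ℝ)
  have hnorm : ∀ n, ‖(t n : ℂ) * ζ‖ = t n := fun n => norm_ofReal_mul_unit hζ (ht0 n)
  have hmem : ∀ n, (t n : ℂ) * ζ ∈ ball (0 : ℂ) 1 := fun n => by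
    rw [mem_ball_zero_iff, hnorm]
    exact ht1 n
  obtain ⟨p, -, φ, hφ, hp⟩ := (hCb.isCompact_closure).tendsto_subseq
    (x := fun n => Y (t n * ζ)) fun n => subset_closure (hm (hmem n))
  have hev : ∀ a < 1, ∀ᶠ n in atTop, a ≤ t (φ n) := fun a ha =>
    (htt.comp hφ.tendsto_atTop).eventually_const_le ha
  refine ⟨p, ⟨mem_closure_of_tendsto hp (.of_forall fun n => mem_image_of_mem _ (hmem _)), ?_⟩, ?_⟩
  · rw [hC.isClosed_compl.mem_iff_infDist_zero hn]
    refine le_antisymm (le_of_forall_pos_le_add fun e he => ?_) infDist_nonneg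
    obtain ⟨a, ha, haY⟩ := hb e he
    rw [zero_add]
    refine le_of_tendsto ((continuous_infDist_pt Cᶜ).continuousAt.tendsto.comp hp) ?_
    filter_upwards [hev a ha] with n hna
    exact haY _ (by rwa [hnorm]) (by rw [hnorm]; exact ht1 _)
  · refine le_of_tendsto ((hp.sub_const x).norm) ?_
    filter_upwards [hev ρ hρ] with n hna
    exact hA _ hna (ht1 _)

/-- A disc in a convex domain close to a curve on its boundary. -/
lemma exists_initial_disc {C : Set R3} (hC : IsOpen C) (hconv : Convex ℝ C)
    (hCb : Bornology.IsBounded C) (hCn : C.Nonempty) (hn : Cᶜ.Nonempty) {γ : ℝ → R3}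
    (hγ : ContDiff ℝ 2 γ) (hγp : Periodic γ 1) (hγC : range γ ⊆ frontier C) {δ : ℝ} (hδ : 0 < δ) :
    ∃ R > 1, ∃ s X, Spin R s X ∧ (∀ z, ‖z‖ ≤ 1 → s z ≠ 0) ∧ (∀ z, ‖z‖ ≤ 1 → X z ∈ C) ∧
      (∀ z, ‖z‖ ≤ 1 → ∃ t, ‖X z - γ t‖ ≤ δ) ∧ (∀ z, ‖z‖ ≤ 1 → infDist (X z) Cᶜ ≤ δ) ∧
      ∀ t, ∃ ζ, ‖ζ‖ = 1 ∧ ‖X ζ - γ t‖ ≤ δ := by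
  obtain ⟨x₀, hx₀⟩ := hCn
  have hγf : ∀ t, γ t ∈ closure C ∧ γ t ∈ Cᶜ := fun t => by
    have := hγC (mem_range_self t)
    rwa [hC.frontier_eq] at this
  obtain ⟨D, hD⟩ := hCb.closure.subset_closedBall x₀
  have hD' : ∀ t, ‖x₀ - γ t‖ ≤ D := fun t => by
    have := hD (hγf t).1
    rwa [mem_closedBall, dist_comm, dist_eq_norm] at this
  have hD0 : 0 ≤ D := (norm_nonneg _).trans (hD' 0)
  obtain ⟨l, hl0, hl1, hl2⟩ : ∃ l, 0 < l ∧ l ≤ 1 ∧ l * D ≤ δ / 2 := by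
    refine ⟨min 1 (δ / (2 * (D + 1))), by positivity, min_le_left _ _, ?_⟩
    have h1 := min_le_right 1 (δ / (2 * (D + 1)))
    have h2 : 0 ≤ min 1 (δ / (2 * (D + 1))) := by positivity
    rw [le_div_iff₀ (by positivity)] at h1
    linarith
  obtain ⟨Γ, hΓ⟩ : ∃ Γ : ℝ → R3, Γ = fun t => γ t + l • (x₀ - γ t) := ⟨_, rfl⟩
  have hΓd : ContDiff ℝ 2 Γ := by
    rw [hΓ]
    fun_prop
  have hΓC : ∀ t, Γ t ∈ C := fun t => by
    rw [hΓ]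
    have := hconv.add_smul_sub_mem_interior' (hγf t).1 (hC.interior_eq.symm ▸ hx₀) ⟨hl0, hl1⟩
    rwa [hC.interior_eq] at this
  have hΓγ : ∀ t, ‖Γ t - γ t‖ ≤ δ / 2 := fun t => by
    rw [hΓ]
    dsimp only
    rw [add_sub_cancel_left, norm_smul, Real.norm_of_nonneg hl0.le]
    exact (mul_le_mul_of_nonneg_left (hD' t) hl0.le).trans hl2
  obtain ⟨a, -, ha⟩ := (isCompact_Icc (a := (0 : ℝ)) (b := 1)).exists_isMinOn (by simp)
    ((continuous_infDist_pt Cᶜ).comp hΓd.continuous).continuousOn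
  have hm0 := infDist_compl_pos hC hn (hΓC a)
  obtain ⟨R, hR, s, X, hX, hs, hXΓ, hΓX⟩ := exists_thin_minimal_disc hΓd
    (show 0 < min (infDist (Γ a) Cᶜ / 2) (δ / 2) by positivity)
  have hclose : ∀ x t, ‖x - Γ t‖ ≤ min (infDist (Γ a) Cᶜ / 2) (δ / 2) → ‖x - γ t‖ ≤ δ :=
    fun x t h => by
      have e1 := norm_add_le (x - Γ t) (Γ t - γ t)
      rw [sub_add_sub_cancel] at e1
      linarith [hΓγ t, min_le_right (infDist (Γ a) Cᶜ / 2) (δ / 2)]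
  refine ⟨R, hR, s, X, hX, hs, fun z hz => ?_, fun z hz => ?_, fun z hz => ?_, fun t => ?_⟩
  · obtain ⟨t, ht, hzt⟩ := hXΓ z hz
    have e1 : infDist (Γ a) Cᶜ ≤ infDist (Γ t) Cᶜ := ha ht
    exact mem_of_norm_sub_lt_infDist (x := Γ t)
      (by linarith [min_le_left (infDist (Γ a) Cᶜ / 2) (δ / 2)])
  · obtain ⟨t, ht, hzt⟩ := hXΓ z hz
    exact ⟨t, hclose _ _ hzt⟩
  · obtain ⟨t, ht, hzt⟩ := hXΓ z hz
    refine (infDist_le_dist_of_mem (hγf t).2).trans ?_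
    rw [dist_eq_norm]
    exact hclose _ _ hzt
  · obtain ⟨t', ht', htt⟩ := hγp.exists_mem_Ico₀ one_pos t
    obtain ⟨ζ, hζ, hζt⟩ := hΓX t' (Ico_subset_Icc_self ht')
    exact ⟨ζ, hζ, htt ▸ hclose _ _ hζt⟩

lemma exists_small_depth (r q : ℝ) {ε : ℝ} (hr : 0 < r) (hε : 0 < ε) :
    ∃ δ, 0 < δ ∧ δ ≤ r / 4 ∧ (√(2 * r * δ) + δ) / (1 - q) + 3 * δ + δ < ε := by
  have hc : Continuous fun δ : ℝ => (√(2 * r * δ) + δ) / (1 - q) + 3 * δ + δ := by fun_prop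
  have h1 : ∀ᶠ δ in 𝓝[>] (0 : ℝ), (√(2 * r * δ) + δ) / (1 - q) + 3 * δ + δ < ε :=
    (hc.tendsto 0).mono_left nhdsWithin_le_nhds |>.eventually_lt_const (by simpa using hε)
  have h2 : ∀ᶠ δ in 𝓝[>] (0 : ℝ), δ ≤ r / 4 :=
    nhdsWithin_le_nhds (eventually_le_nhds (by positivity))
  obtain ⟨δ, h1, h2, h3⟩ := (h1.and (h2.and self_mem_nhdsWithin)).exists
  exact ⟨δ, h3, h2, h1⟩

end NullDisc

/-- **Theorem A.** For a regular strictly convex bounded domain `C ⊆ ℝ³`, a smooth Jordan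
curve `Γ ⊆ ∂C` and `ε > 0`, there is a complete proper conformal minimal immersion
`ψ : 𝔻 → C` whose limit set is a nonempty compact set at Hausdorff distance `< ε` from `Γ`. -/
theorem statement0 (C : Set R3) (hC : RegStrictConvexDomain C)
    (γ : ℝ → R3) (hγ : SmoothJordan γ) (hΓC : range γ ⊆ frontier C)
    (ε : ℝ) (hε : 0 < ε) :
    ∃ ψ : ℂ → R3,
      ConfMinImmOn ψ (ball (0:ℂ) 1) ∧
      CompleteOn ψ (ball (0:ℂ) 1) ∧
      MapsTo ψ (ball (0:ℂ) 1) C ∧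
      ProperIn ψ (ball (0:ℂ) 1) C ∧
      (limitSet ψ).Nonempty ∧
      IsCompact (limitSet ψ) ∧
      hausdorffDist (limitSet ψ) (range γ) < ε := by
  obtain ⟨hCn, hCo, hconv, hCb, r, R₀, hr, hrR, hsph⟩ := hC
  have hn : Cᶜ.Nonempty := by
    rw [nonempty_compl]
    rintro rfl
    exact NormedSpace.unbounded_univ ℝ R3 hCb
  have hR₀ : 0 < R₀ := hr.trans_le hrR
  have hfrac : r / (8 * R₀) ≤ 1 / 8 := by
    rw [div_le_iff₀ (by positivity)]
    linarith
  have hfrac0 : 0 < r / (8 * R₀) := by positivity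
  obtain ⟨q, hq⟩ : ∃ q, q = √(1 - r / (8 * R₀)) := ⟨_, rfl⟩
  have hq2 : q ^ 2 = 1 - r / (8 * R₀) := by rw [hq, Real.sq_sqrt (by linarith)]
  have hq0 : 0 < q := hq ▸ Real.sqrt_pos.2 (by linarith)
  have hq1 : q < 1 := by nlinarith
  obtain ⟨δ, hδ0, hδr, hδε⟩ := NullDisc.exists_small_depth r q hr hε
  obtain ⟨A, hA⟩ : ∃ A, A = (√(2 * r * δ) + δ) / (1 - q) + 3 * δ := ⟨_, rfl⟩
  have hA0 : 0 ≤ A := by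
    have : 0 < 1 - q := by linarith
    rw [hA]
    positivity
  rw [← hA] at hδε
  obtain ⟨R, hR, s, X, hX, hs, hXC, hXγ, hXd, hγX⟩ := NullDisc.exists_initial_disc hCo hconv hCb
    hCn hn (contDiff_infty.1 hγ.1 2) hγ.2.1 hΓC hδ0
  obtain ⟨S, Y, hY, hSY, hgrow, hb, ρ, hρ0, hρ1, hYX⟩ := NullDisc.exists_complete_spin hCo hn hr hrR
    (fun x hx => NullDisc.exists_normalAt hCo hconv hn hr hrR hsph hx) hR hX hXC hδ0
    (fun ζ hζ => hXd ζ hζ.le) hδr hs hq0 hq1 hq2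
  rw [← hA] at hYX
  have hS : ∀ z ∈ ball (0 : ℂ) 1, S z ≠ 0 := fun z hz => (hSY z (mem_ball_zero_iff.1 hz)).1
  have hYC : MapsTo Y (ball 0 1) C := fun z hz => (hSY z (mem_ball_zero_iff.1 hz)).2
  have hYc := NullDisc.Spin.continuousOn hY
  have hprop := NullDisc.properIn_of_infDist hCo hn hYc hb
  have hlim := NullDisc.limitSet_eq_of_properIn hCo hYc hYC hprop
  have hnear : ∀ t, ∃ p ∈ limitSet Y, dist (γ t) p ≤ A + δ := fun t => by
    obtain ⟨ζ, hζ, hζt⟩ := hγX t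
    obtain ⟨p, hp, hpA⟩ := NullDisc.exists_mem_limitSet hCo hn hCb hYC hb hζ hρ1 (hYX ζ hζ)
    refine ⟨p, hlim ▸ hp, ?_⟩
    have e1 := norm_add_le (p - X ζ) (X ζ - γ t)
    rw [sub_add_sub_cancel] at e1
    rw [dist_comm, dist_eq_norm]
    linarith
  refine ⟨Y, hY.confMinImmOn hS, hY.completeOn hS hgrow, hYC, hprop, ?_, ?_, ?_⟩
  · obtain ⟨p, hp, -⟩ := hnear 0
    exact ⟨p, hp⟩
  · rw [hlim]
    exact (hCb.subset hYC.image_subset).isCompact_closure.inter_right hCo.isClosed_compl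
  · refine (hausdorffDist_le_of_infDist (by positivity) (fun p hp => ?_) ?_).trans_lt hδε
    · have hsub : closedBall (0 : ℂ) ρ ⊆ ball 0 1 := closedBall_subset_ball hρ1
      have hcl : IsClosed (Y '' closedBall (0 : ℂ) ρ ∪ {x | infDist x (range γ) ≤ A + δ}) :=
        ((isCompact_closedBall (0 : ℂ) ρ).image_of_continuousOn (hYc.mono hsub)).isClosed.union
          (isClosed_le (continuous_infDist_pt _) continuous_const)
      have hcov : Y '' ball 0 1 ⊆ Y '' closedBall (0 : ℂ) ρ ∪ {x | infDist x (range γ) ≤ A + δ} := by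
        rintro _ ⟨z, hz, rfl⟩
        rcases le_total ‖z‖ ρ with h | h
        · exact Or.inl ⟨z, mem_closedBall_zero_iff.2 h, rfl⟩
        · refine Or.inr ?_
          obtain ⟨ζ, hζ, hzζ⟩ := NullDisc.exists_unit_smul z
          obtain ⟨t, ht⟩ := hXγ ζ hζ.le
          have e1 := hYX ζ hζ ‖z‖ h (mem_ball_zero_iff.1 hz)
          rw [← hzζ] at e1
          have e2 := norm_add_le (Y z - X ζ) (X ζ - γ t)
          rw [sub_add_sub_cancel] at e2
          refine (infDist_le_dist_of_mem (mem_range_self t)).trans ?_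
          rw [dist_eq_norm]
          linarith
      rcases closure_minimal hcov hcl hp.1 with h | h
      · exact absurd (image_mono hsub h) hp.2
      · exact h
    · rintro _ ⟨t, rfl⟩
      obtain ⟨p, hp, hpt⟩ := hnear t
      exact (infDist_le_dist_of_mem hp).trans hpt
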